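/- If (n, m, k, ℓ) is a solution of the equation F^(k)_n · F^(k)_m = P_ℓ in positive integers with k ≥ 3, n > m ≥ 3 and n ≥ k + 2, then n < 8.3 × 10^{30} k^8 (log k)^5 and ℓ < 1.7 × 10^{31} k^8 (log k)^5. -/

import Mathlib

/-- The Pell sequence: `P 0 = 0`, `P 1 = 1`, `P (ℓ+2) = 2 P (ℓ+1) + P ℓ`. -/
def pell : ℕ → ℤ
  | 0 => 0
  | 1 => 1
  | n + 2 => 2 * pell (n + 1) + pell n

/-- `kfib k j` is the `k`-generalized Fibonacci number `F⁽ᵏ⁾_n` with shifted index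
`j = n + k - 2` (so `j = 0` corresponds to `n = 2 - k`).  Thus `kfib k j = 0` for
`0 ≤ j ≤ k - 2` (these are `F⁽ᵏ⁾_{2-k} = ⋯ = F⁽ᵏ⁾_0 = 0`), `kfib k (k - 1) = 1`
(this is `F⁽ᵏ⁾_1 = 1`), and every later term is the sum of the preceding `k` terms
(junk value `0` if `k < 2`). -/
def kfib (k : ℕ) : ℕ → ℤ
  | j =>
    if k < 2 then 0
    else if j < k - 1 then 0
    else if j = k - 1 then 1
    else ∑ i ∈ Finset.range k, kfib k (j - 1 - i)
decreasing_by omega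

section

open MvPolynomial

/-- Polynomials in `n` variables whose degree in the `i`-th variable is less than `D i`. -/
noncomputable def polyBox {n : ℕ} (D : Fin n → ℕ) : Submodule ℝ (MvPolynomial (Fin n) ℝ) :=
  restrictSupport ℝ {m | ∀ i, m i < D i}

lemma mem_polyBox {n : ℕ} {D : Fin n → ℕ} {P : MvPolynomial (Fin n) ℝ} :
    P ∈ polyBox D ↔ ∀ m ∈ P.support, ∀ i, m i < D i := by
  rw [polyBox, mem_restrictSupport_iff]; rfl

lemma mem_polyBox_of_degreeOf_lt {n : ℕ} {D : Fin n → ℕ} {P : MvPolynomial (Fin n) ℝ}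
    (h : ∀ i, degreeOf i P < D i) : P ∈ polyBox D := by
  rw [mem_polyBox]
  intro m hm i
  exact (degreeOf_lt_iff ((Nat.zero_le _).trans_lt (h i))).1 (h i) m hm

lemma degreeOf_lt_of_mem_polyBox {n : ℕ} {D : Fin n → ℕ} {P : MvPolynomial (Fin n) ℝ}
    (hP : P ≠ 0) (h : P ∈ polyBox D) (i : Fin n) : degreeOf i P < D i := by
  rw [mem_polyBox] at h
  obtain ⟨m, hm⟩ := support_nonempty.2 hP
  exact (degreeOf_lt_iff ((Nat.zero_le _).trans_lt (h m hm i))).2 fun m hm => h m hm i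

/-- The exponents of a box are the tuples of bounded naturals. -/
noncomputable def boxExponentEquiv {n : ℕ} (D : Fin n → ℕ) :
    {m : Fin n →₀ ℕ | ∀ i, m i < D i} ≃ ((i : Fin n) → Fin (D i)) where
  toFun m := fun i => ⟨m.1 i, m.2 i⟩
  invFun f := ⟨Finsupp.equivFunOnFinite.symm fun i => (f i : ℕ), fun i => (f i).2⟩
  left_inv m := by ext; rfl
  right_inv f := by ext; rfl

instance {n : ℕ} (D : Fin n → ℕ) : Finite {m : Fin n →₀ ℕ | ∀ i, m i < D i} :=
  Finite.of_equiv _ (boxExponentEquiv D).symm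

instance {n : ℕ} (D : Fin n → ℕ) : FiniteDimensional ℝ (polyBox D) :=
  Module.Finite.of_basis (basisRestrictSupport ℝ {m | ∀ i, m i < D i})

lemma finrank_polyBox {n : ℕ} (D : Fin n → ℕ) : Module.finrank ℝ (polyBox D) = ∏ i, D i := by
  have h := Module.finrank_eq_nat_card_basis (basisRestrictSupport ℝ {m : Fin n →₀ ℕ | ∀ i, m i < D i})
  rw [polyBox, h, Nat.card_congr (boxExponentEquiv D)]
  simp

/-- Multiples of `P` by elements of a box. -/
noncomputable def boxMul {n : ℕ} (P : MvPolynomial (Fin n) ℝ) (D : Fin n → ℕ) :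
    Submodule ℝ (MvPolynomial (Fin n) ℝ) :=
  (polyBox D).map (LinearMap.mulLeft ℝ P)

instance {n : ℕ} (P : MvPolynomial (Fin n) ℝ) (D : Fin n → ℕ) : FiniteDimensional ℝ (boxMul P D) := by
  unfold boxMul; infer_instance

lemma finrank_boxMul {n : ℕ} {P : MvPolynomial (Fin n) ℝ} (hP : P ≠ 0) (D : Fin n → ℕ) :
    Module.finrank ℝ (boxMul P D) = ∏ i, D i := by
  rw [boxMul, LinearEquiv.finrank_eq (Submodule.equivMapOfInjective _ ?_ (polyBox D)).symm,
    finrank_polyBox]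
  exact mul_right_injective₀ hP

lemma mem_boxMul_le {n : ℕ} {P : MvPolynomial (Fin n) ℝ} (hP : P ≠ 0) {D E : Fin n → ℕ}
    (h : ∀ i, degreeOf i P + D i ≤ E i) : boxMul P D ≤ polyBox E := by
  rintro _ ⟨a, ha, rfl⟩
  by_cases ha0 : a = 0
  · subst ha0; simp
  · apply mem_polyBox_of_degreeOf_lt
    intro i
    rw [LinearMap.mulLeft_apply, degreeOf_mul_eq hP ha0]
    have := degreeOf_lt_of_mem_polyBox ha0 ha i
    have := h i
    omega

lemma boxMul_inf_le {n : ℕ} {P R : MvPolynomial (Fin n) ℝ} (hR : R ≠ 0)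
    (hPR : IsRelPrime P R) (D : Fin n → ℕ) :
    boxMul P (fun i => D i - degreeOf i P) ⊓ boxMul R (fun i => D i - degreeOf i R) ≤
      boxMul (P * R) (fun i => D i - degreeOf i P - degreeOf i R) := by
  rintro x ⟨⟨a, ha, rfl⟩, ⟨b, hb, hab⟩⟩
  simp only [LinearMap.mulLeft_apply] at hab ⊢
  by_cases ha0 : a = 0
  · subst ha0; simp
  have h1 : R ∣ P * a := ⟨b, hab.symm⟩
  obtain ⟨c, rfl⟩ := hPR.symm.dvd_of_dvd_mul_left h1
  refine ⟨c, ?_, by simp [LinearMap.mulLeft_apply]⟩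
  have hc0 : c ≠ 0 := right_ne_zero_of_mul ha0
  apply mem_polyBox_of_degreeOf_lt
  intro i
  have := degreeOf_lt_of_mem_polyBox ha0 ha i
  rw [degreeOf_mul_eq hR hc0] at this
  omega

/-- A family of polynomials in a box which is linearly independent modulo two coprime
polynomials cannot be large. -/
lemma card_add_le_of_independent_mod {n : ℕ} {P R : MvPolynomial (Fin n) ℝ} (hP : P ≠ 0)
    (hR : R ≠ 0) (hPR : IsRelPrime P R) (D : Fin n → ℕ)
    (hD : ∀ i, degreeOf i P + degreeOf i R ≤ D i) {ι : Type*} [Fintype ι]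
    (f : ι → MvPolynomial (Fin n) ℝ) (hf : ∀ j, f j ∈ polyBox D)
    (hind : ∀ c : ι → ℝ, ∑ j, C (c j) * f j ∈ Ideal.span {P, R} → c = 0) :
    Fintype.card ι + ∏ i, (D i - degreeOf i P) + ∏ i, (D i - degreeOf i R) ≤
      ∏ i, D i + ∏ i, (D i - degreeOf i P - degreeOf i R) := by
  set S₁ := boxMul P (fun i => D i - degreeOf i P) with hS₁
  set S₂ := boxMul R (fun i => D i - degreeOf i R) with hS₂
  set W := Submodule.span ℝ (Set.range f) with hW
  have hle : ∀ x ∈ S₁ ⊔ S₂, x ∈ Ideal.span {P, R} := by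
    intro x hx
    obtain ⟨y, ⟨a, -, rfl⟩, z, ⟨b, -, rfl⟩, rfl⟩ := Submodule.mem_sup.1 hx
    rw [Ideal.mem_span_pair]
    exact ⟨a, b, by simp [LinearMap.mulLeft_apply, mul_comm]⟩
  have hli : LinearIndependent ℝ f := by
    rw [Fintype.linearIndependent_iff]
    intro c hc i
    have : c = 0 := hind c (by
      have : ∑ j, C (c j) * f j = 0 := by rw [← hc]; simp [smul_eq_C_mul]
      rw [this]; exact Ideal.zero_mem _)
    rw [this]; rfl
  have hWr : Module.finrank ℝ W = Fintype.card ι := finrank_span_eq_card hli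
  have hWinf : W ⊓ (S₁ ⊔ S₂) = ⊥ := by
    rw [eq_bot_iff]
    rintro x ⟨hx1, hx2⟩
    obtain ⟨c, rfl⟩ := (Submodule.mem_span_range_iff_exists_fun ℝ).1 hx1
    have h := hle _ hx2
    simp only [smul_eq_C_mul] at h ⊢
    rw [hind c h]; simp
  have hWfin : FiniteDimensional ℝ W := FiniteDimensional.span_of_finite ℝ (Set.finite_range f)
  have hbox : W ⊔ (S₁ ⊔ S₂) ≤ polyBox D := by
    refine sup_le ?_ (sup_le ?_ ?_)
    · rw [hW, Submodule.span_le]; rintro _ ⟨j, rfl⟩; exact hf j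
    · exact mem_boxMul_le hP fun i => by have := hD i; omega
    · exact mem_boxMul_le hR fun i => by have := hD i; omega
  have e1 := Submodule.finrank_sup_add_finrank_inf_eq W (S₁ ⊔ S₂)
  have e2 := Submodule.finrank_sup_add_finrank_inf_eq S₁ S₂
  have e3 := Submodule.finrank_mono hbox
  have e4 : Module.finrank ℝ (S₁ ⊓ S₂ : Submodule ℝ _) ≤ _ :=
    Submodule.finrank_mono (boxMul_inf_le hR hPR D)
  rw [finrank_boxMul (mul_ne_zero hP hR)] at e4
  rw [hWinf, finrank_bot] at e1
  rw [finrank_boxMul hP, finrank_boxMul hR] at e2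
  rw [finrank_polyBox] at e3
  omega

/-- The mixed degree of `P` and `R` in the two variables other than `i`. -/
noncomputable def mixedDegree (P R : MvPolynomial (Fin 3) ℝ) (i : Fin 3) : ℕ :=
  degreeOf (i + 1) P * degreeOf (i + 2) R + degreeOf (i + 2) P * degreeOf (i + 1) R

/-- A Bézout-type bound: a family independent modulo two coprime polynomials in three variables. -/
lemma card_le_of_independent_mod {P R : MvPolynomial (Fin 3) ℝ} (hP : P ≠ 0)
    (hR : R ≠ 0) (hPR : IsRelPrime P R) (D : Fin 3 → ℕ)
    (hD : ∀ i, degreeOf i P + degreeOf i R ≤ D i) {ι : Type*} [Fintype ι]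
    (f : ι → MvPolynomial (Fin 3) ℝ) (hf : ∀ j, f j ∈ polyBox D)
    (hind : ∀ c : ι → ℝ, ∑ j, C (c j) * f j ∈ Ideal.span {P, R} → c = 0) :
    Fintype.card ι ≤ ∑ i, D i * mixedDegree P R i := by
  have h := card_add_le_of_independent_mod hP hR hPR D hD f hf hind
  simp only [Fin.prod_univ_three, Fin.sum_univ_three, mixedDegree] at h ⊢
  simp only [zero_add, show (1 : Fin 3) + 1 = 2 from rfl, show (1 : Fin 3) + 2 = 0 from rfl,
    show (2 : Fin 3) + 1 = 0 from rfl, show (2 : Fin 3) + 2 = 1 from rfl]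
  have h0 := hD 0
  have h1 := hD 1
  have h2 := hD 2
  generalize D 0 = d0 at *
  generalize D 1 = d1 at *
  generalize D 2 = d2 at *
  generalize degreeOf 0 P = p0 at *
  generalize degreeOf 1 P = p1 at *
  generalize degreeOf 2 P = p2 at *
  generalize degreeOf 0 R = r0 at *
  generalize degreeOf 1 R = r1 at *
  generalize degreeOf 2 R = r2 at *
  obtain ⟨a0, rfl⟩ := Nat.exists_eq_add_of_le h0
  obtain ⟨a1, rfl⟩ := Nat.exists_eq_add_of_le h1
  obtain ⟨a2, rfl⟩ := Nat.exists_eq_add_of_le h2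
  have e : ∀ p r a : ℕ, p + r + a - p = r + a ∧ p + r + a - r = p + a := by
    intro p r a; omega
  rw [(e p0 r0 a0).1, (e p1 r1 a1).1, (e p2 r2 a2).1, (e p0 r0 a0).2, (e p1 r1 a1).2,
    (e p2 r2 a2).2, Nat.add_sub_cancel_left, Nat.add_sub_cancel_left,
    Nat.add_sub_cancel_left] at h
  zify at h ⊢
  have : (0:ℤ) ≤ p0*p1*r2+p0*r1*p2+r0*p1*p2 + p0*r1*r2+ r0*p1*r2 + r0*r1*p2 := by positivity
  linarith

end

section

open MvPolynomial

/-- The univariate polynomial with given coefficients. -/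
noncomputable def polyOfCoeffs {J : ℕ} (c : Fin J → ℝ) : Polynomial ℝ :=
  ∑ j, Polynomial.C (c j) * Polynomial.X ^ (j : ℕ)

lemma polyOfCoeffs_coeff {J : ℕ} (c : Fin J → ℝ) (j : Fin J) :
    (polyOfCoeffs c).coeff j = c j := by
  simp [polyOfCoeffs, Polynomial.finsetSum_coeff, Polynomial.coeff_X_pow, Fin.val_inj]

lemma polyOfCoeffs_eq_zero {J : ℕ} {c : Fin J → ℝ} (h : polyOfCoeffs c = 0) : c = 0 := by
  funext j
  rw [← polyOfCoeffs_coeff c j, h]; simp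

lemma degree_polyOfCoeffs_lt {J : ℕ} (c : Fin J → ℝ) : (polyOfCoeffs c).degree < J := by
  refine lt_of_le_of_lt (Polynomial.degree_sum_le _ _) ?_
  rw [Finset.sup_lt_iff (by exact WithBot.bot_lt_coe J)]
  intro j _
  exact lt_of_le_of_lt (Polynomial.degree_C_mul_X_pow_le _ _) (by exact_mod_cast j.2)

lemma aeval_polyOfCoeffs {J : ℕ} (c : Fin J → ℝ) (x : MvPolynomial (Fin 3) ℝ) :
    Polynomial.aeval x (polyOfCoeffs c) = ∑ j, C (c j) * x ^ (j : ℕ) := by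
  simp [polyOfCoeffs, algebraMap_eq]

lemma card_primes_le {P R : MvPolynomial (Fin 3) ℝ} (hP : P ≠ 0) (hR : R ≠ 0)
    (hPR : IsRelPrime P R) (i : Fin 3) {ι : Type*} [Fintype ι] 
    (p : ι → Ideal (MvPolynomial (Fin 3) ℝ)) (hp : ∀ l, (p l).IsPrime)
    (hinc : ∀ l l', l ≠ l' → ¬ p l ≤ p l') (hPp : ∀ l, P ∈ p l) (hRp : ∀ l, R ∈ p l)
    (htr : ∀ l, ∀ g : Polynomial ℝ, Polynomial.aeval (X i : MvPolynomial (Fin 3) ℝ) g ∈ p l → g = 0) :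
    Fintype.card ι ≤ mixedDegree P R i := by
  classical
  have hx : ∀ l l' : ι, ∃ x : MvPolynomial (Fin 3) ℝ, l ≠ l' → x ∈ p l' ∧ x ∉ p l := by
    intro l l'
    by_cases h : l = l'
    · exact ⟨0, fun h' => absurd h h'⟩
    · obtain ⟨x, hx1, hx2⟩ := Set.not_subset.1 (hinc l' l (Ne.symm h))
      exact ⟨x, fun _ => ⟨hx1, hx2⟩⟩
  choose x hx using hx
  set ε : ι → MvPolynomial (Fin 3) ℝ := fun l => ∏ l' ∈ Finset.univ.erase l, x l l' with hε
  have hε1 : ∀ l, ε l ∉ p l := by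
    intro l h
    have := hp l
    obtain ⟨l', hl', h'⟩ := (Ideal.IsPrime.prod_mem_iff).1 h
    exact (hx l l' (Finset.ne_of_mem_erase hl').symm).2 h'
  have hε2 : ∀ l l', l ≠ l' → ε l' ∈ p l := by
    intro l l' h
    exact Ideal.mem_of_dvd _ (Finset.dvd_prod_of_mem _ (Finset.mem_erase.2 ⟨h, Finset.mem_univ _⟩))
      (hx l' l h.symm).1
  by_contra! hlt
  set B : Fin 3 → ℕ := fun j => ∑ l, degreeOf j (ε l) + degreeOf j P + degreeOf j R + 1 with hB
  set J := ∑ j, B j * mixedDegree P R j + 1 with hJ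
  have key := card_le_of_independent_mod hP hR hPR (fun j => B j + if j = i then J else 0)
    (fun j => by simp only [hB]; omega) (ι := ι × Fin J) (fun a => ε a.1 * X i ^ (a.2 : ℕ)) ?_ ?_
  · rw [Fintype.card_prod, Fintype.card_fin] at key
    simp only [add_mul, Finset.sum_add_distrib, ite_mul, zero_mul, Finset.sum_ite_eq',
      Finset.mem_univ, if_true] at key
    have : (mixedDegree P R i + 1) * J ≤ Fintype.card ι * J := Nat.mul_le_mul_right _ hlt
    rw [add_mul, one_mul, mul_comm _ J] at this
    omega
  · rintro ⟨l, j⟩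
    apply mem_polyBox_of_degreeOf_lt
    intro i'
    have h1 : degreeOf i' (ε l) ≤ ∑ l, degreeOf i' (ε l) :=
      Finset.single_le_sum (f := fun l => degreeOf i' (ε l)) (fun _ _ => Nat.zero_le _) (Finset.mem_univ l)
    have h2 := degreeOf_mul_le i' (ε l) (X i ^ (j : ℕ))
    have h3 := degreeOf_pow_le i' (X i : MvPolynomial (Fin 3) ℝ) (j : ℕ)
    have hj := j.2
    by_cases hi : i' = i
    · subst hi
      rw [degreeOf_X_self] at h3
      simp only [hB, if_true]; omega
    · rw [degreeOf_X_of_ne hi] at h3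
      simp only [hB, if_neg hi]; omega
  · intro c hc
    funext ⟨l, j⟩
    have := hp l
    have hsub : Ideal.span {P, R} ≤ p l := by
      rw [Ideal.span_le]; rintro z (rfl | rfl)
      · exact hPp l
      · exact hRp l
    have h := hsub hc
    rw [Fintype.sum_prod_type] at h
    have e : ∀ l', ∑ j : Fin J, C (c (l', j)) * (ε l' * X i ^ (j : ℕ)) =
        ε l' * Polynomial.aeval (X i) (polyOfCoeffs fun j => c (l', j)) := by
      intro l'
      rw [aeval_polyOfCoeffs, Finset.mul_sum]
      exact Finset.sum_congr rfl fun _ _ => by ring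
    simp only [e] at h
    rw [← Finset.add_sum_erase _ _ (Finset.mem_univ l)] at h
    have h2 : ε l * Polynomial.aeval (X i) (polyOfCoeffs fun j => c (l, j)) ∈ p l := by
      refine (Ideal.add_mem_iff_left _ (Ideal.sum_mem _ fun l' hl' => ?_)).1 h
      exact Ideal.mul_mem_right _ _ (hε2 l l' (Finset.ne_of_mem_erase hl').symm)
    have h3 := ((hp l).mem_or_mem h2).resolve_left (hε1 l)
    exact congrFun (polyOfCoeffs_eq_zero (htr l _ h3)) j

lemma degreeOf_aeval_le_sup {n : ℕ} (i : Fin n) (g : Fin n → MvPolynomial (Fin n) ℝ)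
    (P : MvPolynomial (Fin n) ℝ) : degreeOf i (aeval g P) ≤
      P.support.sup fun m => ∑ j ∈ m.support, m j * degreeOf i (g j) := by
  rw [aeval_def, eval₂_eq, algebraMap_eq]
  refine (degreeOf_sum_le _ _ _).trans (Finset.sup_mono_fun fun m hm => ?_)
  refine (degreeOf_C_mul_le _ _ _).trans ((degreeOf_prod_le _ _ _).trans ?_)
  exact Finset.sum_le_sum fun j _ => degreeOf_pow_le _ _ _

lemma degreeOf_aeval_le {n : ℕ} (i k : Fin n) (g : Fin n → MvPolynomial (Fin n) ℝ)
    (hg : ∀ j, degreeOf i (g j) ≤ if j = k then 1 else 0) (P : MvPolynomial (Fin n) ℝ) :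
    degreeOf i (aeval g P) ≤ degreeOf k P := by
  refine (degreeOf_aeval_le_sup i g P).trans (Finset.sup_le fun m hm => ?_)
  calc ∑ j ∈ m.support, m j * degreeOf i (g j) ≤ ∑ j ∈ m.support, if j = k then m k else 0 := by
        refine Finset.sum_le_sum fun j _ => ?_
        refine (Nat.mul_le_mul_left _ (hg j)).trans ?_
        split_ifs with h
        · rw [h, mul_one]
        · simp
    _ ≤ m k := by rw [Finset.sum_ite_eq']; split_ifs <;> simp
    _ ≤ degreeOf k P := by rw [degreeOf_eq_sup]; exact Finset.le_sup (f := fun m => m k) hm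

lemma degreeOf_aeval_eq_zero {n : ℕ} (i : Fin n) (g : Fin n → MvPolynomial (Fin n) ℝ)
    (hg : ∀ j, degreeOf i (g j) = 0) (P : MvPolynomial (Fin n) ℝ) :
    degreeOf i (aeval g P) = 0 := by
  refine Nat.le_zero.1 ((degreeOf_aeval_le_sup i g P).trans (Finset.sup_le fun m hm => ?_))
  simp [hg]

lemma degreeOf_X_le {n : ℕ} (i j : Fin n) :
    degreeOf i (X j : MvPolynomial (Fin n) ℝ) ≤ if j = i then 1 else 0 := by
  split_ifs with h
  · rw [h, degreeOf_X_self]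
  · rw [degreeOf_X_of_ne (Ne.symm h)]

/-- Substitution of a constant for one variable. -/
noncomputable def specialize {n : ℕ} (i : Fin n) (c : ℝ) :
    MvPolynomial (Fin n) ℝ →ₐ[ℝ] MvPolynomial (Fin n) ℝ :=
  aeval (Function.update X i (C c))

lemma specialize_X_self {n : ℕ} (i : Fin n) (c : ℝ) : specialize i c (X i) = C c := by
  simp [specialize]

lemma specialize_X_of_ne {n : ℕ} {i j : Fin n} (h : j ≠ i) (c : ℝ) :
    specialize i c (X j) = X j := by
  simp [specialize, Function.update_of_ne h]

lemma eval_specialize {n : ℕ} (i : Fin n) (c : ℝ) (x : Fin n → ℝ) (P : MvPolynomial (Fin n) ℝ) :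
    eval x (specialize i c P) = eval (Function.update x i c) P := by
  have : (aeval x).comp (specialize i c) =
      (aeval (Function.update x i c) : MvPolynomial (Fin n) ℝ →ₐ[ℝ] ℝ) := by
    apply algHom_ext
    intro j
    by_cases h : j = i
    · subst h; simp [specialize]
    · simp [specialize, Function.update_of_ne h]
  have h := congrArg (fun φ => φ P) this
  simpa [aeval_eq_eval] using h

lemma degreeOf_specialize_self {n : ℕ} (i : Fin n) (c : ℝ) (P : MvPolynomial (Fin n) ℝ) :
    degreeOf i (specialize i c P) = 0 := by
  refine degreeOf_aeval_eq_zero i _ (fun j => ?_) P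
  by_cases h : j = i
  · subst h; simp [degreeOf_C]
  · rw [Function.update_of_ne h, degreeOf_X_of_ne (Ne.symm h)]

lemma X_sub_C_dvd_sub_specialize {n : ℕ} (i : Fin n) (c : ℝ) (P : MvPolynomial (Fin n) ℝ) :
    X i - C c ∣ P - specialize i c P := by
  rw [← Ideal.mem_span_singleton, ← Ideal.Quotient.eq_zero_iff_mem, map_sub, sub_eq_zero]
  have : (Ideal.Quotient.mkₐ ℝ (Ideal.span {X i - C c})) =
      (Ideal.Quotient.mkₐ ℝ (Ideal.span {X i - C c})).comp (specialize i c) := by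
    apply algHom_ext
    intro j
    by_cases h : j = i
    · subst h
      simp only [AlgHom.comp_apply, specialize_X_self, Ideal.Quotient.mkₐ_eq_mk]
      rw [Ideal.Quotient.eq]
      exact Ideal.mem_span_singleton_self _
    · simp [AlgHom.comp_apply, specialize_X_of_ne h]
  exact congrArg (fun φ => φ P) this

lemma eval_congr_of_degreeOf_eq_zero {n : ℕ} {i : Fin n} {P : MvPolynomial (Fin n) ℝ}
    (h : degreeOf i P = 0) {x y : Fin n → ℝ} (hxy : ∀ j, j ≠ i → x j = y j) :
    eval x P = eval y P := by
  rw [eval_eq', eval_eq']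
  refine Finset.sum_congr rfl fun m hm => ?_
  congr 1
  refine Finset.prod_congr rfl fun j _ => ?_
  by_cases hj : j = i
  · subst hj
    have : m j ≤ degreeOf j P := by
      rw [degreeOf_eq_sup]; exact Finset.le_sup (f := fun m => m j) hm
    rw [h, Nat.le_zero] at this
    rw [this, pow_zero, pow_zero]
  · rw [hxy j hj]

lemma degreeOf_eq_zero_of_eval {n : ℕ} {i : Fin n} {P : MvPolynomial (Fin n) ℝ}
    (h : ∀ x, eval x P = eval (Function.update x i 0) P) : degreeOf i P = 0 := by
  have : P = specialize i 0 P := MvPolynomial.funext fun x => by rw [eval_specialize, h]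
  rw [this]; exact degreeOf_specialize_self _ _ _

section Translation

variable {G : Type*} [AddCommGroup G] (v u w : G →+ ℝ)

/-- The automorphism of the polynomial ring induced by translation by `g`. -/
noncomputable def transl (g : G) : MvPolynomial (Fin 3) ℝ →ₐ[ℝ] MvPolynomial (Fin 3) ℝ :=
  aeval ![X 0 + C (v g), X 1 + C (u g), C (Real.exp (w g)) * X 2]

/-- The point attached to `g`. -/
noncomputable def pt (g : G) : Fin 3 → ℝ := ![v g, u g, Real.exp (w g)]

lemma transl_zero (P : MvPolynomial (Fin 3) ℝ) : transl v u w 0 P = P := by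
  have : transl v u w 0 = AlgHom.id ℝ _ := by
    apply algHom_ext
    intro i
    fin_cases i <;> simp [transl]
  rw [this]; rfl

lemma transl_add (g h : G) (P : MvPolynomial (Fin 3) ℝ) :
    transl v u w (g + h) P = transl v u w g (transl v u w h P) := by
  have : transl v u w (g + h) = (transl v u w g).comp (transl v u w h) := by
    apply algHom_ext
    intro i
    fin_cases i
    · simp [transl, algHom_C, algebraMap_eq]; ring
    · simp [transl, algHom_C, algebraMap_eq]; ring
    · simp [transl, algHom_C, algebraMap_eq, Real.exp_add]; ring
  rw [this]; rfl

lemma eval_transl (g h : G) (P : MvPolynomial (Fin 3) ℝ) :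
    eval (pt v u w h) (transl v u w g P) = eval (pt v u w (g + h)) P := by
  have : (aeval (pt v u w h)).comp (transl v u w g) = (aeval (pt v u w (g + h)) : _ →ₐ[ℝ] ℝ) := by
    apply algHom_ext
    intro i
    fin_cases i
    · simp [transl, pt]; ring
    · simp [transl, pt]; ring
    · simp [transl, pt, Real.exp_add]
  have h := congrArg (fun φ => φ P) this
  simpa [aeval_eq_eval] using h

lemma transl_neg_transl (g : G) (P : MvPolynomial (Fin 3) ℝ) :
    transl v u w (-g) (transl v u w g P) = P := by
  rw [← transl_add, neg_add_cancel, transl_zero]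

lemma transl_transl_neg (g : G) (P : MvPolynomial (Fin 3) ℝ) :
    transl v u w g (transl v u w (-g) P) = P := by
  rw [← transl_add, add_neg_cancel, transl_zero]

/-- Translation as an algebra equivalence. -/
noncomputable def translEquiv (g : G) : MvPolynomial (Fin 3) ℝ ≃ₐ[ℝ] MvPolynomial (Fin 3) ℝ :=
  AlgEquiv.ofAlgHom (transl v u w g) (transl v u w (-g))
    (AlgHom.ext fun P => transl_transl_neg v u w g P)
    (AlgHom.ext fun P => transl_neg_transl v u w g P)

lemma translEquiv_apply (g : G) (P : MvPolynomial (Fin 3) ℝ) :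
    translEquiv v u w g P = transl v u w g P := rfl

lemma transl_ne_zero (g : G) {P : MvPolynomial (Fin 3) ℝ} (hP : P ≠ 0) : transl v u w g P ≠ 0 := by
  rw [← translEquiv_apply]; simpa using hP

lemma degreeOf_transl_le (g : G) (P : MvPolynomial (Fin 3) ℝ) (i : Fin 3) :
    degreeOf i (transl v u w g P) ≤ degreeOf i P := by
  have hgen : ∀ j : Fin 3, degreeOf i ((![X 0 + C (v g), X 1 + C (u g), C (Real.exp (w g)) * X 2] :
      Fin 3 → MvPolynomial (Fin 3) ℝ) j) ≤ if j = i then 1 else 0 := by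
    intro j
    fin_cases j
    · refine (degreeOf_add_le _ _ _).trans ?_
      rw [degreeOf_C]; simpa using degreeOf_X_le i 0
    · refine (degreeOf_add_le _ _ _).trans ?_
      rw [degreeOf_C]; simpa using degreeOf_X_le i 1
    · exact (degreeOf_C_mul_le _ _ _).trans (degreeOf_X_le i 2)
  exact degreeOf_aeval_le i i _ hgen P

lemma degreeOf_transl (g : G) (P : MvPolynomial (Fin 3) ℝ) (i : Fin 3) :
    degreeOf i (transl v u w g P) = degreeOf i P := by
  refine le_antisymm (degreeOf_transl_le v u w g P i) ?_
  conv_lhs => rw [← transl_neg_transl v u w g P]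
  exact degreeOf_transl_le v u w (-g) _ i

lemma irreducible_transl (g : G) {P : MvPolynomial (Fin 3) ℝ} (hP : Irreducible P) :
    Irreducible (transl v u w g P) := by
  rw [← translEquiv_apply]; exact (MulEquiv.irreducible_iff (translEquiv v u w g)).2 hP

end Translation

end

section

open MvPolynomial

lemma Polynomial.eq_C_of_comp_X_add_one {π : Polynomial ℝ} {ρ c : ℝ} (hπ : π ≠ 0)
    (hρ : ρ ≠ 0) (h : π.comp (Polynomial.X + Polynomial.C 1) * Polynomial.C ρ = Polynomial.C c * π) :
    c = ρ ∧ π = Polynomial.C (π.eval 0) := by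
  have hc : c = ρ := by
    have h1 := congrArg Polynomial.leadingCoeff h
    rw [Polynomial.leadingCoeff_mul, Polynomial.leadingCoeff_mul, Polynomial.leadingCoeff_C,
      Polynomial.leadingCoeff_C, Polynomial.leadingCoeff_comp (by rw [Polynomial.natDegree_X_add_C]; simp),
      Polynomial.leadingCoeff_X_add_C, one_pow, mul_one, mul_comm] at h1
    exact (mul_right_cancel₀ (Polynomial.leadingCoeff_ne_zero.2 hπ) h1).symm
  refine ⟨hc, ?_⟩
  subst hc
  have h2 : π.comp (Polynomial.X + Polynomial.C 1) = π := by
    rw [mul_comm] at h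
    exact mul_left_cancel₀ (Polynomial.C_ne_zero.2 hρ) h
  have h3 : ∀ n : ℕ, π.eval (n : ℝ) = π.eval 0 := by
    intro n
    induction n with
    | zero => simp
    | succ n ih =>
      have := congrArg (Polynomial.eval (n : ℝ)) h2
      rw [Polynomial.eval_comp, ih] at this
      rw [← this]; simp
  refine Polynomial.eq_of_infinite_eval_eq _ _ (Set.Infinite.mono ?_
    (Set.infinite_range_of_injective (Nat.cast_injective (R := ℝ))))
  rintro _ ⟨n, rfl⟩
  simp [h3 n]

/-- Restriction of a polynomial to the line through `(x₀, x₁)` with direction `(a, b)`. -/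
noncomputable def lineHom (x₀ x₁ a b : ℝ) :
    MvPolynomial (Fin 3) ℝ →+* Polynomial (Polynomial ℝ) :=
  eval₂Hom (Polynomial.C.comp Polynomial.C)
    ![Polynomial.C (Polynomial.C x₀ + Polynomial.C a * Polynomial.X),
    Polynomial.C (Polynomial.C x₁ + Polynomial.C b * Polynomial.X), Polynomial.X]

lemma lineHom_C (x₀ x₁ a b r : ℝ) :
    lineHom x₀ x₁ a b (C r) = Polynomial.C (Polynomial.C r) := by
  simp [lineHom]

lemma eval_lineHom (x₀ x₁ a b s y : ℝ) (P : MvPolynomial (Fin 3) ℝ) :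
    ((lineHom x₀ x₁ a b P).eval (Polynomial.C y)).eval s = eval ![x₀ + s * a, x₁ + s * b, y] P := by
  have : ((Polynomial.evalRingHom s).comp (Polynomial.evalRingHom (Polynomial.C y))).comp
      (lineHom x₀ x₁ a b) = eval ![x₀ + s * a, x₁ + s * b, y] := by
    apply ringHom_ext
    · intro r; simp [lineHom]
    · intro i
      fin_cases i <;> simp [lineHom, mul_comm s]
  exact congrArg (fun φ => φ P) this

/-- Simultaneous shift of the parameter and scaling of the variable. -/
noncomputable def shiftScale (y : ℝ) : Polynomial (Polynomial ℝ) →+* Polynomial (Polynomial ℝ) :=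
  (Polynomial.compRingHom (Polynomial.C (Polynomial.C y) * Polynomial.X)).comp
    (Polynomial.mapRingHom (Polynomial.compRingHom (Polynomial.X + Polynomial.C 1)))

lemma coeff_shiftScale (y : ℝ) (p : Polynomial (Polynomial ℝ)) (t : ℕ) :
    (shiftScale y p).coeff t =
      (p.coeff t).comp (Polynomial.X + Polynomial.C 1) * Polynomial.C (y ^ t) := by
  simp only [shiftScale, RingHom.comp_apply, Polynomial.coe_compRingHom_apply,
    Polynomial.coe_mapRingHom]
  rw [Polynomial.comp_C_mul_X_coeff, Polynomial.coeff_map, ← Polynomial.C_pow]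
  rfl

section

variable {G : Type*} [AddCommGroup G] (v u w : G →+ ℝ)

lemma lineHom_transl (x₀ x₁ : ℝ) (h : G) (P : MvPolynomial (Fin 3) ℝ) :
    lineHom x₀ x₁ (v h) (u h) (transl v u w h P) =
      shiftScale (Real.exp (w h)) (lineHom x₀ x₁ (v h) (u h) P) := by
  have : (lineHom x₀ x₁ (v h) (u h)).comp (transl v u w h).toRingHom =
      (shiftScale (Real.exp (w h))).comp (lineHom x₀ x₁ (v h) (u h)) := by
    apply ringHom_ext
    · intro r; simp [lineHom, transl, shiftScale, algebraMap_eq]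
    · intro i
      fin_cases i
      · simp [lineHom, transl, shiftScale]; ring
      · simp [lineHom, transl, shiftScale]; ring
      · simp [lineHom, transl, shiftScale]
  exact congrArg (fun φ => φ P) this

/-- If a polynomial prime to the third variable is multiplied by a constant under a translation,
then it is invariant along the corresponding line, and the multiplicative part of the translation
is trivial if the third variable occurs. -/
lemma stabilizer_aux {Q : MvPolynomial (Fin 3) ℝ} (hQ : ¬ X 2 ∣ Q) {h : G} {c : ℝ}
    (hc : transl v u w h Q = C c * Q) :
    (∀ s x₀ x₁ y : ℝ, eval ![x₀ + s * v h, x₁ + s * u h, y] Q = eval ![x₀, x₁, y] Q) ∧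
      (0 < degreeOf 2 Q → w h = 0) := by
  have hcoef : ∀ x₀ x₁ t, (lineHom x₀ x₁ (v h) (u h) Q).coeff t ≠ 0 →
      c = Real.exp (w h) ^ t ∧ (lineHom x₀ x₁ (v h) (u h) Q).coeff t =
        Polynomial.C (((lineHom x₀ x₁ (v h) (u h) Q).coeff t).eval 0) := by
    intro x₀ x₁ t ht
    apply Polynomial.eq_C_of_comp_X_add_one ht (pow_ne_zero _ (Real.exp_ne_zero _))
    rw [← coeff_shiftScale, ← lineHom_transl, hc, map_mul, lineHom_C, Polynomial.coeff_C_mul]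
  have hconst : ∀ x₀ x₁ t, (lineHom x₀ x₁ (v h) (u h) Q).coeff t =
        Polynomial.C (((lineHom x₀ x₁ (v h) (u h) Q).coeff t).eval 0) := by
    intro x₀ x₁ t
    by_cases ht : (lineHom x₀ x₁ (v h) (u h) Q).coeff t = 0
    · rw [ht]; simp
    · exact (hcoef x₀ x₁ t ht).2
  have hpt : ∀ x : Fin 3 → ℝ, ![x 0, x 1, x 2] = x := by
    intro x; funext i; fin_cases i <;> rfl
  have heval0 : ∀ x : Fin 3 → ℝ, eval x Q =
      ((lineHom (x 0) (x 1) (v h) (u h) Q).eval (Polynomial.C (x 2))).eval 0 := by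
    intro x
    rw [eval_lineHom]; simp [hpt]
  refine ⟨fun s x₀ x₁ y => ?_, fun hdeg => ?_⟩
  · have e1 := eval_lineHom x₀ x₁ (v h) (u h) s y Q
    have e2 := eval_lineHom x₀ x₁ (v h) (u h) 0 y Q
    simp only [zero_mul, add_zero] at e2
    rw [← e1, ← e2, Polynomial.eval_eq_sum (p := lineHom _ _ _ _ _), Polynomial.sum,
      Polynomial.eval_finsetSum, Polynomial.eval_finsetSum]
    refine Finset.sum_congr rfl fun t _ => ?_
    rw [hconst]; simp
  · have hex0 : ∃ x₀ x₁, (lineHom x₀ x₁ (v h) (u h) Q).coeff 0 ≠ 0 := by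
      by_contra! hno
      apply hQ
      have h0 : specialize 2 0 Q = 0 := by
        apply MvPolynomial.funext
        intro x
        rw [eval_specialize, heval0]
        simp only [Function.update_self, map_zero]
        rw [← Polynomial.coeff_zero_eq_eval_zero (lineHom _ _ _ _ _), hno]; simp
      have := X_sub_C_dvd_sub_specialize 2 0 Q
      rwa [h0, map_zero, sub_zero, sub_zero] at this
    obtain ⟨x₀, x₁, h0⟩ := hex0
    have hc1 : c = 1 := by simpa using (hcoef x₀ x₁ 0 h0).1
    have hex : ∃ t x₀ x₁, t ≠ 0 ∧ (lineHom x₀ x₁ (v h) (u h) Q).coeff t ≠ 0 := by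
      by_contra! hno
      apply hdeg.ne'
      apply degreeOf_eq_zero_of_eval
      intro x
      rw [heval0, heval0]
      have e : ∀ x₀ x₁, lineHom x₀ x₁ (v h) (u h) Q =
          Polynomial.C ((lineHom x₀ x₁ (v h) (u h) Q).coeff 0) := by
        intro x₀ x₁
        ext1 t
        rw [Polynomial.coeff_C]
        split_ifs with ht
        · rw [ht]
        · exact hno t x₀ x₁ ht
      rw [Function.update_of_ne (a := (0 : Fin 3)) (by decide),
        Function.update_of_ne (a := (1 : Fin 3)) (by decide), e]
      simp
    obtain ⟨t, x₀, x₁, ht, h1⟩ := hex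
    have h2 := (hcoef x₀ x₁ t h1).1
    rw [hc1, ← Real.exp_nat_mul] at h2
    have h3 := Real.exp_eq_one_iff _ |>.1 h2.symm
    exact (mul_eq_zero.1 h3).resolve_left (by exact_mod_cast ht)

end

/-- A polynomial involving one of the first two variables is invariant only under translations in
the kernel of some nonzero linear functional. -/
lemma exists_functional {Q : MvPolynomial (Fin 3) ℝ} (hQ : degreeOf 0 Q ≠ 0 ∨ degreeOf 1 Q ≠ 0) :
    ∃ e : ℝ × ℝ →ₗ[ℝ] ℝ, e ≠ 0 ∧ (degreeOf 1 Q = 0 → e (0, 1) = 0) ∧ ∀ a b : ℝ,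
      (∀ s x₀ x₁ y : ℝ, eval ![x₀ + s * a, x₁ + s * b, y] Q = eval ![x₀, x₁, y] Q) →
        e (a, b) = 0 := by
  let V : Submodule ℝ (ℝ × ℝ) :=
    { carrier := {z | ∀ s x₀ x₁ y : ℝ,
        eval ![x₀ + s * z.1, x₁ + s * z.2, y] Q = eval ![x₀, x₁, y] Q}
      add_mem' := by
        intro z z' hz hz' s x₀ x₁ y
        rw [← hz s x₀ x₁ y, ← hz' s (x₀ + s * z.1) (x₁ + s * z.2) y]
        simp only [Prod.fst_add, Prod.snd_add, mul_add, add_assoc]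
      zero_mem' := by intro s x₀ x₁ y; simp
      smul_mem' := by
        intro r z hz s x₀ x₁ y
        rw [← hz (s * r) x₀ x₁ y]
        simp only [Prod.smul_fst, Prod.smul_snd, smul_eq_mul, mul_assoc] }
  have hmem : ∀ z, z ∈ V ↔ ∀ s x₀ x₁ y : ℝ,
        eval ![x₀ + s * z.1, x₁ + s * z.2, y] Q = eval ![x₀, x₁, y] Q := fun z => Iff.rfl
  have hpt : ∀ x : Fin 3 → ℝ, ![x 0, x 1, x 2] = x := by
    intro x; funext i; fin_cases i <;> rfl
  have hV : V < ⊤ := by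
    rw [lt_top_iff_ne_top]
    intro hV
    have h1 : ((1 : ℝ), (0 : ℝ)) ∈ V := by rw [hV]; trivial
    have h2 : ((0 : ℝ), (1 : ℝ)) ∈ V := by rw [hV]; trivial
    rw [hmem] at h1 h2
    rcases hQ with hQ | hQ
    · apply hQ
      apply degreeOf_eq_zero_of_eval
      intro x
      have := h1 (x 0) 0 (x 1) (x 2)
      simp only [mul_one, mul_zero, zero_add, add_zero, hpt] at this
      rw [this]
      congr 2
      funext i; fin_cases i <;> simp
    · apply hQ
      apply degreeOf_eq_zero_of_eval
      intro x
      have := h2 (x 1) (x 0) 0 (x 2)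
      simp only [mul_one, mul_zero, zero_add, add_zero, hpt] at this
      rw [this]
      congr 2
      funext i; fin_cases i <;> simp
  obtain ⟨e, he, hle⟩ := Submodule.exists_le_ker_of_lt_top V hV
  refine ⟨e, he, fun h => ?_, fun a b hab => ?_⟩
  · refine hle (x := (0, 1)) ?_
    rw [hmem]
    intro s x₀ x₁ y
    apply eval_congr_of_degreeOf_eq_zero h
    intro j hj
    fin_cases j
    · simp
    · exact absurd rfl hj
    · simp
  · exact hle (x := (a, b)) ((hmem _).2 hab)

end

section

open MvPolynomial

lemma exists_mem_span_notMem {V : Type*} [AddCommGroup V] [Module ℝ V] {G : Type*} (f : G → V)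
    (E : Finset G) {ι : Type*} [Finite ι] (N : ι → Submodule ℝ V)
    (h : ∀ i, ∃ g ∈ E, f g ∉ N i) :
    ∃ R ∈ Submodule.span ℝ (f '' E), ∀ i, R ∉ N i := by
  classical
  have := Fintype.ofFinite ι
  let W := Submodule.span ℝ (f '' E)
  let S : Finset (Subspace ℝ W) := Finset.univ.image fun i => (N i).comap W.subtype
  have hS : ⊤ ∉ S := by
    intro hS
    obtain ⟨i, -, hi⟩ := Finset.mem_image.1 hS
    obtain ⟨g, hg, hgN⟩ := h i
    have hmem : (⟨f g, Submodule.subset_span ⟨g, hg, rfl⟩⟩ : W) ∈ (N i).comap W.subtype := by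
      rw [hi]; trivial
    exact hgN hmem
  have h1 := Subspace.biUnion_ne_univ_of_top_notMem hS
  obtain ⟨R, hR⟩ := (Set.ne_univ_iff_exists_notMem _).1 h1
  refine ⟨R, R.2, fun i hi => hR ?_⟩
  simp only [Set.mem_iUnion]
  exact ⟨_, Finset.mem_image_of_mem _ (Finset.mem_univ i), hi⟩

section

variable {G : Type*} [AddCommGroup G] (v u w : G →+ ℝ)

lemma card_image_mul_degreeOf_le {P Q : MvPolynomial (Fin 3) ℝ} (hP : P ≠ 0) (hQ : Irreducible Q)
    (E : Finset G) (hdvd : ∀ g ∈ E, transl v u w (-g) Q ∣ P) {X : Type*} [DecidableEq X] (φ : G → X)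
    (hφ : ∀ g ∈ E, ∀ g' ∈ E, ∀ c, transl v u w (g - g') Q = C c * Q → φ g = φ g') (i : Fin 3) :
    (E.image φ).card * degreeOf i Q ≤ degreeOf i P := by
  classical
  obtain ⟨s, hsE, hs⟩ := Set.exists_subset_bijOn (E : Set G) φ
  lift s to Finset G using (E.finite_toSet.subset hsE)
  have hsE' : s ⊆ E := by exact_mod_cast hsE
  have hcard : (E.image φ).card = s.card := by
    rw [← Finset.card_image_of_injOn hs.injOn]
    congr 1
    have := hs.image_eq
    exact_mod_cast this.symm
  have hprod : ∏ g ∈ s, transl v u w (-g) Q ∣ P := by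
    apply Finset.prod_dvd_of_isRelPrime
    · intro g hg g' hg' hne
      have hg0 : g ∈ s := by exact_mod_cast hg
      have hg0' : g' ∈ s := by exact_mod_cast hg'
      change IsRelPrime _ _
      rw [(irreducible_transl v u w (-g) hQ).isRelPrime_iff_not_dvd]
      intro hd
      have hass := ((irreducible_transl v u w (-g) hQ).dvd_irreducible_iff_associated
        (irreducible_transl v u w (-g') hQ)).1 hd
      obtain ⟨a, ha⟩ := hass
      obtain ⟨r, hr, har⟩ := MvPolynomial.isUnit_iff_eq_C_of_isReduced.1 a.isUnit
      have h1 := congrArg (transl v u w g) ha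
      rw [har, map_mul, transl_transl_neg, algHom_C, algebraMap_eq, ← transl_add,
        ← sub_eq_add_neg] at h1
      apply hne
      apply hs.injOn hg hg'
      exact hφ g (hsE' hg0) g' (hsE' hg0') r (by rw [← h1, mul_comm])
    · intro g hg
      exact hdvd g (hsE' hg)
  have hdeg : degreeOf i (∏ g ∈ s, transl v u w (-g) Q) = s.card * degreeOf i Q := by
    rw [degreeOf_prod_eq _ _ (fun g _ => transl_ne_zero v u w _ hQ.ne_zero)]
    simp [degreeOf_transl]
  rw [hcard, ← hdeg]
  obtain ⟨z, hz⟩ := hprod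
  have hz0 : z ≠ 0 := by rintro rfl; exact hP (by simpa using hz)
  have hpr0 : (∏ g ∈ s, transl v u w (-g) Q) ≠ 0 := by
    intro h; rw [h, zero_mul] at hz; exact hP hz
  rw [hz, degreeOf_mul_eq hpr0 hz0]
  exact Nat.le_add_right _ _

lemma degreeOf_le_of_dvd {n : ℕ} {P Q : MvPolynomial (Fin n) ℝ} (hP : P ≠ 0) (h : Q ∣ P)
    (i : Fin n) : degreeOf i Q ≤ degreeOf i P := by
  obtain ⟨z, rfl⟩ := h
  rw [degreeOf_mul_eq (left_ne_zero_of_mul hP) (right_ne_zero_of_mul hP)]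
  exact Nat.le_add_right _ _

lemma exists_degreeOf_ne_zero {n : ℕ} {Q : MvPolynomial (Fin n) ℝ} (hQ : ¬ IsUnit Q)
    (hQ0 : Q ≠ 0) : ∃ i, degreeOf i Q ≠ 0 := by
  by_contra! h
  apply hQ
  have h1 : Q = C (eval 0 Q) := by
    apply MvPolynomial.funext
    intro x
    rw [eval_C, eval_eq', eval_eq']
    refine Finset.sum_congr rfl fun m hm => ?_
    congr 1
    refine Finset.prod_congr rfl fun j _ => ?_
    have : m j ≤ degreeOf j Q := by
      rw [degreeOf_eq_sup]; exact Finset.le_sup (f := fun m => m j) hm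
    rw [h j, Nat.le_zero] at this
    rw [this, pow_zero, pow_zero]
  have h2 : eval 0 Q ≠ 0 := by
    intro h0; rw [h0, map_zero] at h1; exact hQ0 h1
  rw [h1]
  exact (IsUnit.mk0 _ h2).map C

/-- Some combination of translates of `P` is coprime to `P`. -/
lemma exists_isRelPrime_span_transl {P : MvPolynomial (Fin 3) ℝ} (hP : P ≠ 0) (hY : ¬ X 2 ∣ P)
    (E : Finset G) (hE : E.Nonempty)
    (hC : ∀ e : ℝ × ℝ →ₗ[ℝ] ℝ, e ≠ 0 → (degreeOf 1 P = 0 → e (0, 1) = 0) →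
      degreeOf 0 P + degreeOf 1 P < (E.image fun g => e (v g, u g)).card)
    (hC' : degreeOf 2 P < (E.image w).card) :
    ∃ R ∈ Submodule.span ℝ ((fun g => transl v u w g P) '' E), R ≠ 0 ∧ IsRelPrime P R := by
  classical
  have hfac : ∀ Q, Irreducible Q → Q ∣ P → ∃ g ∈ E, ¬ Q ∣ transl v u w g P := by
    intro Q hQ hQP
    by_contra! hall
    have hQY : ¬ X 2 ∣ Q := fun h => hY (h.trans hQP)
    have hdvd : ∀ g ∈ E, transl v u w (-g) Q ∣ P := by
      intro g hg
      have := map_dvd (transl v u w (-g)) (hall g hg)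
      rwa [transl_neg_transl] at this
    by_cases hd : degreeOf 0 Q ≠ 0 ∨ degreeOf 1 Q ≠ 0
    · obtain ⟨e, he, he1, hinv⟩ := exists_functional hd
      have hcount := card_image_mul_degreeOf_le v u w hP hQ E hdvd (fun g => e (v g, u g)) (by
        intro g _ g' _ c hc
        have h1 := hinv _ _ (stabilizer_aux v u w hQY hc).1
        rw [map_sub, map_sub, ← Prod.mk_sub_mk, map_sub, sub_eq_zero] at h1
        exact h1)
      have h0 := hcount 0
      have h1 := hcount 1
      have h2 := hC e he (fun h => he1 (by
        have := degreeOf_le_of_dvd hP hQP 1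
        omega))
      have h3 : 1 ≤ degreeOf 0 Q + degreeOf 1 Q := by omega
      have h4 := Nat.mul_le_mul_left (E.image fun g => e (v g, u g)).card h3
      rw [mul_add] at h4
      omega
    · push Not at hd
      have hd2 : 0 < degreeOf 2 Q := by
        obtain ⟨i, hi⟩ := exists_degreeOf_ne_zero hQ.not_isUnit hQ.ne_zero
        fin_cases i
        · exact absurd hd.1 hi
        · exact absurd hd.2 hi
        · exact Nat.pos_of_ne_zero hi
      have hcount := card_image_mul_degreeOf_le v u w hP hQ E hdvd w (by
        intro g _ g' _ c hc
        have h1 := (stabilizer_aux v u w hQY hc).2 hd2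
        rw [map_sub, sub_eq_zero] at h1
        exact h1) 2
      have := Nat.mul_le_mul_left (E.image w).card hd2
      omega
  let F := (UniqueFactorizationMonoid.factors P).toFinset
  let N : Option F → Submodule ℝ (MvPolynomial (Fin 3) ℝ) := fun o =>
    o.elim ⊥ fun Q => (Ideal.span {(Q : MvPolynomial (Fin 3) ℝ)}).restrictScalars ℝ
  obtain ⟨R, hR, hRN⟩ := exists_mem_span_notMem (fun g => transl v u w g P) E N (by
    rintro (_ | ⟨Q, hQ⟩)
    · obtain ⟨g, hg⟩ := hE
      exact ⟨g, hg, fun h => transl_ne_zero v u w g hP h⟩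
    · have hQm := Multiset.mem_toFinset.1 hQ
      obtain ⟨g, hg, h⟩ := hfac Q (UniqueFactorizationMonoid.irreducible_of_factor Q hQm)
        (UniqueFactorizationMonoid.dvd_of_mem_factors hQm)
      exact ⟨g, hg, fun h' => h (Ideal.mem_span_singleton.1 h')⟩)
  refine ⟨R, hR, fun h => hRN none h, ?_⟩
  intro d hdP hdR
  by_contra hd
  have hd0 : d ≠ 0 := fun h => hP (by rw [h, zero_dvd_iff] at hdP; exact hdP)
  obtain ⟨q, hq, hqd⟩ := WfDvdMonoid.exists_irreducible_factor hd hd0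
  obtain ⟨Q, hQ, hass⟩ := UniqueFactorizationMonoid.exists_mem_factors_of_dvd hP hq (hqd.trans hdP)
  refine hRN (some ⟨Q, Multiset.mem_toFinset.2 hQ⟩) ?_
  exact Ideal.mem_span_singleton.2 (hass.symm.dvd.trans (hqd.trans hdR))

lemma eval_eq_zero_of_mem_span {P R : MvPolynomial (Fin 3) ℝ} {E : Finset G} {h : G}
    (hR : R ∈ Submodule.span ℝ ((fun g => transl v u w g P) '' E))
    (hz : ∀ g ∈ E, eval (pt v u w (g + h)) P = 0) : eval (pt v u w h) R = 0 := by
  induction hR using Submodule.span_induction with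
  | mem x hx =>
    obtain ⟨g, hg, rfl⟩ := hx
    simp only [eval_transl]
    exact hz g hg
  | zero => simp
  | add x y _ _ hx hy => rw [map_add, hx, hy, add_zero]
  | smul a x _ hx => rw [smul_eval, hx, mul_zero]

lemma degreeOf_le_of_mem_span {P R : MvPolynomial (Fin 3) ℝ} {E : Finset G}
    (hR : R ∈ Submodule.span ℝ ((fun g => transl v u w g P) '' E)) (i : Fin 3) :
    degreeOf i R ≤ degreeOf i P := by
  induction hR using Submodule.span_induction with
  | mem x hx =>
    obtain ⟨g, hg, rfl⟩ := hx
    exact degreeOf_transl_le v u w g P i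
  | zero => simp
  | add x y _ _ hx hy => exact (degreeOf_add_le _ _ _).trans (max_le hx hy)
  | smul a x _ hx => rw [smul_eq_C_mul]; exact (degreeOf_C_mul_le _ _ _).trans hx

end

end

section

open MvPolynomial
open scoped Pointwise

lemma polyOfCoeffs_eq_zero_of_eval {J : ℕ} (c : Fin J → ℝ) (s : Finset ℝ) (hs : J ≤ s.card)
    (h : ∀ x ∈ s, (polyOfCoeffs c).eval x = 0) : c = 0 := by
  apply polyOfCoeffs_eq_zero
  refine Polynomial.eq_zero_of_degree_lt_of_eval_finset_eq_zero s ?_ h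
  exact (degree_polyOfCoeffs_lt c).trans_le (by exact_mod_cast hs)

lemma eval_aeval_X {n : ℕ} (x : Fin n → ℝ) (i : Fin n) (g : Polynomial ℝ) :
    eval x (Polynomial.aeval (X i) g) = g.eval (x i) := by
  have := Polynomial.hom_eval₂ g (algebraMap ℝ (MvPolynomial (Fin n) ℝ)) (eval x) (X i)
  rw [Polynomial.aeval_def, this, eval_X]
  have e : (eval x).comp (algebraMap ℝ (MvPolynomial (Fin n) ℝ)) = RingHom.id ℝ := by
    ext r; simp [algebraMap_eq]
  rw [e, Polynomial.eval₂_id]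

lemma degreeOf_aeval_X_of_ne {n : ℕ} {i j : Fin n} (h : i ≠ j) (g : Polynomial ℝ) :
    degreeOf i (Polynomial.aeval (X j : MvPolynomial (Fin n) ℝ) g) = 0 := by
  apply degreeOf_eq_zero_of_eval
  intro x
  rw [eval_aeval_X, eval_aeval_X, Function.update_of_ne h.symm]

lemma exists_eq_X_pow_mul {P : MvPolynomial (Fin 3) ℝ} (hP : P ≠ 0) :
    ∃ s P', P = X 2 ^ s * P' ∧ ¬ X 2 ∣ P' := by
  have hX : ¬ IsUnit (X 2 : MvPolynomial (Fin 3) ℝ) := by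
    intro h
    obtain ⟨r, hr, h2⟩ := MvPolynomial.isUnit_iff_eq_C_of_isReduced.1 h
    have := congrArg (degreeOf 2) h2
    rw [degreeOf_X_self, degreeOf_C] at this
    exact one_ne_zero this
  obtain ⟨s, h1, h2⟩ := (FiniteMultiplicity.of_not_isUnit hX hP).exists_eq_pow_mul_and_not_dvd
  exact ⟨_, s, h1, h2⟩

section

variable {G : Type*} [AddCommGroup G] (v u w : G →+ ℝ)

lemma eval_zero_of_eval_X_pow_mul {P' : MvPolynomial (Fin 3) ℝ} {s : ℕ} {g : G}
    (h : eval (pt v u w g) (X 2 ^ s * P') = 0) : eval (pt v u w g) P' = 0 := by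
  rw [map_mul, map_pow, eval_X] at h
  refine (mul_eq_zero.1 h).resolve_left (pow_ne_zero _ ?_)
  simp [pt]

/-- Zero estimate for polynomials not involving the second variable and prime to the third. -/
theorem two_variable_zero_estimate_aux {P : MvPolynomial (Fin 3) ℝ} (hP : P ≠ 0) (hY : ¬ X 2 ∣ P)
    {K T : ℕ} (h0 : degreeOf 0 P < K) (h1 : degreeOf 1 P = 0) (h2 : degreeOf 2 P < T)
    (E F : Finset G) (hE0 : 0 ∈ E) (hvE : Set.InjOn v E) (hvF : Set.InjOn v F) (hEK : K ≤ E.card)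
    (hET : T ≤ (E.image w).card) (hF : 2 * K * T < F.card)
    (hz : ∀ g ∈ E, ∀ h ∈ F, eval (pt v u w (g + h)) P = 0) : False := by
  classical
  obtain ⟨R, hRspan, hR, hPR⟩ := exists_isRelPrime_span_transl v u w hP hY E ⟨0, hE0⟩ (by
    intro e he he1
    have he1 := he1 h1
    have hval : ∀ a b, e (a, b) = a * e (1, 0) := by
      intro a b
      have : ((a, b) : ℝ × ℝ) = a • (1, 0) + b • (0, 1) := by ext <;> simp
      rw [this, map_add, map_smul, map_smul, he1, smul_zero, add_zero, smul_eq_mul]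
    have hne : e (1, 0) ≠ 0 := by
      intro h
      exact he (LinearMap.ext fun z => by rw [← Prod.mk.eta (p := z), hval, h, mul_zero]; rfl)
    rw [h1, add_zero, Finset.card_image_of_injOn]
    · omega
    · intro g hg g' hg' hgg
      have hgg : e (v g, u g) = e (v g', u g') := hgg
      rw [hval, hval (v g')] at hgg
      exact hvE hg hg' (mul_right_cancel₀ hne hgg)) (by omega)
  have hR0 := degreeOf_le_of_mem_span v u w hRspan 0
  have hR1 := degreeOf_le_of_mem_span v u w hRspan 1
  have hR2 := degreeOf_le_of_mem_span v u w hRspan 2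
  have hRz : ∀ h ∈ F, eval (pt v u w h) R = 0 := fun h hh =>
    eval_eq_zero_of_mem_span v u w hRspan fun g hg => hz g hg h hh
  have hPz : ∀ h ∈ F, eval (pt v u w h) P = 0 := fun h hh => by
    have := hz 0 hE0 h hh
    rwa [zero_add] at this
  have key := card_le_of_independent_mod hP hR hPR
    ![degreeOf 0 P + degreeOf 0 R + F.card, 1, degreeOf 2 P + degreeOf 2 R + 1] (by
      intro i; fin_cases i
      · simp
      · simp; omega
      · simp) (ι := Fin F.card) (fun j => X 0 ^ (j : ℕ)) (by
      intro j
      apply mem_polyBox_of_degreeOf_lt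
      intro i
      have hj := j.2
      refine (degreeOf_pow_le i _ _).trans_lt ?_
      have hX := Nat.mul_le_mul_left (j : ℕ) (degreeOf_X_le i 0)
      refine hX.trans_lt ?_
      fin_cases i
      · simp; omega
      · simp
      · simp) (by
      intro c hc
      rw [← aeval_polyOfCoeffs, Ideal.mem_span_pair] at hc
      obtain ⟨a, b, hab⟩ := hc
      apply polyOfCoeffs_eq_zero_of_eval c (F.image v)
      · rw [Finset.card_image_of_injOn hvF]
      · intro x hx
        obtain ⟨h, hh, rfl⟩ := Finset.mem_image.1 hx
        have := congrArg (eval (pt v u w h)) hab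
        rw [map_add, map_mul, map_mul, hPz h hh, hRz h hh, eval_aeval_X] at this
        simpa [pt] using this.symm)
  rw [Fintype.card_fin, Fin.sum_univ_three] at key
  simp only [mixedDegree, zero_add, show (1 : Fin 3) + 1 = 2 from rfl,
    show (1 : Fin 3) + 2 = 0 from rfl,
    show (2 : Fin 3) + 1 = 0 from rfl, show (2 : Fin 3) + 2 = 1 from rfl] at key
  have hR1' : degreeOf 1 R = 0 := by omega
  rw [h1, hR1'] at key
  simp only [Matrix.cons_val_one, Matrix.cons_val_zero, zero_mul, mul_zero, add_zero, zero_add, one_mul] at key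
  have a1 : degreeOf 2 P * degreeOf 0 R ≤ T * K := Nat.mul_le_mul h2.le (by omega)
  have a2 : degreeOf 0 P * degreeOf 2 R ≤ K * T := Nat.mul_le_mul h0.le (by omega)
  rw [mul_comm T K] at a1
  rw [mul_assoc] at hF
  omega

/-- Zero estimate for polynomials not involving the second variable. -/
theorem two_variable_zero_estimate {P : MvPolynomial (Fin 3) ℝ} (hP : P ≠ 0)
    {K T : ℕ} (h0 : degreeOf 0 P < K) (h1 : degreeOf 1 P = 0) (h2 : degreeOf 2 P < T)
    (F : Finset G) (hvF : Set.InjOn v F) (hEK : K ≤ F.card)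
    (hET : T ≤ (F.image w).card) (hF : 2 * K * T < F.card)
    (hz : ∀ g ∈ F, ∀ h ∈ F, eval (pt v u w (g + h)) P = 0) : False := by
  classical
  obtain ⟨s, P', rfl, hY⟩ := exists_eq_X_pow_mul hP
  have hP' : P' ≠ 0 := right_ne_zero_of_mul hP
  have hd := degreeOf_le_of_dvd hP (Dvd.intro_left _ rfl : P' ∣ X 2 ^ s * P')
  have hne : F.Nonempty := Finset.card_pos.1 (by omega)
  obtain ⟨p, hp⟩ := hne
  refine two_variable_zero_estimate_aux v u w (P := transl v u w p P')
    (transl_ne_zero v u w p hP') ?_ (K := K) (T := T) ?_ ?_ ?_ (F.image fun g => g - p) F ?_ ?_ hvF ?_ ?_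
    hF ?_
  · intro h
    have h1 := map_dvd (transl v u w (-p)) h
    rw [transl_neg_transl] at h1
    refine hY (dvd_trans ?_ h1)
    simp [transl]
  · rw [degreeOf_transl]; exact (hd 0).trans_lt h0
  · rw [degreeOf_transl]; have := hd 1; omega
  · rw [degreeOf_transl]; exact (hd 2).trans_lt h2
  · exact Finset.mem_image.2 ⟨p, hp, sub_self p⟩
  · intro a ha b hb hab
    obtain ⟨g, hg, rfl⟩ := Finset.mem_image.1 (Finset.mem_coe.1 ha)
    obtain ⟨g', hg', rfl⟩ := Finset.mem_image.1 (Finset.mem_coe.1 hb)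
    rw [map_sub, map_sub] at hab
    rw [hvF hg hg' (sub_left_injective hab)]
  · rw [Finset.card_image_of_injective _ sub_left_injective]; exact hEK
  · rw [Finset.image_image]
    have : (w ∘ fun g => g - p) = (fun x => x - w p) ∘ w := by funext g; simp
    rw [this, ← Finset.image_image, Finset.card_image_of_injective _ sub_left_injective]
    exact hET
  · intro a ha h hh
    obtain ⟨g, hg, rfl⟩ := Finset.mem_image.1 ha
    rw [eval_transl]
    have : p + (g - p + h) = g + h := by abel
    rw [this]
    exact eval_zero_of_eval_X_pow_mul v u w (hz g hg h hh)

end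

/-- Products of nonzero polynomials in the first variable and powers of the third variable. -/
noncomputable def denomMonoid : Submonoid (MvPolynomial (Fin 3) ℝ) where
  carrier := {x | ∃ h : Polynomial ℝ, ∃ s : ℕ, h ≠ 0 ∧ x = Polynomial.aeval (X 0) h * X 2 ^ s}
  one_mem' := ⟨1, 0, one_ne_zero, by simp⟩
  mul_mem' := by
    rintro _ _ ⟨h, s, hh, rfl⟩ ⟨h', s', hh', rfl⟩
    exact ⟨h * h', s + s', mul_ne_zero hh hh', by rw [map_mul]; ring⟩

lemma X_two_mem_denomMonoid : (X 2 : MvPolynomial (Fin 3) ℝ) ∈ denomMonoid :=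
  ⟨1, 1, one_ne_zero, by simp⟩

lemma aeval_mem_denomMonoid {h : Polynomial ℝ} (hh : h ≠ 0) :
    Polynomial.aeval (X 0 : MvPolynomial (Fin 3) ℝ) h ∈ denomMonoid :=
  ⟨h, 0, hh, by simp⟩

/-- Ideals maximal among those avoiding `denomMonoid`. -/
def MaxDisjoint (p : Ideal (MvPolynomial (Fin 3) ℝ)) : Prop :=
  Maximal (fun q : Ideal (MvPolynomial (Fin 3) ℝ) =>
    Disjoint (q : Set (MvPolynomial (Fin 3) ℝ)) denomMonoid) p

lemma MaxDisjoint.isPrime {p : Ideal (MvPolynomial (Fin 3) ℝ)} (hp : MaxDisjoint p) : p.IsPrime :=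
  Ideal.isPrime_of_maximally_disjoint _ _ hp.1 fun _ => hp.not_prop_of_gt

lemma MaxDisjoint.notMem {p : Ideal (MvPolynomial (Fin 3) ℝ)} (hp : MaxDisjoint p)
    {x : MvPolynomial (Fin 3) ℝ} (hx : x ∈ denomMonoid) : x ∉ p :=
  fun h => Set.disjoint_left.1 hp.1 h hx

lemma exists_maxDisjoint_ge {I : Ideal (MvPolynomial (Fin 3) ℝ)}
    (hI : Disjoint (I : Set (MvPolynomial (Fin 3) ℝ)) denomMonoid) : ∃ p, I ≤ p ∧ MaxDisjoint p := by
  refine zorn_le_nonempty₀ {p : Ideal (MvPolynomial (Fin 3) ℝ) |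
    Disjoint (p : Set (MvPolynomial (Fin 3) ℝ)) denomMonoid} (fun c hc hc' x hx ↦ ?_) I hI
  have : Nonempty c := ⟨⟨x, hx⟩⟩
  refine ⟨sSup c, Set.disjoint_left.mpr fun x hx ↦ ?_, fun _ ↦ le_sSup⟩
  have ⟨p, hp⟩ := (Submodule.mem_iSup_of_directed _ hc'.directed).mp (sSup_eq_iSup' c ▸ hx)
  exact Set.disjoint_left.mp (hc p.2) hp

lemma exists_irreducible_mem {P R : MvPolynomial (Fin 3) ℝ} (hP : P ≠ 0) (hR : R ≠ 0)
    (hPR : IsRelPrime P R) {p : Ideal (MvPolynomial (Fin 3) ℝ)} (hp : MaxDisjoint p) (hPp : P ∈ p)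
    (hRp : R ∈ p) :
    ∃ r ∈ p, Irreducible r ∧ degreeOf 1 r = 0 ∧ ¬ X 2 ∣ r ∧ 0 < degreeOf 2 r := by
  have hpp := hp.isPrime
  have hsub : Ideal.span {P, R} ≤ p := by
    rw [Ideal.span_le]; rintro z (rfl | rfl)
    · exact hPp
    · exact hRp
  obtain ⟨f, hfp, hf0, hf1⟩ : ∃ f ∈ p, f ≠ 0 ∧ degreeOf 1 f = 0 := by
    by_contra! hno
    set B := fun i : Fin 3 => degreeOf i P + degreeOf i R + 1
    set J := mixedDegree P R 0 + mixedDegree P R 2 + (B 0 * mixedDegree P R 0 +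
      B 1 * mixedDegree P R 1 + B 2 * mixedDegree P R 2) + 1 with hJ
    have hli : LinearIndependent ℝ fun a : Fin J × Fin J =>
        (basisMonomials (Fin 3) ℝ (Finsupp.single 0 (a.1 : ℕ) + Finsupp.single 2 (a.2 : ℕ))) := by
      refine (basisMonomials (Fin 3) ℝ).linearIndependent.comp
        (fun a : Fin J × Fin J => Finsupp.single 0 (a.1 : ℕ) + Finsupp.single 2 (a.2 : ℕ)) ?_
      intro a b hab
      have e0 := DFunLike.congr_fun hab 0
      have e2 := DFunLike.congr_fun hab 2
      simp at e0 e2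
      exact Prod.ext (Fin.ext e0) (Fin.ext e2)
    have hmon : ∀ a b : ℕ, basisMonomials (Fin 3) ℝ (Finsupp.single 0 a + Finsupp.single 2 b) =
        X 0 ^ a * X 2 ^ b := by
      intro a b
      rw [coe_basisMonomials, X_pow_eq_monomial, X_pow_eq_monomial, monomial_mul, one_mul]
    have hdeg : ∀ (a b : ℕ) (i : Fin 3), degreeOf i (X 0 ^ a * X 2 ^ b : MvPolynomial (Fin 3) ℝ) ≤
        (if 0 = i then a else 0) + if 2 = i then b else 0 := by
      intro a b i
      refine (degreeOf_mul_le _ _ _).trans (add_le_add ?_ ?_)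
      · refine (degreeOf_pow_le _ _ _).trans ((Nat.mul_le_mul_left _ (degreeOf_X_le i 0)).trans ?_)
        split_ifs <;> simp
      · refine (degreeOf_pow_le _ _ _).trans ((Nat.mul_le_mul_left _ (degreeOf_X_le i 2)).trans ?_)
        split_ifs <;> simp
    have key := card_le_of_independent_mod hP hR hPR ![B 0 + J, B 1, B 2 + J] (by
        intro i; fin_cases i <;> simp [B] <;> omega) (ι := Fin J × Fin J)
        (fun a => X 0 ^ (a.1 : ℕ) * X 2 ^ (a.2 : ℕ)) (by
        rintro ⟨a, b⟩
        apply mem_polyBox_of_degreeOf_lt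
        intro i
        have := a.2
        have := b.2
        refine (hdeg a b i).trans_lt ?_
        fin_cases i <;> simp [B] <;> omega) (by
        intro c hc
        have h1 : ∑ a : Fin J × Fin J, C (c a) * (X 0 ^ (a.1 : ℕ) * X 2 ^ (a.2 : ℕ)) =
          (0 : MvPolynomial (Fin 3) ℝ) := by
          by_contra hne
          refine hno _ (hsub hc) hne ?_
          refine Nat.le_zero.1 ((degreeOf_sum_le _ _ _).trans (Finset.sup_le fun a _ => ?_))
          exact (degreeOf_C_mul_le _ _ _).trans (hdeg _ _ _)
        have h2 := Fintype.linearIndependent_iff.1 hli c (by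
          rw [← h1]
          exact Finset.sum_congr rfl fun a _ => by rw [hmon, smul_eq_C_mul])
        funext a; exact h2 a)
    rw [Fintype.card_prod, Fintype.card_fin, Fin.sum_univ_three] at key
    simp only [Matrix.cons_val_zero, Matrix.cons_val_one, Matrix.cons_val] at key
    have : J * J = J * mixedDegree P R 0 + J * mixedDegree P R 2 + J * (B 0 * mixedDegree P R 0 +
      B 1 * mixedDegree P R 1 + B 2 * mixedDegree P R 2) + J := by
      nth_rewrite 2 [hJ]
      rw [mul_add, mul_add, mul_add, mul_one]
    have h3 : (B 0 * mixedDegree P R 0 + B 1 * mixedDegree P R 1 + B 2 * mixedDegree P R 2) ≤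
      J * (B 0 * mixedDegree P R 0 + B 1 * mixedDegree P R 1 + B 2 * mixedDegree P R 2) :=
      Nat.le_mul_of_pos_left _ (by omega)
    have hJ0 : 0 < J := by omega
    have k1 : (B 0 + J) * mixedDegree P R 0 = B 0 * mixedDegree P R 0 + J * mixedDegree P R 0 :=
      add_mul _ _ _
    have k2 : (B 2 + J) * mixedDegree P R 2 = B 2 * mixedDegree P R 2 + J * mixedDegree P R 2 :=
      add_mul _ _ _
    rw [this, k1, k2] at key
    omega
  have hfac : ∃ r ∈ p, Irreducible r ∧ r ∣ f := by
    obtain ⟨z, hz⟩ := UniqueFactorizationMonoid.factors_prod hf0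
    have h1 : (UniqueFactorizationMonoid.factors f).prod ∈ p := by
      have h2 : (UniqueFactorizationMonoid.factors f).prod * z ∈ p := by rw [hz]; exact hfp
      rcases hpp.mem_or_mem h2 with h | h
      · exact h
      · exact absurd (Ideal.eq_top_of_isUnit_mem _ h z.isUnit) hpp.ne_top
    obtain ⟨r, hr, hrp⟩ := (Ideal.IsPrime.multiset_prod_mem_iff_exists_mem hpp _).1 h1
    exact ⟨r, hrp, UniqueFactorizationMonoid.irreducible_of_factor r hr,
      UniqueFactorizationMonoid.dvd_of_mem_factors hr⟩
  obtain ⟨r, hrp, hr, hrf⟩ := hfac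
  have hr1 : degreeOf 1 r = 0 := by
    have := degreeOf_le_of_dvd hf0 hrf 1
    omega
  have hrY : ¬ X 2 ∣ r := by
    rintro ⟨z, hz⟩
    rcases hr.isUnit_or_isUnit hz with h | h
    · exact hp.notMem X_two_mem_denomMonoid (by
        exact absurd (Ideal.eq_top_of_isUnit_mem _ (hz ▸ hrp : X 2 * z ∈ p) (by
          exfalso
          obtain ⟨a, -, ha⟩ := MvPolynomial.isUnit_iff_eq_C_of_isReduced.1 h
          have := congrArg (degreeOf 2) ha
          rw [degreeOf_X_self, degreeOf_C] at this
          exact one_ne_zero this)) hpp.ne_top)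
    · refine hp.notMem X_two_mem_denomMonoid ?_
      rw [hz] at hrp
      rcases hpp.mem_or_mem hrp with h' | h'
      · exact h'
      · exact absurd (Ideal.eq_top_of_isUnit_mem _ h' h) hpp.ne_top
  refine ⟨r, hrp, hr, hr1, hrY, Nat.pos_of_ne_zero fun h2 => ?_⟩
  have e : r = Polynomial.aeval (X 0) (aeval ![Polynomial.X, 0, 0] r : Polynomial ℝ) := by
    apply MvPolynomial.funext
    intro x
    rw [eval_aeval_X]
    have e1 : eval x r = eval ![x 0, 0, 0] r := by
      rw [eval_congr_of_degreeOf_eq_zero hr1 (y := ![x 0, 0, x 2]) (by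
        intro j hj; fin_cases j <;> simp_all)]
      exact eval_congr_of_degreeOf_eq_zero h2 (by
        intro j hj; fin_cases j <;> simp_all)
    rw [e1]
    have e2 : (Polynomial.aeval (x 0)).comp (aeval ![Polynomial.X, 0, 0]) =
        (aeval ![x 0, 0, 0] : MvPolynomial (Fin 3) ℝ →ₐ[ℝ] ℝ) := by
      apply algHom_ext
      intro i; fin_cases i <;> simp
    have h := congrArg (fun φ => φ r) e2
    simpa [aeval_eq_eval, Polynomial.aeval_def] using h.symm
  refine hp.notMem (aeval_mem_denomMonoid (h := aeval ![Polynomial.X, 0, 0] r) ?_) (e ▸ hrp)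
  intro h0
  rw [h0, map_zero] at e
  exact hr.ne_zero e

end

section

open MvPolynomial
open scoped Pointwise

section

variable {G : Type*} [AddCommGroup G] (v u w : G →+ ℝ)

lemma transl_mem_denomMonoid (g : G) {x : MvPolynomial (Fin 3) ℝ} (hx : x ∈ denomMonoid) :
    transl v u w g x ∈ denomMonoid := by
  obtain ⟨h, s, hh, rfl⟩ := hx
  refine ⟨Polynomial.C (Real.exp (w g) ^ s) * h.comp (Polynomial.X + Polynomial.C (v g)), s,
    mul_ne_zero (Polynomial.C_ne_zero.2 (pow_ne_zero _ (Real.exp_ne_zero _))) ?_, ?_⟩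
  · rw [Ne, Polynomial.comp_X_add_C_eq_zero_iff]; exact hh
  · have e0 : transl v u w g (X 0) = X 0 + C (v g) := by simp [transl]
    have e2 : transl v u w g (X 2) = C (Real.exp (w g)) * X 2 := by simp [transl]
    rw [map_mul, map_pow, e2, ← Polynomial.aeval_algHom_apply, e0, map_mul, Polynomial.aeval_C,
      Polynomial.aeval_comp, map_add, Polynomial.aeval_X, Polynomial.aeval_C, algebraMap_eq,
      mul_pow, map_pow]
    ring

lemma MaxDisjoint.comap_transl {p : Ideal (MvPolynomial (Fin 3) ℝ)} (hp : MaxDisjoint p) (g : G) :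
    MaxDisjoint (p.comap (transl v u w g)) := by
  refine ⟨Set.disjoint_left.2 fun x hx hxM =>
    hp.notMem (transl_mem_denomMonoid v u w g hxM) (Ideal.mem_comap.1 (SetLike.mem_coe.1 hx)),
    fun q hq hle y hy => ?_⟩
  have h1 : Disjoint ((q.comap (transl v u w (-g)) : Ideal _) : Set (MvPolynomial (Fin 3) ℝ))
      denomMonoid :=
    Set.disjoint_left.2 fun x hx hxM =>
      Set.disjoint_left.1 hq (SetLike.mem_coe.2 (Ideal.mem_comap.1 (SetLike.mem_coe.1 hx)))
        (transl_mem_denomMonoid v u w (-g) hxM)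
  have h2 : p ≤ q.comap (transl v u w (-g)) := fun x hx => by
    rw [Ideal.mem_comap]
    apply hle
    rw [Ideal.mem_comap, transl_transl_neg]
    exact hx
  rw [Ideal.mem_comap]
  refine hp.2 h1 h2 ?_
  rw [Ideal.mem_comap, transl_neg_transl]
  exact hy

lemma MaxDisjoint.not_isRelPrime {p : Ideal (MvPolynomial (Fin 3) ℝ)} (hp : MaxDisjoint p)
    {r s : MvPolynomial (Fin 3) ℝ} (hr : r ∈ p) (hs : s ∈ p) (hr0 : r ≠ 0) (hs0 : s ≠ 0)
    (hr1 : degreeOf 1 r = 0) (hs1 : degreeOf 1 s = 0) : ¬ IsRelPrime r s := by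
  intro hrs
  have hsub : Ideal.span {r, s} ≤ p := by
    rw [Ideal.span_le]; rintro z (rfl | rfl)
    · exact hr
    · exact hs
  set m := mixedDegree r s 1 with hm
  have key := card_le_of_independent_mod hr0 hs0 hrs
    ![degreeOf 0 r + degreeOf 0 s + m + 1, 1, degreeOf 2 r + degreeOf 2 s + 1] (by
      intro i; fin_cases i
      · simp; omega
      · simp; omega
      · simp) (ι := Fin (m + 1)) (fun j => X 0 ^ (j : ℕ)) (by
      intro j
      apply mem_polyBox_of_degreeOf_lt
      intro i
      have hj := j.2
      refine (degreeOf_pow_le i _ _).trans_lt ?_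
      have hX := Nat.mul_le_mul_left (j : ℕ) (degreeOf_X_le i 0)
      refine hX.trans_lt ?_
      fin_cases i
      · simp; omega
      · simp
      · simp) (by
      intro c hc
      rw [← aeval_polyOfCoeffs] at hc
      apply polyOfCoeffs_eq_zero
      by_contra hne
      exact hp.notMem (aeval_mem_denomMonoid hne) (hsub hc))
  rw [Fintype.card_fin, Fin.sum_univ_three] at key
  have e0 : mixedDegree r s 0 = 0 := by
    simp only [mixedDegree, zero_add, hr1, hs1, zero_mul, mul_zero]
  have e2 : mixedDegree r s 2 = 0 := by
    simp only [mixedDegree, show (2 : Fin 3) + 2 = 1 from rfl, hr1, hs1, zero_mul, mul_zero, add_zero]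
  rw [e0, e2] at key
  simp only [Matrix.cons_val_one, Matrix.cons_val_zero, mul_zero, add_zero, zero_add,
    one_mul] at key
  omega

lemma MaxDisjoint.map_eq_zero_of_comap_eq {P R : MvPolynomial (Fin 3) ℝ} (hP : P ≠ 0) (hR : R ≠ 0)
    (hPR : IsRelPrime P R) {p : Ideal (MvPolynomial (Fin 3) ℝ)} (hp : MaxDisjoint p) (hPp : P ∈ p)
    (hRp : R ∈ p) {g : G} (hg : p ≤ p.comap (transl v u w g)) : w g = 0 := by
  obtain ⟨r, hr, hri, hr1, hrY, hr2⟩ := exists_irreducible_mem hP hR hPR hp hPp hRp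
  have hτ : transl v u w g r ∈ p := Ideal.mem_comap.1 (hg hr)
  by_cases hdvd : r ∣ transl v u w g r
  · obtain ⟨z, hz⟩ := hri.associated_of_dvd (irreducible_transl v u w g hri) hdvd
    obtain ⟨c, -, hc⟩ := MvPolynomial.isUnit_iff_eq_C_of_isReduced.1 z.isUnit
    exact (stabilizer_aux v u w hrY (h := g) (c := c) (by rw [← hz, hc, mul_comm])).2 hr2
  · exact absurd ((hri.isRelPrime_iff_not_dvd).2 hdvd) (hp.not_isRelPrime hr hτ hri.ne_zero
      (irreducible_transl v u w g hri).ne_zero hr1 (by rw [degreeOf_transl, hr1]))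

lemma MaxDisjoint.eq_of_le {p q : Ideal (MvPolynomial (Fin 3) ℝ)} (hp : MaxDisjoint p)
    (hq : MaxDisjoint q) (h : p ≤ q) : p = q := le_antisymm h (hp.2 hq.1 h)

lemma MaxDisjoint.eq_zero_of_aeval_mem {p : Ideal (MvPolynomial (Fin 3) ℝ)} (hp : MaxDisjoint p)
    {g : Polynomial ℝ} (hg : Polynomial.aeval (X 0 : MvPolynomial (Fin 3) ℝ) g ∈ p) : g = 0 := by
  by_contra hne
  exact hp.notMem (aeval_mem_denomMonoid hne) hg

lemma finite_maxDisjoint {P R : MvPolynomial (Fin 3) ℝ} (hP : P ≠ 0) (hR : R ≠ 0)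
    (hPR : IsRelPrime P R) :
    {p : Ideal (MvPolynomial (Fin 3) ℝ) | MaxDisjoint p ∧ P ∈ p ∧ R ∈ p}.Finite := by
  by_contra hinf
  obtain ⟨t, ht, hcard⟩ := Set.Infinite.exists_subset_card_eq hinf (mixedDegree P R 0 + 1)
  have := card_primes_le hP hR hPR 0 (ι := t) (fun l => l.1) (fun l => (ht l.2).1.isPrime)
    (fun l l' hne h => hne (Subtype.ext ((ht l.2).1.eq_of_le (ht l'.2).1 h)))
    (fun l => (ht l.2).2.1) (fun l => (ht l.2).2.2)
    (fun l g hg => (ht l.2).1.eq_zero_of_aeval_mem hg)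
  rw [Fintype.card_coe, hcard] at this
  omega

lemma exists_transl_notMem [DecidableEq G] {P R : MvPolynomial (Fin 3) ℝ} (hP : P ≠ 0) (hR : R ≠ 0)
    (hPR : IsRelPrime P R) {E₁ E₂ : Finset G}
    (hRE : R ∈ Submodule.span ℝ ((fun g => transl v u w g P) '' E₁)) (h0 : 0 ∈ E₁)
    (hw : Set.InjOn w E₂) (hE₂ : mixedDegree P R 0 < E₂.card)
    {p : Ideal (MvPolynomial (Fin 3) ℝ)} (hp : MaxDisjoint p) :
    ∃ g ∈ E₁ + E₂, transl v u w g P ∉ p := by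
  by_contra! hall
  have hP' : ∀ g ∈ E₂, P ∈ p.comap (transl v u w g) := fun g hg => by
    have := hall (0 + g) (Finset.add_mem_add h0 hg)
    rw [zero_add] at this
    exact Ideal.mem_comap.2 this
  have hR' : ∀ g ∈ E₂, R ∈ p.comap (transl v u w g) := fun g hg => by
    clear hR hPR hE₂
    induction hRE using Submodule.span_induction with
    | mem x hx =>
      obtain ⟨g', hg', rfl⟩ := hx
      rw [Ideal.mem_comap, ← transl_add, add_comm]
      exact hall _ (Finset.add_mem_add hg' hg)
    | zero => exact Ideal.zero_mem _
    | add x y _ _ hx hy => exact Ideal.add_mem _ hx hy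
    | smul a x _ hx => rw [smul_eq_C_mul]; exact Ideal.mul_mem_left _ _ hx
  have hm := fun g => hp.comap_transl v u w g
  have := card_primes_le hP hR hPR 0 (ι := E₂) (fun l => p.comap (transl v u w l))
    (fun l => (hm l).isPrime) (fun l l' hne h => hne (by
      have hst := (hm l).map_eq_zero_of_comap_eq v u w hP hR hPR (hP' l l.2) (hR' l l.2)
        (g := (l' : G) - l) (fun x hx => by
          have h1 : transl v u w l' x ∈ p := Ideal.mem_comap.1 (h hx)
          rw [Ideal.mem_comap, Ideal.mem_comap, ← transl_add, add_sub_cancel]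
          exact h1)
      rw [map_sub, sub_eq_zero] at hst
      exact Subtype.ext (hw l.2 l'.2 hst.symm)))
    (fun l => hP' l l.2) (fun l => hR' l l.2) (fun l g hg => (hm l).eq_zero_of_aeval_mem hg)
  rw [Fintype.card_coe] at this
  omega

lemma exists_mem_span_third [DecidableEq G] {P R : MvPolynomial (Fin 3) ℝ} (hP : P ≠ 0) (hR : R ≠ 0)
    (hPR : IsRelPrime P R) {E₁ E₂ : Finset G}
    (hRE : R ∈ Submodule.span ℝ ((fun g => transl v u w g P) '' E₁)) (h0 : 0 ∈ E₁)
    (hw : Set.InjOn w E₂) (hE₂ : mixedDegree P R 0 < E₂.card) :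
    ∃ S ∈ Submodule.span ℝ ((fun g => transl v u w g P) '' ((E₁ + E₂ : Finset G) : Set G)),
      ∃ a, ∃ m ∈ denomMonoid, m - a * S ∈ Ideal.span {P, R} := by
  have := (finite_maxDisjoint hP hR hPR).to_subtype
  obtain ⟨S, hS, hSn⟩ := exists_mem_span_notMem (fun g => transl v u w g P) (E₁ + E₂)
    (ι := {p : Ideal (MvPolynomial (Fin 3) ℝ) | MaxDisjoint p ∧ P ∈ p ∧ R ∈ p})
    (fun i => (i : Ideal (MvPolynomial (Fin 3) ℝ)).restrictScalars ℝ)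
    (fun i => exists_transl_notMem v u w hP hR hPR hRE h0 hw hE₂ i.2.1)
  refine ⟨S, hS, ?_⟩
  by_contra! hno
  obtain ⟨p, hle, hp⟩ := exists_maxDisjoint_ge (I := Ideal.span {S} ⊔ Ideal.span {P, R})
    (Set.disjoint_left.2 fun m hm hmM => by
      obtain ⟨x, hx, y, hy, hxy⟩ := Submodule.mem_sup.1 hm
      obtain ⟨a, rfl⟩ := Ideal.mem_span_singleton'.1 hx
      refine hno a m hmM ?_
      rw [← hxy, add_sub_cancel_left]; exact hy)
  have hPp : P ∈ p := hle (Ideal.mem_sup_right (Ideal.subset_span (by simp)))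
  have hRp : R ∈ p := hle (Ideal.mem_sup_right (Ideal.subset_span (by simp)))
  exact hSn ⟨p, hp, hPp, hRp⟩
    (hle (Ideal.mem_sup_left (Ideal.mem_span_singleton_self S)))

end

lemma mem_span_pair_of_X_sub_C_mul {P R g : MvPolynomial (Fin 3) ℝ} {c : ℝ}
    (hc : IsRelPrime (specialize 0 c P) (specialize 0 c R))
    (hg : (X 0 - C c) * g ∈ Ideal.span {P, R}) : g ∈ Ideal.span {P, R} := by
  rw [Ideal.mem_span_pair] at hg ⊢
  obtain ⟨a, b, hab⟩ := hg
  have h0 := congrArg (specialize 0 c) hab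
  rw [map_add, map_mul, map_mul, map_mul, map_sub, specialize_X_self, algHom_C, algebraMap_eq,
    sub_self, zero_mul] at h0
  obtain ⟨z, hz1, hz2⟩ : ∃ z, specialize 0 c a = -(z * specialize 0 c R) ∧
      specialize 0 c b = z * specialize 0 c P := by
    by_cases hP0 : specialize 0 c P = 0
    · rw [hP0] at hc h0 ⊢
      have hu : IsUnit (specialize 0 c R) := hc (dvd_zero _) dvd_rfl
      obtain ⟨y, hy⟩ := hu.exists_left_inv
      refine ⟨-specialize 0 c a * y, by rw [mul_assoc, hy]; ring, ?_⟩
      rw [mul_zero, zero_add] at h0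
      rw [mul_zero]
      exact (mul_eq_zero.1 h0).resolve_right (fun h => hu.ne_zero h)
    · have hd : specialize 0 c P ∣ specialize 0 c b * specialize 0 c R :=
        ⟨-specialize 0 c a, by linear_combination h0⟩
      obtain ⟨z, hz⟩ := hc.dvd_of_dvd_mul_right hd
      refine ⟨z, ?_, by rw [hz, mul_comm]⟩
      apply mul_left_cancel₀ hP0
      rw [hz] at h0
      linear_combination h0
  obtain ⟨a', ha'⟩ := X_sub_C_dvd_sub_specialize 0 c a
  obtain ⟨b', hb'⟩ := X_sub_C_dvd_sub_specialize 0 c b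
  obtain ⟨P', hP'⟩ := X_sub_C_dvd_sub_specialize 0 c P
  obtain ⟨R', hR'⟩ := X_sub_C_dvd_sub_specialize 0 c R
  have hX : (X 0 - C c : MvPolynomial (Fin 3) ℝ) ≠ 0 := by
    intro h
    have := congrArg (eval ![c + 1, 0, 0]) h
    simp at this
  refine ⟨a' + z * R', b' - z * P', mul_left_cancel₀ hX ?_⟩
  rw [← hab]
  linear_combination (-P) * ha' - R * hb' - z * P * hR' + z * R * hP' + (-P) * hz1 - R * hz2

lemma eval_eq_zero_of_mul_mem {P R f m : MvPolynomial (Fin 3) ℝ} {x : Fin 3 → ℝ}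
    (hc : IsRelPrime (specialize 0 (x 0) P) (specialize 0 (x 0) R)) (hx : x 2 ≠ 0)
    (hP : eval x P = 0) (hR : eval x R = 0) (hm : m ∈ denomMonoid)
    (hf : m * f ∈ Ideal.span {P, R}) : eval x f = 0 := by
  obtain ⟨h, s, hh, rfl⟩ := hm
  obtain ⟨h', hh', hnd⟩ := Polynomial.exists_eq_pow_rootMultiplicity_mul_and_not_dvd h hh (x 0)
  have hcancel : ∀ (e : ℕ) g, (X 0 - C (x 0)) ^ e * g ∈ Ideal.span {P, R} →
      g ∈ Ideal.span {P, R} := by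
    intro e
    induction e with
    | zero => intro g hg; simpa using hg
    | succ e ih =>
      intro g hg
      rw [pow_succ, mul_assoc] at hg
      exact mem_span_pair_of_X_sub_C_mul hc (ih _ hg)
  have h1 : Polynomial.aeval (X 0) h' * X 2 ^ s * f ∈ Ideal.span {P, R} := by
    apply hcancel (h.rootMultiplicity (x 0))
    rw [hh', map_mul, map_pow, map_sub, Polynomial.aeval_X, Polynomial.aeval_C, algebraMap_eq] at hf
    convert hf using 1
    ring
  rw [Ideal.mem_span_pair] at h1
  obtain ⟨a, b, hab⟩ := h1
  have h2 := congrArg (eval x) hab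
  rw [map_add, map_mul, map_mul, hP, hR, map_mul, map_mul, map_pow, eval_X, eval_aeval_X] at h2
  have h3 : h'.eval (x 0) ≠ 0 := fun h0 => hnd (Polynomial.dvd_iff_isRoot.2 h0)
  have h4 : h'.eval (x 0) * x 2 ^ s ≠ 0 := mul_ne_zero h3 (pow_ne_zero _ hx)
  exact (mul_eq_zero.1 (by linear_combination -h2 : h'.eval (x 0) * x 2 ^ s * eval x f = 0)).resolve_left h4

lemma exists_irreducible_dvd_of_not_isRelPrime {P R : MvPolynomial (Fin 3) ℝ}
    (hP0 : degreeOf 0 P = 0) (hR0 : degreeOf 0 R = 0) (h : ¬ IsRelPrime P R) :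
    ∃ D, Irreducible D ∧ D ∣ P ∧ D ∣ R ∧ degreeOf 0 D = 0 := by
  rw [IsRelPrime] at h
  push Not at h
  obtain ⟨d, hdP, hdR, hd⟩ := h
  by_cases hd0 : d = 0
  · subst hd0
    refine ⟨X 1, X_prime.irreducible, ?_, ?_, degreeOf_X_of_ne (by decide)⟩
    · rw [zero_dvd_iff.1 hdP]; exact dvd_zero _
    · rw [zero_dvd_iff.1 hdR]; exact dvd_zero _
  · obtain ⟨D, hD, hDd⟩ := WfDvdMonoid.exists_irreducible_factor hd hd0
    by_cases hPz : P = 0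
    · by_cases hRz : R = 0
      · refine ⟨X 1, X_prime.irreducible, ?_, ?_, degreeOf_X_of_ne (by decide)⟩
        · rw [hPz]; exact dvd_zero _
        · rw [hRz]; exact dvd_zero _
      · exact ⟨D, hD, hDd.trans hdP, hDd.trans hdR,
          Nat.le_zero.1 (hR0 ▸ degreeOf_le_of_dvd hRz (hDd.trans hdR) 0)⟩
    · exact ⟨D, hD, hDd.trans hdP, hDd.trans hdR,
          Nat.le_zero.1 (hP0 ▸ degreeOf_le_of_dvd hPz (hDd.trans hdP) 0)⟩

lemma aeval_X_ne_zero (i : Fin 3) {g : Polynomial ℝ} (hg : g ≠ 0) :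
    Polynomial.aeval (X i : MvPolynomial (Fin 3) ℝ) g ≠ 0 := by
  intro h
  apply hg
  apply Polynomial.funext
  intro r
  have := congrArg (eval fun _ => r) h
  rw [eval_aeval_X] at this
  simpa using this

lemma eq_zero_of_dvd_aeval_X {D : MvPolynomial (Fin 3) ℝ} {i j : Fin 3} (hij : i ≠ j)
    (hD : degreeOf i D ≠ 0) {g : Polynomial ℝ}
    (h : D ∣ Polynomial.aeval (X j : MvPolynomial (Fin 3) ℝ) g) : g = 0 := by
  by_contra hne
  have := degreeOf_le_of_dvd (aeval_X_ne_zero j hne) h i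
  rw [degreeOf_aeval_X_of_ne hij] at this
  omega

lemma card_not_isRelPrime_specialize_le {P R : MvPolynomial (Fin 3) ℝ} (hP : P ≠ 0) (hR : R ≠ 0)
    (hPR : IsRelPrime P R) (s : Finset ℝ)
    (hs : ∀ c ∈ s, ¬ IsRelPrime (specialize 0 c P) (specialize 0 c R)) :
    s.card ≤ mixedDegree P R 1 + mixedDegree P R 2 := by
  classical
  have hD : ∀ c : s, ∃ D, Irreducible D ∧ D ∣ specialize 0 (c : ℝ) P ∧ D ∣ specialize 0 (c : ℝ) R ∧
      degreeOf 0 D = 0 := fun c =>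
    exists_irreducible_dvd_of_not_isRelPrime (degreeOf_specialize_self _ _ _)
      (degreeOf_specialize_self _ _ _) (hs c c.2)
  choose D hDi hDP hDR hD0 using hD
  set q : s → Ideal (MvPolynomial (Fin 3) ℝ) := fun c =>
    (Ideal.span {D c}).comap (specialize 0 (c : ℝ)) with hq
  have hmem : ∀ c x, x ∈ q c ↔ D c ∣ specialize 0 (c : ℝ) x := fun c x => by
    rw [hq, Ideal.mem_comap, Ideal.mem_span_singleton]
  have hprime : ∀ c, (q c).IsPrime := fun c => by
    have := (Ideal.span_singleton_prime (hDi c).ne_zero).2 (hDi c).prime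
    exact Ideal.comap_isPrime _ _
  have hinc : ∀ c c', c ≠ c' → ¬ q c ≤ q c' := by
    intro c c' hne hle
    have h1 : X 0 - C (c : ℝ) ∈ q c' := hle ((hmem _ _).2 (by
      rw [map_sub, specialize_X_self, algHom_C, algebraMap_eq, sub_self]; exact dvd_zero _))
    rw [hmem, map_sub, specialize_X_self, algHom_C, algebraMap_eq, ← C_sub] at h1
    refine (hDi c').not_isUnit (isUnit_of_dvd_unit h1 ?_)
    exact (IsUnit.mk0 ((c' : ℝ) - c) (sub_ne_zero.2 fun h => hne (Subtype.ext h.symm))).map C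
  have h1 := card_primes_le hP hR hPR 1 (ι := {c : s // degreeOf 2 (D c) ≠ 0}) (fun c => q c)
    (fun c => hprime c) (fun c c' hne => hinc _ _ fun h => hne (Subtype.ext h))
    (fun c => (hmem _ _).2 (hDP c)) (fun c => (hmem _ _).2 (hDR c)) (fun c g hg => by
      rw [hmem, ← Polynomial.aeval_algHom_apply, specialize_X_of_ne (by decide)] at hg
      exact eq_zero_of_dvd_aeval_X (by decide) c.2 hg)
  have h2 := card_primes_le hP hR hPR 2 (ι := {c : s // ¬ degreeOf 2 (D c) ≠ 0}) (fun c => q c)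
    (fun c => hprime c) (fun c c' hne => hinc _ _ fun h => hne (Subtype.ext h))
    (fun c => (hmem _ _).2 (hDP c)) (fun c => (hmem _ _).2 (hDR c)) (fun c g hg => by
      rw [hmem, ← Polynomial.aeval_algHom_apply, specialize_X_of_ne (by decide)] at hg
      refine eq_zero_of_dvd_aeval_X (i := 1) (by decide) (fun h1 => ?_) hg
      obtain ⟨i, hi⟩ := exists_degreeOf_ne_zero (hDi c).not_isUnit (hDi c).ne_zero
      fin_cases i
      · exact hi (hD0 c)
      · exact hi h1
      · exact c.2 hi)
  have h3 := Fintype.card_subtype_compl (fun c : s => degreeOf 2 (D c) ≠ 0)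
  rw [Fintype.card_coe] at h3
  omega

end

section

open MvPolynomial
open scoped Pointwise

lemma coeffs_eq_zero_of_mul_mem {P R S a m₀ : MvPolynomial (Fin 3) ℝ} (hm₀ : m₀ ∈ denomMonoid)
    (hS : m₀ - a * S ∈ Ideal.span {P, R}) (s : Finset ℝ)
    (hs : ∀ c ∈ s, IsRelPrime (specialize 0 c P) (specialize 0 c R) ∧
      ∃ x : Fin 3 → ℝ, x 0 = c ∧ x 2 ≠ 0 ∧ eval x P = 0 ∧ eval x R = 0 ∧ eval x S = 0) {J : ℕ}
    (c : Fin J → Fin s.card → ℝ) {m : MvPolynomial (Fin 3) ℝ} (hm : m ∈ denomMonoid)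
    (h : m * ∑ j, Polynomial.aeval (X 0) (polyOfCoeffs (c j)) * S ^ (j : ℕ) ∈ Ideal.span {P, R}) :
    c = 0 := by
  induction J generalizing m with
  | zero => exact Subsingleton.elim _ _
  | succ J ih =>
    have hsum : ∑ j, Polynomial.aeval (X 0) (polyOfCoeffs (c j)) * S ^ (j : ℕ) =
        Polynomial.aeval (X 0) (polyOfCoeffs (c 0)) +
        S * ∑ j : Fin J, Polynomial.aeval (X 0) (polyOfCoeffs (c j.succ)) * S ^ (j : ℕ) := by
      rw [Fin.sum_univ_succ, Finset.mul_sum]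
      simp only [Fin.val_zero, pow_zero, mul_one, Fin.val_succ]
      congr 1
      exact Finset.sum_congr rfl fun j _ => by ring
    have h0 : c 0 = 0 := by
      apply polyOfCoeffs_eq_zero_of_eval _ s le_rfl
      intro y hy
      obtain ⟨hrel, x, hx0, hx2, hxP, hxR, hxS⟩ := hs y hy
      have := eval_eq_zero_of_mul_mem (by rwa [hx0]) hx2 hxP hxR hm h
      rw [hsum, map_add, map_mul, hxS, zero_mul, add_zero, eval_aeval_X, hx0] at this
      exact this
    have hz : polyOfCoeffs (c 0) = 0 := by rw [h0]; simp [polyOfCoeffs]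
    have h1 := ih (fun j => c j.succ) (Submonoid.mul_mem _ hm₀ hm) (by
      rw [hsum, hz, map_zero, zero_add] at h
      set F := ∑ j : Fin J, Polynomial.aeval (X 0) (polyOfCoeffs (c j.succ)) * S ^ (j : ℕ)
      have h2 := Ideal.add_mem _ (Ideal.mul_mem_left _ a h) (Ideal.mul_mem_left _ (m * F) hS)
      convert h2 using 1
      ring)
    funext j
    refine Fin.cases h0 (fun i => congrFun h1 i) j

section

variable {G : Type*} [AddCommGroup G] [DecidableEq G] (v u w : G →+ ℝ)

lemma zero_estimate_aux {P : MvPolynomial (Fin 3) ℝ} (hP : P ≠ 0) (hY : ¬ X 2 ∣ P) {K T : ℕ}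
    (h0 : degreeOf 0 P < K) (h1 : degreeOf 1 P < K) (h2 : degreeOf 2 P < T)
    (E₁ E₂ E₃ : Finset G) (hE₁ : 0 ∈ E₁) (hE₂ : 0 ∈ E₂) (hv : Set.InjOn v E₃)
    (hC : ∀ e : ℝ × ℝ →ₗ[ℝ] ℝ, e ≠ 0 → 2 * K ≤ (E₁.image fun g => e (v g, u g)).card)
    (hC' : T ≤ (E₁.image w).card) (hw : Set.InjOn w E₂) (hE₂' : 2 * K * T < E₂.card)
    (hE₃ : 6 * K ^ 2 * T + 2 * K * T + 2 * K ^ 2 < E₃.card)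
    (hz : ∀ g₁ ∈ E₁, ∀ g₂ ∈ E₂, ∀ g₃ ∈ E₃, eval (pt v u w (g₁ + g₂ + g₃)) P = 0) : False := by
  classical
  obtain ⟨R, hRs, hR, hPR⟩ := exists_isRelPrime_span_transl v u w hP hY E₁ ⟨0, hE₁⟩
    (fun e he _ => by have := hC e he; omega) (by omega)
  have hRd := degreeOf_le_of_mem_span v u w hRs
  have hm : ∀ a b c d A B : ℕ, a ≤ A → b ≤ B → c ≤ B → d ≤ A → a * b + c * d ≤ 2 * A * B := by
    intro a b c d A B ha hb hc hd
    have e1 := Nat.mul_le_mul ha hb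
    have e2 := Nat.mul_le_mul hc hd
    rw [mul_comm B A] at e2
    rw [mul_assoc]; omega
  have hR0 := hRd 0
  have hR1 := hRd 1
  have hR2 := hRd 2
  have m0 : mixedDegree P R 0 ≤ 2 * K * T := hm _ _ _ _ _ _ h1.le (by change degreeOf 2 R ≤ T; omega)
    h2.le (by change degreeOf 1 R ≤ K; omega)
  have m1 : mixedDegree P R 1 ≤ 2 * K * T := by
    rw [mul_right_comm]
    exact hm _ _ _ _ _ _ h2.le (by change degreeOf 0 R ≤ K; omega) h0.le
      (by change degreeOf 2 R ≤ T; omega)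
  have m2 : mixedDegree P R 2 ≤ 2 * K ^ 2 := by
    rw [sq, ← mul_assoc]
    exact hm _ _ _ _ _ _ h0.le (by change degreeOf 1 R ≤ K; omega) h1.le
      (by change degreeOf 0 R ≤ K; omega)
  obtain ⟨S, hSs, a, m₀, hm₀, hS⟩ := exists_mem_span_third v u w hP hR hPR hRs hE₁ hw (by omega)
  have hSd := degreeOf_le_of_mem_span v u w hSs
  set s := (E₃.image v).filter fun c => IsRelPrime (specialize 0 c P) (specialize 0 c R) with hsdef
  have hscard : 6 * K ^ 2 * T < s.card := by
    have e1 := card_not_isRelPrime_specialize_le hP hR hPR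
      ((E₃.image v).filter fun c => ¬ IsRelPrime (specialize 0 c P) (specialize 0 c R))
      (fun c hc => (Finset.mem_filter.1 hc).2)
    have e2 : s.card + ((E₃.image v).filter fun c =>
        ¬ IsRelPrime (specialize 0 c P) (specialize 0 c R)).card = (E₃.image v).card :=
      Finset.card_filter_add_card_filter_not _
    rw [Finset.card_image_of_injOn hv] at e2
    omega
  have hs : ∀ c ∈ s, IsRelPrime (specialize 0 c P) (specialize 0 c R) ∧
      ∃ x : Fin 3 → ℝ, x 0 = c ∧ x 2 ≠ 0 ∧ eval x P = 0 ∧ eval x R = 0 ∧ eval x S = 0 := by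
    intro c hc
    obtain ⟨hc1, hc2⟩ := Finset.mem_filter.1 hc
    obtain ⟨g₃, hg₃, rfl⟩ := Finset.mem_image.1 hc1
    refine ⟨hc2, pt v u w g₃, rfl, Real.exp_ne_zero _, ?_, ?_, ?_⟩
    · have := hz 0 hE₁ 0 hE₂ g₃ hg₃
      rwa [zero_add, zero_add] at this
    · refine eval_eq_zero_of_mem_span v u w hRs fun g hg => ?_
      have := hz g hg 0 hE₂ g₃ hg₃
      rwa [add_zero] at this
    · refine eval_eq_zero_of_mem_span v u w hSs fun g hg => ?_
      obtain ⟨g₁, hg₁, g₂, hg₂, rfl⟩ := Finset.mem_add.1 hg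
      exact hz g₁ hg₁ g₂ hg₂ g₃ hg₃
  set L := s.card with hL
  set B := fun i : Fin 3 => degreeOf i P + degreeOf i R + L + 1 with hB
  obtain ⟨J, hJ⟩ : ∃ J, J =
    B 0 * mixedDegree P R 0 + B 1 * mixedDegree P R 1 + B 2 * mixedDegree P R 2 + 1 := ⟨_, rfl⟩
  have key := card_le_of_independent_mod hP hR hPR (fun i => B i + J * degreeOf i S)
    (fun i => by simp only [hB]; omega) (ι := Fin J × Fin L)
    (fun a => X 0 ^ (a.2 : ℕ) * S ^ (a.1 : ℕ)) (by
      rintro ⟨j, i⟩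
      apply mem_polyBox_of_degreeOf_lt
      intro d
      have e1 := degreeOf_mul_le d (X 0 ^ (i : ℕ) : MvPolynomial (Fin 3) ℝ) (S ^ (j : ℕ))
      have e2 := degreeOf_pow_le d (X 0 : MvPolynomial (Fin 3) ℝ) i
      have e3 := degreeOf_pow_le d S j
      have e4 := Nat.mul_le_mul_right (degreeOf d S) j.2.le
      have e5 : (i : ℕ) * degreeOf d (X 0 : MvPolynomial (Fin 3) ℝ) ≤ i * 1 :=
        Nat.mul_le_mul_left _ ((degreeOf_X_le d 0).trans (by split_ifs <;> simp))
      have := i.2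
      simp only [hB]
      omega) (by
      intro c hc
      have h3 := coeffs_eq_zero_of_mul_mem hm₀ hS s hs (fun j i => c (j, i))
        (Submonoid.one_mem _) (by
          rw [one_mul]
          convert hc using 1
          rw [Fintype.sum_prod_type]
          refine Finset.sum_congr rfl fun j _ => ?_
          rw [aeval_polyOfCoeffs, Finset.sum_mul]
          exact Finset.sum_congr rfl fun i _ => by ring)
      funext x
      exact congrFun (congrFun h3 x.1) x.2)
  have hexp : ∀ i, (B i + J * degreeOf i S) * mixedDegree P R i =
      B i * mixedDegree P R i + J * (degreeOf i S * mixedDegree P R i) := fun i => by ring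
  rw [Fintype.card_prod, Fintype.card_fin, Fintype.card_fin, Fin.sum_univ_three, hexp, hexp,
    hexp] at key
  have s0 : degreeOf 0 S * mixedDegree P R 0 ≤ K * (2 * K * T) :=
    Nat.mul_le_mul ((hSd 0).trans h0.le) m0
  have s1 : degreeOf 1 S * mixedDegree P R 1 ≤ K * (2 * K * T) :=
    Nat.mul_le_mul ((hSd 1).trans h1.le) m1
  have s2 : degreeOf 2 S * mixedDegree P R 2 ≤ T * (2 * K ^ 2) :=
    Nat.mul_le_mul ((hSd 2).trans h2.le) m2
  have s3 : degreeOf 0 S * mixedDegree P R 0 + degreeOf 1 S * mixedDegree P R 1 +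
      degreeOf 2 S * mixedDegree P R 2 + 1 ≤ L := by nlinarith
  have s4 := Nat.mul_le_mul_left J s3
  rw [mul_add, mul_add, mul_add, mul_one] at s4
  omega

/-- A zero estimate for polynomials in three variables on `ℝ × ℝ × ℝˣ`. -/
theorem zero_estimate {P : MvPolynomial (Fin 3) ℝ} (hP : P ≠ 0) {K T : ℕ}
    (h0 : degreeOf 0 P < K) (h1 : degreeOf 1 P < K) (h2 : degreeOf 2 P < T)
    (E₁ E₂ E₃ : Finset G) (hE₁ : 0 ∈ E₁) (hE₂ : 0 ∈ E₂) (hv : Set.InjOn v E₃)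
    (hC : ∀ e : ℝ × ℝ →ₗ[ℝ] ℝ, e ≠ 0 → 2 * K ≤ (E₁.image fun g => e (v g, u g)).card)
    (hC' : T ≤ (E₁.image w).card) (hw : Set.InjOn w E₂) (hE₂' : 2 * K * T < E₂.card)
    (hE₃ : 6 * K ^ 2 * T + 2 * K * T + 2 * K ^ 2 < E₃.card)
    (hz : ∀ g₁ ∈ E₁, ∀ g₂ ∈ E₂, ∀ g₃ ∈ E₃, eval (pt v u w (g₁ + g₂ + g₃)) P = 0) : False := by
  obtain ⟨s, P', rfl, hY⟩ := exists_eq_X_pow_mul hP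
  have hd := degreeOf_le_of_dvd hP (Dvd.intro_left _ rfl : P' ∣ X 2 ^ s * P')
  exact zero_estimate_aux v u w (right_ne_zero_of_mul hP) hY ((hd 0).trans_lt h0)
    ((hd 1).trans_lt h1) ((hd 2).trans_lt h2) E₁ E₂ E₃ hE₁ hE₂ hv hC hC' hw hE₂' hE₃
    fun g₁ hg₁ g₂ hg₂ g₃ hg₃ => eval_zero_of_eval_X_pow_mul v u w (hz g₁ hg₁ g₂ hg₂ g₃ hg₃)

end

end

lemma abs_det_le_prod {n : Type*} [Fintype n] [DecidableEq n] (A : Matrix n n ℝ) (b : n → ℝ)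
    (h : ∀ j i, |A j i| ≤ b j) : |A.det| ≤ (Fintype.card n).factorial * ∏ j, b j := by
  rw [← Matrix.det_transpose, Matrix.det_apply]
  refine (Finset.abs_sum_le_sum_abs _ _).trans ?_
  have : ∀ σ ∈ (Finset.univ : Finset (Equiv.Perm n)),
      |Equiv.Perm.sign σ • ∏ i, A.transpose (σ i) i| ≤ ∏ j, b j := by
    intro σ _
    rw [Units.smul_def, zsmul_eq_mul, abs_mul, Finset.abs_prod]
    have h1 : |(((Equiv.Perm.sign σ : ℤˣ) : ℤ) : ℝ)| = 1 := by
      rw [← Int.cast_abs, Int.abs_eq_natAbs, Int.units_natAbs]; simp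
    rw [h1, one_mul]
    exact Finset.prod_le_prod (fun _ _ => abs_nonneg _) fun j _ => h j _
  refine (Finset.sum_le_card_nsmul _ _ _ this).trans ?_
  rw [Finset.card_univ, Fintype.card_perm, nsmul_eq_mul]

lemma sum_sub_le_of_card_fiber_le {n : Type*} [Fintype n] (g : n → ℕ) (G M : ℕ)
    (h : ∀ c < G, (Finset.univ.filter fun j => g j = c).card ≤ M) :
    ∑ j, (G - g j) ≤ M * ∑ c ∈ Finset.range G, (G - c) := by
  classical
  have h1 : ∑ j, (G - g j) = ∑ j with g j < G, (G - g j) := by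
    symm
    apply Finset.sum_filter_of_ne
    intro j _ hj; omega
  have h2 : ∑ j with g j < G, (G - g j) =
      ∑ c ∈ Finset.range G, ∑ j with g j < G ∧ g j = c, (G - g j) := by
    rw [← Finset.sum_fiberwise_of_maps_to (g := g) (t := Finset.range G)]
    · exact Finset.sum_congr rfl fun c _ => by rw [Finset.filter_filter]
    · intro j hj; simpa using hj
  rw [h1, h2, Finset.mul_sum]
  refine Finset.sum_le_sum fun c hc => ?_
  have hc' := Finset.mem_range.1 hc
  calc ∑ j with g j < G ∧ g j = c, (G - g j) = ∑ j with g j < G ∧ g j = c, (G - c) :=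
        Finset.sum_congr rfl fun j hj => by rw [(Finset.mem_filter.1 hj).2.2]
    _ = (Finset.univ.filter fun j => g j < G ∧ g j = c).card * (G - c) := by
        rw [Finset.sum_const, smul_eq_mul]
    _ ≤ M * (G - c) := by
        refine Nat.mul_le_mul_right _ (le_trans (Finset.card_le_card ?_) (h c hc'))
        intro j; simp

/-- A determinant is small when its rows are sums of graded vectors such that the vectors of any
given small grade span a space of small dimension. -/
theorem abs_det_mul_pow_le {n : Type*} [Fintype n] [DecidableEq n] {τ : Type*} [Fintype τ]
    (A : Matrix n n ℝ) (a : n → τ → n → ℝ) (hA : ∀ j i, A j i = ∑ t, a j t i) (gr : n → τ → ℕ)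
    (G M : ℕ) (U : ℕ → Submodule ℝ (n → ℝ)) (hgr : ∀ j t, gr j t ≤ G)
    (hU : ∀ c < G, Module.finrank ℝ (U c) ≤ M) (haU : ∀ j t, gr j t < G → a j t ∈ U (gr j t))
    (b : n → τ → ℝ) (hb : ∀ j t i, |a j t i| ≤ b j t) (E B : ℝ) (hE : 1 ≤ E)
    (hB : ∀ j, ∑ t, b j t * E ^ gr j t ≤ B) :
    |A.det| * E ^ (Fintype.card n * G) ≤
      (Fintype.card n).factorial * B ^ Fintype.card n *
        E ^ (M * ∑ c ∈ Finset.range G, (G - c)) := by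
  classical
  rcases isEmpty_or_nonempty n with hn | hn
  · simp
    exact one_le_pow₀ hE
  have hE0 : (0 : ℝ) < E := by linarith
  have hb0 : ∀ j t, 0 ≤ b j t := fun j t => (abs_nonneg _).trans (hb j t hn.some)
  have hdet : A.det = ∑ r : n → τ, Matrix.det (Matrix.of fun j => a j (r j)) := by
    have e : A = Matrix.of fun j => ∑ t, a j t := by
      ext j i; rw [hA]; simp
    rw [e]
    exact (Matrix.detRowAlternating (n := n) (R := ℝ)).toMultilinearMap.map_sum a
  have hterm : ∀ r : n → τ, |Matrix.det (Matrix.of fun j => a j (r j))| * E ^ (Fintype.card n * G) ≤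
      (Fintype.card n).factorial * (∏ j, b j (r j) * E ^ gr j (r j)) *
        E ^ (M * ∑ c ∈ Finset.range G, (G - c)) := by
    intro r
    by_cases hz : Matrix.det (Matrix.of fun j => a j (r j)) = 0
    · rw [hz, abs_zero, zero_mul]
      have : 0 ≤ ∏ j, b j (r j) * E ^ gr j (r j) :=
        Finset.prod_nonneg fun j _ => mul_nonneg (hb0 _ _) (pow_nonneg hE0.le _)
      positivity
    · have hli : LinearIndependent ℝ fun j => a j (r j) := by
        have := Matrix.linearIndependent_rows_iff_isUnit.2
          ((Matrix.isUnit_iff_isUnit_det _).2 (isUnit_iff_ne_zero.2 hz))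
        exact this
      have hfib : ∀ c < G, (Finset.univ.filter fun j => gr j (r j) = c).card ≤ M := by
        intro c hc
        refine le_trans ?_ (hU c hc)
        have h1 := hli.comp (fun j : {j // j ∈ Finset.univ.filter fun j => gr j (r j) = c} => (j : n))
          Subtype.val_injective
        have h2 : LinearIndependent ℝ
            (fun j : {j // j ∈ Finset.univ.filter fun j => gr j (r j) = c} =>
              (⟨a j (r j), by
                have hj : gr (j : n) (r j) = c := (Finset.mem_filter.1 j.2).2
                have := haU j (r j) (by rw [hj]; exact hc)
                rwa [hj] at this⟩ : U c)) :=
          LinearIndependent.of_comp (U c).subtype h1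
        have := h2.fintype_card_le_finrank
        rwa [Fintype.card_coe] at this
      have hs := sum_sub_le_of_card_fiber_le (fun j => gr j (r j)) G M hfib
      have hs2 : ∑ j, gr j (r j) + ∑ j, (G - gr j (r j)) = Fintype.card n * G := by
        rw [← Finset.sum_add_distrib, Finset.sum_congr rfl fun j _ => Nat.add_sub_cancel' (hgr j (r j)),
          Finset.sum_const, Finset.card_univ, smul_eq_mul]
      have h3 := abs_det_le_prod (Matrix.of fun j => a j (r j)) (fun j => b j (r j))
        (fun j i => hb j (r j) i)
      rw [← hs2, pow_add, Finset.prod_mul_distrib, Finset.prod_pow_eq_pow_sum, ← mul_assoc, ← mul_assoc]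
      refine mul_le_mul ?_ (pow_le_pow_right₀ hE hs) (by positivity) ?_
      · exact mul_le_mul_of_nonneg_right h3 (by positivity)
      · exact mul_nonneg (mul_nonneg (by positivity) (Finset.prod_nonneg fun j _ => hb0 _ _))
          (by positivity)
  have hprod : ∑ r : n → τ, ∏ j, b j (r j) * E ^ gr j (r j) ≤ B ^ Fintype.card n := by
    rw [← Fintype.prod_sum fun j t => b j t * E ^ gr j t, ← Finset.card_univ, ← Finset.prod_const]
    exact Finset.prod_le_prod
      (fun j _ => Finset.sum_nonneg fun t _ => mul_nonneg (hb0 _ _) (pow_nonneg hE0.le _))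
      fun j _ => hB j
  calc |A.det| * E ^ (Fintype.card n * G)
      ≤ (∑ r : n → τ, |Matrix.det (Matrix.of fun j => a j (r j))|) * E ^ (Fintype.card n * G) := by
        rw [hdet]
        exact mul_le_mul_of_nonneg_right (Finset.abs_sum_le_sum_abs _ _) (by positivity)
    _ ≤ ∑ r : n → τ, (Fintype.card n).factorial * (∏ j, b j (r j) * E ^ gr j (r j)) *
        E ^ (M * ∑ c ∈ Finset.range G, (G - c)) := by
        rw [Finset.sum_mul]
        exact Finset.sum_le_sum fun r _ => hterm r
    _ = (Fintype.card n).factorial * (∑ r : n → τ, ∏ j, b j (r j) * E ^ gr j (r j)) *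
        E ^ (M * ∑ c ∈ Finset.range G, (G - c)) := by
        rw [← Finset.sum_mul, ← Finset.mul_sum]
    _ ≤ _ := by gcongr

lemma abs_exp_sub_sum_mul_pow_le (x : ℝ) {E : ℝ} (hE : 1 ≤ E) (G : ℕ) :
    |Real.exp x - ∑ l ∈ Finset.range G, x ^ l / l.factorial| * E ^ G ≤ Real.exp (E * |x|) := by
  have hE0 : 0 < E := by linarith
  have hsum : ∀ y : ℝ, Real.exp y = ∑' l : ℕ, y ^ l / l.factorial := fun y => by
    rw [Real.exp_eq_exp_ℝ, NormedSpace.exp_eq_tsum_div]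
  have h1 : Real.exp x - ∑ l ∈ Finset.range G, x ^ l / l.factorial =
      ∑' l : ℕ, x ^ (l + G) / (l + G).factorial := by
    rw [hsum, ← (Real.summable_pow_div_factorial x).sum_add_tsum_nat_add G, add_sub_cancel_left]
  have h2 : Real.exp (E * |x|) - ∑ l ∈ Finset.range G, (E * |x|) ^ l / l.factorial =
      ∑' l : ℕ, (E * |x|) ^ (l + G) / (l + G).factorial := by
    rw [hsum, ← (Real.summable_pow_div_factorial _).sum_add_tsum_nat_add G, add_sub_cancel_left]
  have h3 : |∑' l : ℕ, x ^ (l + G) / (l + G).factorial| ≤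
      ∑' l : ℕ, |x| ^ (l + G) / (l + G).factorial := by
    have hs := (summable_nat_add_iff G).2 (Real.summable_pow_div_factorial |x|)
    refine (norm_tsum_le_tsum_norm (f := fun l : ℕ => x ^ (l + G) / ((l + G).factorial : ℝ)) ?_).trans
      (le_of_eq (tsum_congr fun l => ?_))
    · refine hs.congr fun l => ?_
      rw [Real.norm_eq_abs, abs_div, abs_pow, Nat.abs_cast]
    · rw [Real.norm_eq_abs, abs_div, abs_pow, Nat.abs_cast]
  have h4 : (∑' l : ℕ, |x| ^ (l + G) / (l + G).factorial) * E ^ G ≤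
      ∑' l : ℕ, (E * |x|) ^ (l + G) / (l + G).factorial := by
    rw [← tsum_mul_right]
    refine Summable.tsum_le_tsum (fun l => ?_)
      (((summable_nat_add_iff G).2 (Real.summable_pow_div_factorial |x|)).mul_right _)
      ((summable_nat_add_iff G).2 (Real.summable_pow_div_factorial _))
    rw [div_mul_eq_mul_div]
    refine div_le_div_of_nonneg_right ?_ (by positivity)
    rw [mul_pow, mul_comm]
    exact mul_le_mul_of_nonneg_right (pow_le_pow_right₀ hE (by omega)) (by positivity)
  rw [h1]
  calc _ ≤ (∑' l : ℕ, |x| ^ (l + G) / (l + G).factorial) * E ^ G := by gcongr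
    _ ≤ _ := h4
    _ ≤ _ := by
      rw [← h2]
      have : 0 ≤ ∑ l ∈ Finset.range G, (E * |x|) ^ l / (l.factorial : ℝ) :=
        Finset.sum_nonneg fun l _ => by positivity
      linarith

lemma sum_pow_div_factorial_le_exp {x : ℝ} (hx : 0 ≤ x) (G : ℕ) :
    ∑ l ∈ Finset.range G, x ^ l / l.factorial ≤ Real.exp x :=
  Real.sum_le_exp_of_nonneg hx G

/-- An interpolation determinant bound for exponential polynomials. -/
theorem abs_det_exp_poly_mul_pow_le {n : Type*} [Fintype n] [DecidableEq n] (A : Matrix n n ℝ)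
    (z : n → ℝ) {K : ℕ} (q : n → Fin K → n → ℝ) (θ : n → ℝ) (err : n → n → ℝ)
    (hA : ∀ j i, A j i = (∑ m, q j m i * z i ^ (m : ℕ)) * Real.exp (θ j * z i) + err j i)
    (W : Submodule ℝ (n → ℝ)) (M : ℕ) (hW : Module.finrank ℝ W ≤ M) (hq : ∀ j m, q j m ∈ W)
    (Z : ℝ) (hz : ∀ i, |z i| ≤ Z) (c : n → Fin K → ℝ) (hc : ∀ j m i, |q j m i| ≤ c j m)
    {E B : ℝ} (hE : 1 ≤ E) (G : ℕ)
    (hB : ∀ j, (∑ m, c j m * (E * Z) ^ (m : ℕ)) * Real.exp (E * (|θ j| * Z)) ≤ B)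
    (herr : ∀ j i, |err j i| * E ^ G ≤ B) :
    |A.det| * E ^ (Fintype.card n * G) ≤
      (Fintype.card n).factorial * (3 * B) ^ Fintype.card n *
        E ^ (M * ∑ c ∈ Finset.range G, (G - c)) := by
  classical
  have hE0 : 0 < E := by linarith
  rcases isEmpty_or_nonempty n with hn | hn
  · simp
    exact one_le_pow₀ hE
  have hZ0 : 0 ≤ Z := (abs_nonneg _).trans (hz hn.some)
  have hc0 : ∀ j m, 0 ≤ c j m := fun j m => (abs_nonneg _).trans (hc j m hn.some)
  set tail : n → n → ℝ := fun j i =>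
    Real.exp (θ j * z i) - ∑ l ∈ Finset.range G, (θ j * z i) ^ l / l.factorial with htail
  have hS0 : ∀ j, 0 ≤ ∑ m, c j m * (E * Z) ^ (m : ℕ) := fun j =>
    Finset.sum_nonneg fun m _ => mul_nonneg (hc0 _ _) (by positivity)
  have hθz : ∀ j i, |θ j * z i| ≤ |θ j| * Z := fun j i => by
    rw [abs_mul]; exact mul_le_mul_of_nonneg_left (hz i) (abs_nonneg _)
  have hpoly : ∀ j i, |∑ m, q j m i * z i ^ (m : ℕ)| ≤ ∑ m, c j m * (E * Z) ^ (m : ℕ) := fun j i => by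
    refine (Finset.abs_sum_le_sum_abs _ _).trans (Finset.sum_le_sum fun m _ => ?_)
    rw [abs_mul, abs_pow]
    refine mul_le_mul (hc j m i) (pow_le_pow_left₀ (abs_nonneg _) ?_ _) (by positivity) (hc0 _ _)
    exact (hz i).trans (le_mul_of_one_le_left hZ0 hE)
  refine abs_det_mul_pow_le A (τ := (Fin K × Fin G) ⊕ Bool)
    (fun j t i => Sum.elim (fun x => q j x.1 i * z i ^ (x.1 : ℕ) * ((θ j * z i) ^ (x.2 : ℕ) /
        (x.2 : ℕ).factorial)) (fun x => if x then (∑ m, q j m i * z i ^ (m : ℕ)) * tail j i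
          else err j i) t) ?_
    (fun j t => Sum.elim (fun x => min ((x.1 : ℕ) + x.2) G) (fun _ => G) t) G M
    (fun d => W.map (LinearMap.mulLeft ℝ (fun i => z i ^ d))) ?_
    (fun d _ => (Submodule.finrank_map_le _ _).trans hW) ?_
    (fun j t => Sum.elim (fun x => c j x.1 * Z ^ (x.1 : ℕ) * ((|θ j| * Z) ^ (x.2 : ℕ) /
        (x.2 : ℕ).factorial)) (fun _ => B / E ^ G) t) ?_ E (3 * B) hE ?_
  · intro j i
    rw [hA, Fintype.sum_sum_type, Fintype.sum_prod_type, Fintype.sum_bool]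
    simp only [Sum.elim_inl, Sum.elim_inr, if_true, Bool.false_eq_true, if_false, ← Finset.mul_sum]
    rw [← Finset.sum_mul, Fin.sum_univ_eq_sum_range (fun l => (θ j * z i) ^ l / (l.factorial : ℝ)) G,
      htail]
    ring
  · rintro j (x | x)
    · exact min_le_right _ _
    · exact le_rfl
  · rintro j (⟨m, l⟩ | x) h
    · simp only [Sum.elim_inl] at h ⊢
      have hml : min ((m : ℕ) + l) G = m + l := by omega
      rw [hml]
      refine ⟨(θ j ^ (l : ℕ) / (l : ℕ).factorial) • q j m, W.smul_mem _ (hq j m), ?_⟩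
      funext i
      simp only [LinearMap.mulLeft_apply, Pi.mul_apply, Pi.smul_apply, smul_eq_mul]
      ring
    · simp at h
  · rintro j (⟨m, l⟩ | x) i
    · simp only [Sum.elim_inl]
      rw [abs_mul, abs_mul, abs_div, abs_pow, abs_pow, Nat.abs_cast]
      have := hc0 j m
      have := hc j m i
      have := hz i
      have := hθz j i
      gcongr
    · simp only [Sum.elim_inr]
      rw [le_div_iff₀ (by positivity)]
      split_ifs
      · rw [abs_mul, mul_assoc]
        refine le_trans ?_ (hB j)
        refine mul_le_mul (hpoly j i) ?_ (by positivity) (hS0 j)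
        refine (abs_exp_sub_sum_mul_pow_le _ hE G).trans (Real.exp_le_exp.2 ?_)
        exact mul_le_mul_of_nonneg_left (hθz j i) hE0.le
      · exact herr j i
  · intro j
    rw [Fintype.sum_sum_type, Fintype.sum_prod_type, Fintype.sum_bool]
    simp only [Sum.elim_inl, Sum.elim_inr]
    rw [div_mul_cancel₀ _ (by positivity)]
    have h1 : ∀ m : Fin K, ∀ l : Fin G, c j m * Z ^ (m : ℕ) * ((|θ j| * Z) ^ (l : ℕ) /
        (l : ℕ).factorial) * E ^ min ((m : ℕ) + l) G ≤
        c j m * (E * Z) ^ (m : ℕ) * ((E * (|θ j| * Z)) ^ (l : ℕ) / (l : ℕ).factorial) := by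
      intro m l
      have h2 : E ^ min ((m : ℕ) + l) G ≤ E ^ ((m : ℕ) + l) := pow_le_pow_right₀ hE (min_le_left _ _)
      have h3 : 0 ≤ c j m * Z ^ (m : ℕ) * ((|θ j| * Z) ^ (l : ℕ) / (l : ℕ).factorial) := by
        have := hc0 j m
        positivity
      refine (mul_le_mul_of_nonneg_left h2 h3).trans (le_of_eq ?_)
      rw [pow_add, mul_pow E Z, mul_pow E (|θ j| * Z)]
      ring
    have h4 : ∑ m : Fin K, ∑ l : Fin G, c j m * Z ^ (m : ℕ) * ((|θ j| * Z) ^ (l : ℕ) /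
        (l : ℕ).factorial) * E ^ min ((m : ℕ) + l) G ≤ B := by
      refine le_trans (Finset.sum_le_sum fun m _ => Finset.sum_le_sum fun l _ => h1 m l) ?_
      simp only [← Finset.mul_sum]
      rw [← Finset.sum_mul,
        Fin.sum_univ_eq_sum_range (fun l => (E * (|θ j| * Z)) ^ l / (l.factorial : ℝ)) G]
      refine le_trans (mul_le_mul_of_nonneg_left ?_ (hS0 j)) (hB j)
      exact sum_pow_div_factorial_le_exp (by positivity) G
    linarith

/-- Functions which are linearly independent on a set of points have a nonvanishing
interpolation determinant at suitable points. -/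
theorem exists_det_eval_ne_zero {J Ω : Type*} [Fintype J] [DecidableEq J] (f : J → Ω → ℝ)
    (hf : ∀ c : J → ℝ, (∀ ω, ∑ j, c j * f j ω = 0) → c = 0) :
    ∃ p : J → Ω, (Matrix.of fun j i => f j (p i)).det ≠ 0 := by
  classical
  let v : Ω → J → ℝ := fun ω j => f j ω
  have hspan : Submodule.span ℝ (Set.range v) = ⊤ := by
    by_contra h
    obtain ⟨g, hg, hle⟩ := Submodule.exists_le_ker_of_lt_top _ (lt_top_iff_ne_top.2 h)
    apply hg
    have h1 : (fun j => g (Pi.single j 1)) = 0 := by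
      refine hf _ fun ω => ?_
      have h2 : g (v ω) = 0 := hle (Submodule.subset_span ⟨ω, rfl⟩)
      rw [← h2, LinearMap.pi_apply_eq_sum_univ g (v ω)]
      refine Finset.sum_congr rfl fun j _ => ?_
      rw [smul_eq_mul, mul_comm]
      congr 2
      funext i
      simp [Pi.single_apply, eq_comm]
    refine LinearMap.pi_ext' fun j => LinearMap.ext_ring ?_
    simpa using congrFun h1 j
  obtain ⟨κ, a, -, hsp, hli⟩ := exists_linearIndependent' ℝ v
  rw [hspan] at hsp
  let b := Module.Basis.mk hli hsp.ge
  let e : J ≃ κ := (Pi.basisFun ℝ J).indexEquiv b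
  refine ⟨fun i => a (e i), ?_⟩
  have h1 : LinearIndependent ℝ (fun i => v (a (e i))) := hli.comp e e.injective
  have h2 := (Matrix.linearIndependent_rows_iff_isUnit
    (A := Matrix.of fun i => v (a (e i)))).1 h1
  rw [Matrix.isUnit_iff_isUnit_det, isUnit_iff_ne_zero] at h2
  rw [← Matrix.det_transpose]
  exact h2

/-- Liouville's inequality for an algebraic integer. -/
theorem one_le_norm_mul_prod_erase {L : Type*} [Field L] [Algebra ℚ L] [FiniteDimensional ℚ L]
    [DecidableEq (L →ₐ[ℚ] ℂ)] (φ : L →ₐ[ℚ] ℂ) {D : L} (hD : D ≠ 0) (h_int : IsIntegral ℤ D)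
    (c : (L →ₐ[ℚ] ℂ) → ℝ) (hc : ∀ σ, σ ≠ φ → ‖σ D‖ ≤ c σ) :
    1 ≤ ‖φ D‖ * ∏ σ ∈ Finset.univ.erase φ, c σ := by
  have h1 : IsIntegral ℤ (Algebra.norm ℚ D) := Algebra.isIntegral_norm ℚ h_int
  obtain ⟨z, hz⟩ := IsIntegrallyClosed.isIntegral_iff.1 h1
  have hz0 : z ≠ 0 := by
    rintro rfl
    rw [map_zero] at hz
    exact hD (Algebra.norm_eq_zero_iff.1 hz.symm)
  have h2 := Algebra.norm_eq_prod_embeddings ℚ ℂ D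
  rw [← hz, ← Finset.mul_prod_erase _ _ (Finset.mem_univ φ)] at h2
  have h3 : (1 : ℝ) ≤ ‖φ D * ∏ σ ∈ Finset.univ.erase φ, σ D‖ := by
    rw [← h2]
    simp only [eq_intCast, map_intCast, Complex.norm_intCast]
    exact_mod_cast Int.one_le_abs hz0
  refine h3.trans ?_
  rw [norm_mul, norm_prod]
  refine mul_le_mul_of_nonneg_left (Finset.prod_le_prod (fun _ _ => norm_nonneg _) fun σ hσ => ?_)
    (norm_nonneg _)
  exact hc σ (Finset.ne_of_mem_erase hσ)

lemma norm_det_le_factorial {n : Type*} [Fintype n] [DecidableEq n] (A : Matrix n n ℂ) {x : ℝ}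
    (hx : ∀ i j, ‖A i j‖ ≤ x) : ‖A.det‖ ≤ (Fintype.card n).factorial * x ^ Fintype.card n := by
  have := Matrix.det_le (abv := NormedField.toAbsoluteValue ℂ) (A := A) (x := x) hx
  rw [nsmul_eq_mul] at this
  exact this

lemma norm_det_monomial_le {n : Type*} [Fintype n] [DecidableEq n] {a g μ l : ℂ} {T R₁ R₂ R₃ : ℕ}
    (z : n → n → ℤ) (t s₁ s₂ s₃ : n → ℕ) (ht : ∀ j, t j ≤ T) (h₁ : ∀ i, s₁ i ≤ R₁)
    (h₂ : ∀ i, s₂ i ≤ R₂) (h₃ : ∀ i, s₃ i ≤ R₃) {C X Y H : ℝ} (hz : ∀ j i, |(z j i : ℝ)| ≤ C)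
    (hX : 1 ≤ X) (hY : 1 ≤ Y) (hH : 1 ≤ H) (ha : ‖a‖ ≤ X) (hg : ‖g‖ ≤ Y) (hμ : ‖μ‖ ≤ H)
    (hl : ‖l‖ ≤ H) :
    ‖(Matrix.of fun j i => (z j i : ℂ) *
      (a ^ s₁ i * g ^ s₂ i * μ ^ s₃ i * l ^ (R₃ - s₃ i)) ^ t j).det‖ ≤
      (Fintype.card n).factorial * (C * (X ^ R₁ * Y ^ R₂ * H ^ R₃) ^ T) ^ Fintype.card n := by
  refine norm_det_le_factorial _ fun j i => ?_
  rw [Matrix.of_apply, norm_mul, Complex.norm_intCast, norm_pow, norm_mul, norm_mul, norm_mul,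
    norm_pow, norm_pow, norm_pow, norm_pow]
  have hC : 0 ≤ C := (abs_nonneg _).trans (hz j i)
  refine mul_le_mul (hz j i) ?_ (by positivity) hC
  have h4 : ‖a‖ ^ s₁ i ≤ X ^ R₁ :=
    (pow_le_pow_left₀ (norm_nonneg _) ha _).trans (pow_le_pow_right₀ hX (h₁ i))
  have h5 : ‖g‖ ^ s₂ i ≤ Y ^ R₂ :=
    (pow_le_pow_left₀ (norm_nonneg _) hg _).trans (pow_le_pow_right₀ hY (h₂ i))
  have h6 : ‖μ‖ ^ s₃ i * ‖l‖ ^ (R₃ - s₃ i) ≤ H ^ R₃ := by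
    calc _ ≤ H ^ s₃ i * H ^ (R₃ - s₃ i) := by gcongr
      _ = H ^ R₃ := by rw [← pow_add, Nat.add_sub_cancel' (h₃ i)]
  calc _ ≤ (X ^ R₁ * Y ^ R₂ * H ^ R₃) ^ t j := by
        rw [mul_assoc (‖a‖ ^ s₁ i * ‖g‖ ^ s₂ i)]
        gcongr
    _ ≤ _ := pow_le_pow_right₀ (one_le_mul_of_one_le_of_one_le
        (one_le_mul_of_one_le_of_one_le (one_le_pow₀ hX) (one_le_pow₀ hY)) (one_le_pow₀ hH)) (ht j)

section Embeddings

variable {k : ℕ} {α : ℝ}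

lemma isIntegral_of_pow_eq_sum {R : Type*} [CommRing R] {a : R}
    (ha : a ^ k = ∑ i ∈ Finset.range k, a ^ i) : IsIntegral ℤ a := by
  refine ⟨Polynomial.X ^ k - ∑ i ∈ Finset.range k, Polynomial.X ^ i, ?_, ?_⟩
  · refine Polynomial.monic_X_pow_sub ?_
    refine (Polynomial.degree_sum_le _ _).trans_lt ?_
    refine (Finset.sup_lt_iff (WithBot.bot_lt_coe k)).2 fun i hi => ?_
    rw [Polynomial.degree_X_pow]
    exact WithBot.coe_lt_coe.2 (Finset.mem_range.1 hi)
  · simp [Polynomial.eval₂_finsetSum, ha]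

/-- The number field generated by `α` and `√2`. -/
noncomputable abbrev adjoinSqrtTwo (α : ℝ) : IntermediateField ℚ ℝ := IntermediateField.adjoin ℚ {α, √2}

lemma finiteDimensional_adjoinSqrtTwo (hα : α ^ k = ∑ i ∈ Finset.range k, α ^ i) :
    FiniteDimensional ℚ (adjoinSqrtTwo α) := by
  refine IntermediateField.finiteDimensional_adjoin fun x hx => ?_
  rcases hx with rfl | rfl
  · exact (isIntegral_of_pow_eq_sum hα).tower_top
  · have : IsIntegral ℤ (√2) := by
      refine IsIntegral.of_pow (n := 2) (by norm_num) ?_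
      rw [Real.sq_sqrt (by norm_num)]
      exact_mod_cast isIntegral_algebraMap (R := ℤ) (A := ℝ) (x := 2)
    exact this.tower_top

/-- `α` as an element of the field `adjoinSqrtTwo α`. -/
noncomputable def adjoinSqrtTwo.gen (α : ℝ) : adjoinSqrtTwo α :=
  ⟨α, IntermediateField.subset_adjoin ℚ _ (Set.mem_insert _ _)⟩

/-- `√2` as an element of the field `adjoinSqrtTwo α`. -/
noncomputable def adjoinSqrtTwo.sqrt (α : ℝ) : adjoinSqrtTwo α :=
  ⟨√2, IntermediateField.subset_adjoin ℚ _ (Set.mem_insert_of_mem _ rfl)⟩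

open adjoinSqrtTwo

lemma gen_pow (hα : α ^ k = ∑ i ∈ Finset.range k, α ^ i) :
    gen α ^ k = ∑ i ∈ Finset.range k, gen α ^ i :=
  Subtype.ext (by simpa [gen] using hα)

lemma sqrt_sq : adjoinSqrtTwo.sqrt α ^ 2 = 2 :=
  Subtype.ext (by simp [adjoinSqrtTwo.sqrt]; rfl)

lemma algHom_gen_pow (hα : α ^ k = ∑ i ∈ Finset.range k, α ^ i)
    (σ : adjoinSqrtTwo α →ₐ[ℚ] ℂ) : σ (gen α) ^ k = ∑ i ∈ Finset.range k, σ (gen α) ^ i := by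
  rw [← map_pow, gen_pow hα, map_sum]
  simp

lemma algHom_sqrt (σ : adjoinSqrtTwo α →ₐ[ℚ] ℂ) :
    σ (adjoinSqrtTwo.sqrt α) = (√2 : ℝ) ∨ σ (adjoinSqrtTwo.sqrt α) = -(√2 : ℝ) := by
  refine sq_eq_sq_iff_eq_or_eq_neg.1 ?_
  rw [← map_pow, sqrt_sq, ← Complex.ofReal_pow, Real.sq_sqrt (by norm_num), map_ofNat]
  simp

lemma algHom_ext {σ τ : adjoinSqrtTwo α →ₐ[ℚ] ℂ} (h₁ : σ (gen α) = τ (gen α))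
    (h₂ : σ (adjoinSqrtTwo.sqrt α) = τ (adjoinSqrtTwo.sqrt α)) : σ = τ := by
  refine IntermediateField.algHom_ext_of_eq_adjoin ℚ rfl ?_
  rintro x (rfl | rfl)
  · exact h₁
  · exact h₂

/-- The inclusion of `adjoinSqrtTwo α` into the complex numbers. -/
noncomputable def adjoinSqrtTwo.incl (α : ℝ) : adjoinSqrtTwo α →ₐ[ℚ] ℂ :=
  ((Complex.ofRealAm).restrictScalars ℚ).comp (adjoinSqrtTwo α).val

lemma incl_apply (x : adjoinSqrtTwo α) : incl α x = ((x : ℝ) : ℂ) := rfl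

/-- The polynomial `X ^ k - (1 + X + ⋯ + X ^ (k - 1))`. -/
noncomputable def kfibPoly (k : ℕ) : Polynomial ℂ :=
  Polynomial.X ^ k - ∑ i ∈ Finset.range k, Polynomial.X ^ i

lemma card_roots_kfibPoly_le (k : ℕ) : kfibPoly k ≠ 0 ∧ (kfibPoly k).roots.toFinset.card ≤ k := by
  have hd : (∑ i ∈ Finset.range k, (Polynomial.X : Polynomial ℂ) ^ i).degree < k := by
    refine (Polynomial.degree_sum_le _ _).trans_lt ?_
    refine (Finset.sup_lt_iff (WithBot.bot_lt_coe k)).2 fun i hi => ?_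
    rw [Polynomial.degree_X_pow]
    exact WithBot.coe_lt_coe.2 (Finset.mem_range.1 hi)
  have hdeg : (kfibPoly k).degree = k := by
    rw [kfibPoly, Polynomial.degree_sub_eq_left_of_degree_lt] <;> rw [Polynomial.degree_X_pow]
    exact hd
  refine ⟨fun h => by simp [h] at hdeg, ?_⟩
  refine (Multiset.toFinset_card_le _).trans ((Polynomial.card_roots' _).trans ?_)
  rw [Polynomial.natDegree_eq_of_degree_eq_some hdeg]

lemma mem_roots_kfibPoly {x : ℂ} (hx : x ^ k = ∑ i ∈ Finset.range k, x ^ i) :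
    x ∈ (kfibPoly k).roots.toFinset := by
  rw [Multiset.mem_toFinset, Polynomial.mem_roots (card_roots_kfibPoly_le k).1,
    Polynomial.IsRoot.def]
  simp [kfibPoly, Polynomial.eval_finsetSum, hx]

open Classical in
lemma card_algHom_le (hα : α ^ k = ∑ i ∈ Finset.range k, α ^ i)
    [Fintype (adjoinSqrtTwo α →ₐ[ℚ] ℂ)] :
    Fintype.card (adjoinSqrtTwo α →ₐ[ℚ] ℂ) ≤ 2 * k ∧
    (Finset.univ.filter fun σ : adjoinSqrtTwo α →ₐ[ℚ] ℂ =>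
      σ ≠ incl α ∧ σ (gen α) = α).card ≤ 1 ∧
    (Finset.univ.filter fun σ : adjoinSqrtTwo α →ₐ[ℚ] ℂ =>
      σ ≠ incl α ∧ σ (adjoinSqrtTwo.sqrt α) = (√2 : ℝ)).card ≤ k - 1 := by
  refine ⟨?_, ?_, ?_⟩
  · have h1 := Finset.card_le_card_of_injOn (s := (Finset.univ : Finset (adjoinSqrtTwo α →ₐ[ℚ] ℂ)))
      (t := ({((√2 : ℝ) : ℂ), -((√2 : ℝ) : ℂ)} : Finset ℂ) ×ˢ (kfibPoly k).roots.toFinset)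
      (fun σ => (σ (adjoinSqrtTwo.sqrt α), σ (gen α))) ?_ ?_
    · rw [Finset.card_univ, Finset.card_product] at h1
      exact h1.trans (Nat.mul_le_mul (Finset.card_le_two) (card_roots_kfibPoly_le k).2)
    · intro σ _
      rw [Finset.coe_product]
      refine ⟨?_, mem_roots_kfibPoly (algHom_gen_pow hα σ)⟩
      simpa using algHom_sqrt σ
    · intro σ _ τ _ h
      rw [Prod.mk.injEq] at h
      exact algHom_ext h.2 h.1
  · refine Finset.card_le_one.2 fun σ hσ τ hτ => ?_
    simp only [Finset.mem_filter, Finset.mem_univ, true_and] at hσ hτ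
    have h : ∀ ρ : adjoinSqrtTwo α →ₐ[ℚ] ℂ, ρ ≠ incl α → ρ (gen α) = α →
        ρ (adjoinSqrtTwo.sqrt α) = -(√2 : ℝ) := fun ρ h1 h2 =>
      (algHom_sqrt ρ).resolve_left fun h3 => h1 (algHom_ext h2 h3)
    exact algHom_ext (hσ.2.trans hτ.2.symm) ((h σ hσ.1 hσ.2).trans (h τ hτ.1 hτ.2).symm)
  · have h1 := Finset.card_le_card_of_injOn (s := Finset.univ.filter
      fun σ : adjoinSqrtTwo α →ₐ[ℚ] ℂ => σ ≠ incl α ∧ σ (adjoinSqrtTwo.sqrt α) = (√2 : ℝ))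
      (t := (kfibPoly k).roots.toFinset.erase (α : ℂ)) (fun σ => σ (gen α)) ?_ ?_
    · refine h1.trans ?_
      rw [Finset.card_erase_of_mem (mem_roots_kfibPoly (by exact_mod_cast hα))]
      exact Nat.sub_le_sub_right (card_roots_kfibPoly_le k).2 1
    · intro σ hσ
      simp only [Finset.coe_filter, Finset.mem_univ, true_and, Set.mem_ofPred_eq] at hσ
      refine Finset.mem_coe.2 (Finset.mem_erase.2 ⟨fun h => hσ.1 (algHom_ext h hσ.2), ?_⟩)
      exact mem_roots_kfibPoly (algHom_gen_pow hα σ)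
    · intro σ hσ τ hτ h
      simp only [Finset.coe_filter, Finset.mem_univ, true_and, Set.mem_ofPred_eq] at hσ hτ
      exact algHom_ext h (hσ.2.trans hτ.2.symm)

end Embeddings

section Liouville

variable {k : ℕ} {α : ℝ}

open adjoinSqrtTwo

lemma isIntegral_gen (hα : α ^ k = ∑ i ∈ Finset.range k, α ^ i) : IsIntegral ℤ (gen α) :=
  isIntegral_of_pow_eq_sum (gen_pow hα)

lemma isIntegral_sqrt : IsIntegral ℤ (adjoinSqrtTwo.sqrt α) := by
  refine IsIntegral.of_pow (n := 2) (by norm_num) ?_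
  rw [sqrt_sq]
  exact_mod_cast isIntegral_algebraMap (R := ℤ) (A := adjoinSqrtTwo α) (x := 2)

lemma isIntegral_natCast' {R : Type*} [CommRing R] (n : ℕ) : IsIntegral ℤ (n : R) := by
  exact_mod_cast isIntegral_algebraMap (R := ℤ) (A := R) (x := n)

lemma isIntegral_int_mul {R : Type*} [CommRing R] (n : ℤ) {x : R} (hx : IsIntegral ℤ x) :
    IsIntegral ℤ ((n : R) * x) := by
  refine IsIntegral.mul ?_ hx
  exact_mod_cast isIntegral_algebraMap (R := ℤ) (A := R) (x := n)

lemma one_add_sqrt_two_bounds : (2.414 : ℝ) < 1 + √2 ∧ 1 + √2 < (2.4143 : ℝ) := by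
  constructor
  · have : (1.414 : ℝ) < √2 := Real.lt_sqrt_of_sq_lt (by norm_num)
    linarith
  · have : √2 < (1.4143 : ℝ) := by
      rw [Real.sqrt_lt' (by norm_num)]
      norm_num
    linarith

/-- Liouville's lower bound for a nonvanishing interpolation determinant. -/
theorem one_le_abs_det_mul {n : Type*} [Fintype n] [DecidableEq n] (hk : 1 ≤ k)
    (hα : α ^ k = ∑ i ∈ Finset.range k, α ^ i) (h1 : 1 < α) (h2 : α ≤ 2)
    (hpos : 0 < (k + 1) * α - 2 * k)
    (hconj : ∀ β : ℂ, β ^ k = ∑ i ∈ Finset.range k, β ^ i → β = α ∨ ‖β‖ ≤ 1)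
    {e c : ℕ} {H : ℝ} (hH₁ : c * √2 * 2 ^ e ≤ H) (hH₂ : (3 * k + 1 : ℝ) ^ e ≤ H)
    {T R₁ R₂ R₃ : ℕ} (z : n → n → ℤ) (t s₁ s₂ s₃ : n → ℕ) (ht : ∀ j, t j ≤ T)
    (hs₁ : ∀ i, s₁ i ≤ R₁) (hs₂ : ∀ i, s₂ i ≤ R₂) (hs₃ : ∀ i, s₃ i ≤ R₃) {C : ℝ} (hC : 1 ≤ C)
    (hz : ∀ j i, |(z j i : ℝ)| ≤ C) (A : Matrix n n ℝ)
    (hA : ∀ j i, A j i = z j i * (α ^ s₁ i * (1 + √2) ^ s₂ i *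
      (c * √2 * (α - 1) ^ e / ((k + 1) * α - 2 * k) ^ e) ^ s₃ i) ^ t j) (hdet : A.det ≠ 0) :
    1 ≤ |A.det| * (((Fintype.card n).factorial * C ^ Fintype.card n *
      H ^ (T * R₃ * Fintype.card n)) ^ (2 * k) * α ^ (T * R₁ * Fintype.card n) *
      (1 + √2) ^ (k * (T * R₂ * Fintype.card n))) := by
  classical
  have := finiteDimensional_adjoinSqrtTwo hα
  set N := Fintype.card n with hN
  have hH : 1 ≤ H := le_trans (one_le_pow₀ (by have : (0 : ℝ) ≤ k := k.cast_nonneg; linarith)) hH₂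
  set g : adjoinSqrtTwo α := 1 + adjoinSqrtTwo.sqrt α with hg
  set μ : adjoinSqrtTwo α := c * adjoinSqrtTwo.sqrt α * (gen α - 1) ^ e with hμ
  set l : adjoinSqrtTwo α := (((k + 1 : ℕ) : adjoinSqrtTwo α) * gen α - ((2 * k : ℕ) :
    adjoinSqrtTwo α)) ^ e with hl
  set M : Matrix n n (adjoinSqrtTwo α) := Matrix.of fun j i => (z j i : adjoinSqrtTwo α) *
      (gen α ^ s₁ i * g ^ s₂ i * μ ^ s₃ i * l ^ (R₃ - s₃ i)) ^ t j with hM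
  have hmap : ∀ σ : adjoinSqrtTwo α →ₐ[ℚ] ℂ, σ M.det = (Matrix.of fun j i => (z j i : ℂ) *
      (σ (gen α) ^ s₁ i * σ g ^ s₂ i * σ μ ^ s₃ i * σ l ^ (R₃ - s₃ i)) ^ t j).det := by
    intro σ
    rw [← AlgHom.coe_toRingHom, RingHom.map_det]
    congr 1
    ext j i
    simp [hM]
  have hσg : ∀ σ : adjoinSqrtTwo α →ₐ[ℚ] ℂ, σ g = 1 + σ (adjoinSqrtTwo.sqrt α) := fun σ => by
    simp [hg]
  have hσμ : ∀ σ : adjoinSqrtTwo α →ₐ[ℚ] ℂ, σ μ = c * σ (adjoinSqrtTwo.sqrt α) *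
      (σ (gen α) - 1) ^ e := fun σ => by simp [hμ]
  have hσl : ∀ σ : adjoinSqrtTwo α →ₐ[ℚ] ℂ, σ l = ((k + 1) * σ (gen α) - 2 * k) ^ e := fun σ => by
    simp [hl, map_ofNat σ 2]
  have hsq0 := Real.sqrt_nonneg 2
  have hsqrt : ∀ σ : adjoinSqrtTwo α →ₐ[ℚ] ℂ, ‖σ (adjoinSqrtTwo.sqrt α)‖ = √2 := fun σ => by
    rcases algHom_sqrt σ with h | h <;> rw [h] <;> simp [abs_of_nonneg hsq0]
  -- bounds for conjugates
  have hσ : ∀ σ : adjoinSqrtTwo α →ₐ[ℚ] ℂ, σ (gen α) = α ∨ ‖σ (gen α)‖ ≤ 1 := fun σ =>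
    hconj _ (algHom_gen_pow hα σ)
  have hμH : ∀ σ : adjoinSqrtTwo α →ₐ[ℚ] ℂ, ‖σ μ‖ ≤ H := fun σ => by
    rw [hσμ, norm_mul, norm_mul, hsqrt, norm_pow, Complex.norm_natCast]
    refine le_trans ?_ hH₁
    have : ‖σ (gen α) - 1‖ ≤ 2 := by
      rcases hσ σ with h | h
      · rw [h, ← Complex.ofReal_one, ← Complex.ofReal_sub, Complex.norm_real, Real.norm_eq_abs,
          abs_of_pos (by linarith)]
        linarith
      · refine (norm_sub_le _ _).trans ?_
        rw [norm_one]
        linarith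
    gcongr
  have hlH : ∀ σ : adjoinSqrtTwo α →ₐ[ℚ] ℂ, ‖σ l‖ ≤ H := fun σ => by
    rw [hσl, norm_pow]
    refine le_trans (pow_le_pow_left₀ (norm_nonneg _) ?_ _) hH₂
    have hk0 : (1 : ℝ) ≤ k := by exact_mod_cast hk
    rcases hσ σ with h | h
    · have : ((k : ℂ) + 1) * α - 2 * k = (((k + 1) * α - 2 * k : ℝ) : ℂ) := by push_cast; ring
      rw [h, this, Complex.norm_real, Real.norm_eq_abs, abs_of_pos hpos]
      nlinarith
    · refine (norm_sub_le _ _).trans ?_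
      have h3 : ‖(k : ℂ) + 1‖ = k + 1 := by exact_mod_cast Complex.norm_natCast (k + 1)
      rw [norm_mul, norm_mul, h3, Complex.norm_natCast, Complex.norm_ofNat]
      nlinarith
  -- the determinant over the number field
  have hdetM : ((M.det : adjoinSqrtTwo α) : ℝ) =
      (∏ j, (((k + 1) * α - 2 * k) ^ e) ^ (R₃ * t j)) * A.det := by
    rw [← Matrix.det_mul_column]
    have : ((M.det : adjoinSqrtTwo α) : ℝ) = (adjoinSqrtTwo α).val M.det := rfl
    rw [this, ← AlgHom.coe_toRingHom, RingHom.map_det]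
    congr 1
    ext j i
    have hl0 : ((k + 1) * α - 2 * k) ^ e ≠ 0 := (pow_pos hpos e).ne'
    simp only [RingHom.mapMatrix_apply, Matrix.map_apply, hM, Matrix.of_apply, hA, hg, hμ, hl]
    simp only [gen, adjoinSqrtTwo.sqrt, AlgHom.coe_toRingHom, map_mul, map_intCast, map_pow,
      map_add, map_sub, map_one, map_natCast, IntermediateField.coe_val]
    push_cast
    rw [pow_mul, mul_left_comm, ← mul_pow]
    congr 2
    have : (((k + 1) * α - 2 * k) ^ e) ^ R₃ = (((k + 1) * α - 2 * k) ^ e) ^ (R₃ - s₃ i) *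
        (((k + 1) * α - 2 * k) ^ e) ^ s₃ i := by
      rw [← pow_add, Nat.sub_add_cancel (hs₃ i)]
    rw [this, div_pow]
    generalize ((k + 1) * α - 2 * k) ^ e = w at hl0
    field_simp
  have hD0 : M.det ≠ 0 := by
    intro h
    rw [h, ZeroMemClass.coe_zero] at hdetM
    refine (mul_ne_zero (Finset.prod_ne_zero_iff.2 fun j _ => ?_) hdet) hdetM.symm
    positivity
  have h_int : IsIntegral ℤ M.det := by
    refine IsIntegral.det fun j i => ?_
    have hg' : IsIntegral ℤ (gen α) := isIntegral_gen hα
    have hs' : IsIntegral ℤ (adjoinSqrtTwo.sqrt α) := isIntegral_sqrt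
    refine isIntegral_int_mul _ (IsIntegral.pow ((((hg'.pow _).mul
      ((isIntegral_one.add hs').pow _)).mul (IsIntegral.pow ?_ _)).mul (IsIntegral.pow ?_ _)) _)
    · exact ((isIntegral_natCast' _).mul hs').mul ((hg'.sub isIntegral_one).pow _)
    · exact (((isIntegral_natCast' _).mul hg').sub (isIntegral_natCast' _)).pow _
  have hg1 : 1 ≤ 1 + √2 := by linarith
  set Q : ℝ := N.factorial * C ^ N * H ^ (T * R₃ * N) with hQ
  have hN1 : (1 : ℝ) ≤ N.factorial := by exact_mod_cast N.factorial_pos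
  have hHN : 1 ≤ H ^ (T * R₃ * N) := one_le_pow₀ hH
  have hQH : H ^ (T * R₃ * N) ≤ Q := by
    rw [hQ]
    exact le_mul_of_one_le_left (by positivity)
      (one_le_mul_of_one_le_of_one_le hN1 (one_le_pow₀ hC))
  have hQ1 : 1 ≤ Q := hHN.trans hQH
  set X : ℝ := α ^ (T * R₁ * N) with hX
  set Y : ℝ := (1 + √2) ^ (T * R₂ * N) with hY
  have hX1 : 1 ≤ X := one_le_pow₀ h1.le
  have hY1 : 1 ≤ Y := one_le_pow₀ hg1
  have key := one_le_norm_mul_prod_erase (incl α) hD0 h_int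
    (fun σ => Q * ((if σ (gen α) = α then X else 1) *
      (if σ (adjoinSqrtTwo.sqrt α) = (√2 : ℝ) then Y else 1))) (fun σ _ => by
    rw [hmap]
    have h5 : ‖σ (gen α)‖ ≤ if σ (gen α) = α then α else 1 := by
      split_ifs with h
      · rw [h, Complex.norm_real, Real.norm_eq_abs, abs_of_pos (by linarith)]
      · exact (hσ σ).resolve_left h
    have h6 : ‖σ g‖ ≤ if σ (adjoinSqrtTwo.sqrt α) = (√2 : ℝ) then 1 + √2 else 1 := by
      rw [hσg]
      split_ifs with h
      · rw [h, ← Complex.ofReal_one, ← Complex.ofReal_add, Complex.norm_real, Real.norm_eq_abs,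
          abs_of_pos (by linarith)]
      · rw [(algHom_sqrt σ).resolve_left h, ← Complex.ofReal_one, ← Complex.ofReal_neg,
          ← Complex.ofReal_add, Complex.norm_real, Real.norm_eq_abs, abs_le]
        have := one_add_sqrt_two_bounds
        constructor <;> linarith
    refine (norm_det_monomial_le z t s₁ s₂ s₃ ht hs₁ hs₂ hs₃ hz ?_ ?_ hH h5 h6 (hμH σ)
      (hlH σ)).trans (le_of_eq ?_)
    · split_ifs
      · exact h1.le
      · exact le_rfl
    · split_ifs
      · exact hg1
      · exact le_rfl
    · rw [← hN, hQ, hX, hY]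
      split_ifs <;> simp only [one_pow, mul_pow, ← pow_mul, one_mul, mul_one] <;> ring_nf)
  clear_value Q X Y
  rw [Finset.prod_mul_distrib, Finset.prod_mul_distrib, Finset.prod_ite, Finset.prod_ite] at key
  simp only [Finset.prod_const, one_pow, mul_one] at key
  rw [Finset.card_erase_of_mem (Finset.mem_univ _), Finset.card_univ] at key
  obtain ⟨c1, c2, c3⟩ := card_algHom_le hα
  have e1 : (Finset.filter (fun σ : adjoinSqrtTwo α →ₐ[ℚ] ℂ => σ (gen α) = α)
      (Finset.univ.erase (incl α))).card ≤ 1 := by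
    refine le_trans (Finset.card_le_card fun σ hσ' => ?_) c2
    simpa using hσ'
  have e2 : (Finset.filter (fun σ : adjoinSqrtTwo α →ₐ[ℚ] ℂ =>
      σ (adjoinSqrtTwo.sqrt α) = (√2 : ℝ)) (Finset.univ.erase (incl α))).card ≤ k := by
    refine le_trans (Finset.card_le_card fun σ hσ' => ?_) (c3.trans (Nat.sub_le _ _))
    simpa using hσ'
  have hnorm : ‖incl α M.det‖ ≤ H ^ (T * R₃ * N) * |A.det| := by
    rw [incl_apply, hdetM, Complex.norm_real, Real.norm_eq_abs, abs_mul]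
    refine mul_le_mul_of_nonneg_right ?_ (abs_nonneg _)
    rw [Finset.abs_prod]
    refine (Finset.prod_le_prod (fun _ _ => abs_nonneg _) (g := fun _ => H ^ (T * R₃))
      fun j _ => ?_).trans (le_of_eq ?_)
    · rw [abs_of_pos (by positivity)]
      have : ((k + 1) * α - 2 * k) ^ e ≤ H := by
        refine le_trans (pow_le_pow_left₀ hpos.le ?_ e) hH₂
        have hk0 : (1 : ℝ) ≤ k := by exact_mod_cast hk
        nlinarith
      calc _ ≤ H ^ (R₃ * t j) := pow_le_pow_left₀ (by positivity) this _
        _ ≤ _ := pow_le_pow_right₀ hH (by rw [mul_comm]; exact Nat.mul_le_mul_right _ (ht j))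
    · rw [Finset.prod_const, Finset.card_univ, ← pow_mul]
  have hcard : 1 ≤ Fintype.card (adjoinSqrtTwo α →ₐ[ℚ] ℂ) := Fintype.card_pos_iff.2 ⟨incl α⟩
  have hA0 : 0 ≤ |A.det| := abs_nonneg _
  refine key.trans ?_
  calc _ ≤ (Q * |A.det|) * (Q ^ (2 * k - 1) * (X ^ 1 * Y ^ k)) := by
        refine mul_le_mul (hnorm.trans (mul_le_mul_of_nonneg_right hQH hA0)) ?_ (by positivity)
          (by positivity)
        refine mul_le_mul (pow_le_pow_right₀ hQ1 (Nat.sub_le_sub_right c1 1)) ?_ (by positivity)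
          (by positivity)
        exact mul_le_mul (pow_le_pow_right₀ hX1 e1) (pow_le_pow_right₀ hY1 e2) (by positivity)
          (by positivity)
    _ = _ := by
      have : Q ^ (2 * k) = Q * Q ^ (2 * k - 1) := by
        rw [← pow_succ']
        congr 1
        omega
      rw [this, hY, ← pow_mul, mul_comm (T * R₂ * N) k]
      ring

end Liouville

section Independence

variable {k : ℕ} {α : ℝ}

open adjoinSqrtTwo

/-- The dominant root is multiplicatively independent of `1 + √2`. -/
theorem pow_ne_one_add_sqrt_two_pow (hα : α ^ k = ∑ i ∈ Finset.range k, α ^ i)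
    (h1 : 1.8 ≤ α) (h2 : α < 2)
    (hconj : ∀ β : ℂ, β ^ k = ∑ i ∈ Finset.range k, β ^ i → β = α ∨ ‖β‖ ≤ 1)
    {a c : ℕ} (ha : 1 ≤ a) (hc : 1 ≤ c) : α ^ a ≠ (1 + √2) ^ c := by
  classical
  intro h
  have := finiteDimensional_adjoinSqrtTwo hα
  have hb := one_add_sqrt_two_bounds
  have h0 : 0 < α := by linarith
  have hσ0 : ∀ σ : adjoinSqrtTwo α →ₐ[ℚ] ℂ,
      σ (gen α) ^ a = (1 + σ (adjoinSqrtTwo.sqrt α)) ^ c := fun σ => by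
    have : gen α ^ a = (1 + adjoinSqrtTwo.sqrt α) ^ c :=
      Subtype.ext (by simpa [gen, adjoinSqrtTwo.sqrt] using h)
    rw [← map_pow, this]
    simp
  have hincl : incl α (gen α) = α := rfl
  have hσ1 : ∀ σ : adjoinSqrtTwo α →ₐ[ℚ] ℂ, σ ≠ incl α → ‖σ (gen α)‖ = 1 / α := by
    intro σ hne
    have hs : σ (adjoinSqrtTwo.sqrt α) = -(√2 : ℝ) := by
      refine (algHom_sqrt σ).resolve_left fun hs => ?_
      have h3 := hσ0 σ
      rw [hs] at h3
      refine hne (algHom_ext (((hconj _ (algHom_gen_pow hα σ)).resolve_right fun h4 => ?_).trans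
        hincl.symm) hs)
      have h5 : ‖σ (gen α)‖ ^ a = (1 + √2) ^ c := by
        rw [← norm_pow, h3, norm_pow, ← Complex.ofReal_one, ← Complex.ofReal_add,
          Complex.norm_real, Real.norm_eq_abs, abs_of_pos (by linarith)]
      have h6 : ‖σ (gen α)‖ ^ a ≤ 1 := pow_le_one₀ (norm_nonneg _) h4
      have h7 : 1 < (1 + √2) ^ c := one_lt_pow₀ (by linarith) (by omega)
      linarith
    have h3 := hσ0 σ
    rw [hs] at h3
    have h5 : ‖σ (gen α)‖ ^ a = (√2 - 1) ^ c := by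
      rw [← norm_pow, h3, norm_pow, ← Complex.ofReal_one, ← Complex.ofReal_neg,
        ← Complex.ofReal_add, Complex.norm_real, Real.norm_eq_abs, abs_of_neg (by linarith)]
      ring
    have h6 : (‖σ (gen α)‖ * α) ^ a = 1 := by
      rw [mul_pow, h5, h, ← mul_pow]
      have : (√2 - 1) * (1 + √2) = 1 := by
        have := Real.mul_self_sqrt (show (0 : ℝ) ≤ 2 by norm_num)
        linarith
      rw [this, one_pow]
    rw [eq_div_iff h0.ne']
    exact (pow_eq_one_iff_of_nonneg (by positivity) (by omega)).1 h6
  -- the norm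
  have hg0 : gen α ≠ 0 := fun h3 => h0.ne' (congrArg Subtype.val h3)
  have key := one_le_norm_mul_prod_erase (incl α) hg0 (isIntegral_gen hα) (fun _ => 1 / α)
    fun σ hσ => (hσ1 σ hσ).le
  rw [Finset.prod_const, Finset.card_erase_of_mem (Finset.mem_univ _), Finset.card_univ, hincl,
    Complex.norm_real, Real.norm_eq_abs, abs_of_pos h0] at key
  -- at most one further embedding
  have hd : (Finset.univ.erase (incl α)).card ≤ 1 := by
    rw [Finset.card_erase_of_mem (Finset.mem_univ _), Finset.card_univ]
    by_contra hlt
    have h3 : (1 / α) ^ (Fintype.card (adjoinSqrtTwo α →ₐ[ℚ] ℂ) - 1) ≤ (1 / α) ^ 2 :=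
      pow_le_pow_of_le_one (by positivity) (by rw [div_le_one h0]; linarith) (by omega)
    have h4 : 1 ≤ α * (1 / α) ^ 2 := key.trans (mul_le_mul_of_nonneg_left h3 h0.le)
    have h5 : α * (1 / α) ^ 2 = 1 / α := by field_simp
    rw [h5, le_div_iff₀ h0] at h4
    linarith
  -- trace and norm are integers
  obtain ⟨y, hy⟩ := IsIntegrallyClosed.isIntegral_iff.1
    (Algebra.isIntegral_trace (L := ℚ) (isIntegral_gen hα))
  obtain ⟨x, hx⟩ := IsIntegrallyClosed.isIntegral_iff.1
    (Algebra.isIntegral_norm ℚ (isIntegral_gen hα))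
  have hx' := Algebra.norm_eq_prod_embeddings ℚ ℂ (gen α)
  have hy' := trace_eq_sum_embeddings (K := ℚ) ℂ (x := gen α)
  rw [← hy, ← Finset.add_sum_erase _ _ (Finset.mem_univ (incl α)), hincl] at hy'
  rw [← hx, ← Finset.mul_prod_erase _ _ (Finset.mem_univ (incl α)), hincl] at hx'
  simp only [eq_intCast, map_intCast] at hx' hy'
  have h_int : ∀ m : ℤ, (m : ℂ) = α → False := fun m hm => by
    have hm' : (m : ℝ) = α := by exact_mod_cast hm
    rw [← hm'] at h1 h2
    have : m < 2 := by exact_mod_cast h2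
    have : 1 < m := by exact_mod_cast lt_of_lt_of_le (by norm_num : (1 : ℝ) < 1.8) h1
    omega
  rcases Nat.le_one_iff_eq_zero_or_eq_one.1 hd with hd | hd
  · rw [Finset.card_eq_zero] at hd
    rw [hd, Finset.prod_empty, mul_one] at hx'
    exact h_int _ hx'
  · obtain ⟨τ, hτ⟩ := Finset.card_eq_one.1 hd
    have hτ1 := hσ1 τ (Finset.ne_of_mem_erase (s := Finset.univ) (by rw [hτ]; simp))
    rw [hτ, Finset.prod_singleton] at hx'
    rw [hτ, Finset.sum_singleton] at hy'
    have hx1 : |x| = 1 := by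
      have h3 : ‖(x : ℂ)‖ = 1 := by
        rw [hx', norm_mul, hτ1, Complex.norm_real, Real.norm_eq_abs, abs_of_pos h0]
        field_simp
      rw [Complex.norm_intCast] at h3
      exact_mod_cast h3
    have hmul : (y : ℝ) * α = α * α + x := by
      have : (y : ℂ) * α = α * α + x := by rw [hx', hy']; ring
      exact_mod_cast this
    have hy1 : (y : ℝ) ≤ 2 ∨ 3 ≤ (y : ℝ) := by
      rcases le_or_gt y 2 with h3 | h3
      · left; exact_mod_cast h3
      · right; exact_mod_cast h3
    have hy2 : (y : ℝ) ≤ 1 ∨ 2 ≤ (y : ℝ) := by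
      rcases le_or_gt y 1 with h3 | h3
      · left; exact_mod_cast h3
      · right; exact_mod_cast h3
    rcases (abs_eq (by norm_num : (0 : ℤ) ≤ 1)).1 hx1 with rfl | rfl
    · push_cast at hmul
      rcases hy1 with h3 | h3
      · nlinarith
      · nlinarith
    · push_cast at hmul
      rcases hy2 with h3 | h3
      · nlinarith
      · nlinarith

end Independence

/-- Comparison of the analytic upper bound and the arithmetic lower bound for an interpolation
determinant of size `N`. -/
lemma compare_det_bounds {N k T K R₁ R₂ R₃ η ℓ G S : ℕ} (hN : 1 ≤ N) {D α γ H Z E : ℝ}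
    (hα : 0 < α) (hγ : 0 < γ) (hH₀ : 0 < H) (hH : H ≤ Real.exp η) (hNℓ : (N : ℝ) ≤ Real.exp ℓ)
    (hD : 0 ≤ D)
    (h1 : 1 ≤ D * ((N.factorial * Real.exp (2 * K * ℓ) ^ N * H ^ (T * R₃ * N)) ^ (2 * k) *
      α ^ (T * R₁ * N) * γ ^ (k * (T * R₂ * N))))
    (h2 : D * Real.exp 2 ^ (N * G) ≤ N.factorial *
      (3 * (Real.exp (2 * K * ℓ) * Real.exp (E * (T * Z)))) ^ N * Real.exp 2 ^ S)
    (hG : 4 * (N * G) + 2 * N = 4 * S + N * (K * T)) :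
    (K * T / 2 - 1 : ℝ) ≤ 2 + ℓ + 2 * K * ℓ + E * (T * Z) + 2 * k * (ℓ + 2 * K * ℓ + T * R₃ * η) +
      T * R₁ * Real.log α + k * T * R₂ * Real.log γ := by
  have hfac : (N.factorial : ℝ) ≤ Real.exp (N * ℓ) := by
    rw [Real.exp_nat_mul]
    calc (N.factorial : ℝ) ≤ (N : ℝ) ^ N := by exact_mod_cast N.factorial_le_pow
      _ ≤ _ := pow_le_pow_left₀ N.cast_nonneg hNℓ N
  have h3 : (3 : ℝ) ≤ Real.exp 2 := by
    have := Real.add_one_le_exp (2 : ℝ)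
    linarith
  have hA : (N.factorial * Real.exp (2 * K * ℓ) ^ N * H ^ (T * R₃ * N)) ^ (2 * k) *
      α ^ (T * R₁ * N) * γ ^ (k * (T * R₂ * N)) ≤
      Real.exp (N * (2 * k * (ℓ + 2 * K * ℓ + T * R₃ * η) +
      T * R₁ * Real.log α + k * T * R₂ * Real.log γ)) := by
    have e1 : α ^ (T * R₁ * N) = Real.exp (N * (T * R₁ * Real.log α)) := by
      rw [← Real.rpow_natCast, Real.rpow_def_of_pos hα]
      push_cast
      ring_nf
    have e2 : γ ^ (k * (T * R₂ * N)) = Real.exp (N * (k * T * R₂ * Real.log γ)) := by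
      rw [← Real.rpow_natCast, Real.rpow_def_of_pos hγ]
      push_cast
      ring_nf
    have e3 : (N.factorial * Real.exp (2 * K * ℓ) ^ N * H ^ (T * R₃ * N)) ≤
        Real.exp (N * (ℓ + 2 * K * ℓ + T * R₃ * η)) := by
      calc _ ≤ Real.exp (N * ℓ) * Real.exp (2 * K * ℓ) ^ N * Real.exp η ^ (T * R₃ * N) := by gcongr
        _ = _ := by
          rw [← Real.exp_nat_mul, ← Real.exp_nat_mul, ← Real.exp_add, ← Real.exp_add]
          push_cast
          ring_nf
    rw [e1, e2]
    calc _ ≤ Real.exp (N * (ℓ + 2 * K * ℓ + T * R₃ * η)) ^ (2 * k) *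
          Real.exp (N * (T * R₁ * Real.log α)) * Real.exp (N * (k * T * R₂ * Real.log γ)) := by
          gcongr
      _ = _ := by
          rw [← Real.exp_nat_mul, ← Real.exp_add, ← Real.exp_add]
          push_cast
          ring_nf
  have hB : N.factorial * (3 * (Real.exp (2 * K * ℓ) * Real.exp (E * (T * Z)))) ^ N *
      Real.exp 2 ^ S ≤ Real.exp (N * (2 + ℓ + 2 * K * ℓ + E * (T * Z)) + 2 * S) := by
    calc _ ≤ Real.exp (N * ℓ) * (Real.exp 2 * (Real.exp (2 * K * ℓ) *
          Real.exp (E * (T * Z)))) ^ N * Real.exp 2 ^ S := by gcongr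
      _ = _ := by
        rw [← Real.exp_add, ← Real.exp_add, ← Real.exp_nat_mul, ← Real.exp_nat_mul,
          ← Real.exp_add, ← Real.exp_add]
        ring_nf
  set a : ℝ := N * (2 * k * (ℓ + 2 * K * ℓ + T * R₃ * η) +
      T * R₁ * Real.log α + k * T * R₂ * Real.log γ) with ha
  have h4 : Real.exp (N * G * 2) ≤ Real.exp (N * (2 + ℓ + 2 * K * ℓ + E * (T * Z)) + 2 * S + a) := by
    calc Real.exp (N * G * 2) ≤ Real.exp (N * G * 2) * (D * Real.exp a) :=
          le_mul_of_one_le_right (Real.exp_pos _).le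
            (h1.trans (mul_le_mul_of_nonneg_left hA hD))
      _ = (D * Real.exp 2 ^ (N * G)) * Real.exp a := by
          rw [← Real.exp_nat_mul]
          push_cast
          ring
      _ ≤ _ := by
          rw [Real.exp_add _ a]
          exact mul_le_mul_of_nonneg_right (h2.trans hB) (Real.exp_pos _).le
  rw [Real.exp_le_exp] at h4
  have hG' : 4 * ((N : ℝ) * G) + 2 * N = 4 * S + N * (K * T) := by exact_mod_cast hG
  have hN0 : (0 : ℝ) < N := by exact_mod_cast hN
  refine le_of_mul_le_mul_left ?_ hN0
  rw [ha] at h4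
  linarith

lemma log_one_add_sqrt_two_lt : Real.log (1 + √2) < 0.9 := by
  have hb := one_add_sqrt_two_bounds
  rw [Real.log_lt_iff_lt_exp (by linarith)]
  have := Real.sum_le_exp_of_nonneg (show (0 : ℝ) ≤ 0.9 by norm_num) 5
  norm_num [Finset.sum_range_succ, Nat.factorial] at this
  linarith

lemma exp_two_lt : Real.exp 2 < 7.4 := by
  have := Real.exp_one_lt_d9
  have h : Real.exp 2 = Real.exp 1 * Real.exp 1 := by rw [← Real.exp_add]; norm_num
  have h0 := Real.exp_pos 1
  rw [h]
  nlinarith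

/-- The parameters chosen below violate the conclusion of `compare_det_bounds`. -/
lemma parameters_violate {k η ℓ q Z la lg E : ℝ} (hk : 3 ≤ k) (hη : 1 ≤ η) (hℓ : 1 ≤ ℓ)
    (hq : 1000 ≤ q) (hla : la ≤ 0.7) (hlg : lg ≤ 0.9) (hE : E ≤ 7.4) (hZ₀ : 0 ≤ Z)
    (hZ : Z ≤ 0.7 * (2.02 * k * η * q) + 0.9 * (2.02 * η * q) + η * (2 * q) + 1) :
    2 + ℓ + 2 * (120 * k * η * q) * ℓ + E * ((24 * k * ℓ) * Z) +
      2 * k * (ℓ + 2 * (120 * k * η * q) * ℓ + (24 * k * ℓ) * (2 * q) * η) +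
      (24 * k * ℓ) * (2.02 * k * η * q) * la + k * (24 * k * ℓ) * (2.02 * η * q) * lg <
      (120 * k * η * q) * (24 * k * ℓ) / 2 - 1 := by
  have hkℓ : 3 ≤ k * ℓ := by nlinarith
  set A : ℝ := k * ℓ * (η * q) with hA
  set Y : ℝ := k * A with hY
  have hηq : 1000 ≤ η * q := by nlinarith
  have h1 : 1000 * (k * ℓ) ≤ A := by rw [hA]; nlinarith
  have h2 : 3 * A ≤ Y := by rw [hY]; nlinarith
  have h3 : 3 * ℓ ≤ k * ℓ := by nlinarith
  have h4 : E * ((24 * k * ℓ) * Z) ≤ 7.4 * 24 * (1.414 * Y + 3.818 * A + k * ℓ) := by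
    have h5 : (k * ℓ) * Z ≤ (k * ℓ) * (0.7 * (2.02 * k * η * q) + 0.9 * (2.02 * η * q) +
      η * (2 * q) + 1) := mul_le_mul_of_nonneg_left hZ (by linarith)
    have h6 : E * ((24 * k * ℓ) * Z) ≤ 7.4 * ((24 * k * ℓ) * Z) :=
      mul_le_mul_of_nonneg_right hE (mul_nonneg (by linarith) hZ₀)
    rw [hY, hA]
    linarith
  have hY0 : 0 ≤ Y := by linarith
  have h5 : (24 * k * ℓ) * (2.02 * k * η * q) * la ≤ 48.48 * Y * 0.7 := by
    have : (24 * k * ℓ) * (2.02 * k * η * q) * la = 48.48 * Y * la := by rw [hY, hA]; ring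
    rw [this]
    exact mul_le_mul_of_nonneg_left hla (by linarith)
  have h6 : k * (24 * k * ℓ) * (2.02 * η * q) * lg ≤ 48.48 * Y * 0.9 := by
    have : k * (24 * k * ℓ) * (2.02 * η * q) * lg = 48.48 * Y * lg := by rw [hY, hA]; ring
    rw [this]
    exact mul_le_mul_of_nonneg_left hlg (by linarith)
  have h7 : 2 * (120 * k * η * q) * ℓ = 240 * A := by rw [hA]; ring
  have h8 : 2 * k * (ℓ + 2 * (120 * k * η * q) * ℓ + (24 * k * ℓ) * (2 * q) * η) =
      2 * (k * ℓ) + 576 * Y := by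
    rw [hY, hA]; ring
  have h9 : (120 * k * η * q) * (24 * k * ℓ) / 2 = 1440 * Y := by rw [hY, hA]; ring
  rw [h8, h7, h9]
  linarith

section Homs

/-- The first coordinate of the exponential points. -/
def vHom (ω b₁ b₂ : ℤ) : ℤ × ℤ × ℤ →+ ℝ :=
  AddMonoidHom.mk' (fun g => ((g.1 - b₁ * g.2.2 + ω * (g.2.1 + b₂ * g.2.2) : ℤ) : ℝ))
    fun g h => by simp only [Prod.fst_add, Prod.snd_add]; push_cast; ring

/-- The second coordinate of the exponential points. -/
def uHom (b₂ : ℤ) : ℤ × ℤ × ℤ →+ ℝ :=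
  AddMonoidHom.mk' (fun g => ((g.2.1 + b₂ * g.2.2 : ℤ) : ℝ))
    fun g h => by simp only [Prod.fst_add, Prod.snd_add]; push_cast; ring

/-- The logarithm of the third coordinate of the exponential points. -/
noncomputable def wHom (x y z : ℝ) : ℤ × ℤ × ℤ →+ ℝ :=
  AddMonoidHom.mk' (fun g => g.1 * x + g.2.1 * y + g.2.2 * z)
    fun g h => by simp only [Prod.fst_add, Prod.snd_add]; push_cast; ring

lemma vHom_apply (ω b₁ b₂ : ℤ) (g : ℤ × ℤ × ℤ) :
    vHom ω b₁ b₂ g = ((g.1 - b₁ * g.2.2 + ω * (g.2.1 + b₂ * g.2.2) : ℤ) : ℝ) := rfl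

lemma uHom_apply (b₂ : ℤ) (g : ℤ × ℤ × ℤ) : uHom b₂ g = ((g.2.1 + b₂ * g.2.2 : ℤ) : ℝ) := rfl

lemma wHom_apply (x y z : ℝ) (g : ℤ × ℤ × ℤ) :
    wHom x y z g = g.1 * x + g.2.1 * y + g.2.2 * z := rfl

/-- The third logarithm is nearly a linear combination of the first two coordinates. -/
lemma wHom_sub (ω b₁ b₂ : ℤ) (x y z : ℝ) (g : ℤ × ℤ × ℤ) :
    wHom x y z g - g.2.2 * (b₁ * x - b₂ * y + z) =
      (vHom ω b₁ b₂ g - ω * uHom b₂ g) * x + uHom b₂ g * y := by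
  rw [wHom_apply, vHom_apply, uHom_apply]
  push_cast
  ring

/-- A box of integer points. -/
noncomputable def box (n₁ n₂ n₃ : ℕ) : Finset (ℤ × ℤ × ℤ) :=
  Finset.Ico 0 (n₁ : ℤ) ×ˢ Finset.Ico 0 (n₂ : ℤ) ×ˢ Finset.Ico 0 (n₃ : ℤ)

lemma mem_box {n₁ n₂ n₃ : ℕ} {g : ℤ × ℤ × ℤ} : g ∈ box n₁ n₂ n₃ ↔
    (0 ≤ g.1 ∧ g.1 < n₁) ∧ (0 ≤ g.2.1 ∧ g.2.1 < n₂) ∧ (0 ≤ g.2.2 ∧ g.2.2 < n₃) := by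
  simp [box, Finset.mem_product]

lemma card_box (n₁ n₂ n₃ : ℕ) : (box n₁ n₂ n₃).card = n₁ * (n₂ * n₃) := by
  simp [box]

lemma vHom_injOn_box {b₁ b₂ : ℕ} {S₁ S₂ S₃ : ℕ} (hS₁ : 5 ≤ S₁) (hb₁ : b₁ ≤ 2 * b₂)
    (hb₂ : 2 * (S₂ + 1) ≤ b₂) : Set.InjOn (vHom S₁ b₁ b₂) (box S₁ S₂ S₃) := by
  intro g hg h hh hgh
  rw [Finset.mem_coe, mem_box] at hg hh
  rw [vHom_apply, vHom_apply, Int.cast_inj] at hgh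
  obtain ⟨g1, g2, g3⟩ := g
  obtain ⟨h1, h2, h3⟩ := h
  simp only at hg hh hgh
  obtain ⟨⟨a1, a2⟩, ⟨a3, a4⟩, a5, a6⟩ := hg
  obtain ⟨⟨c1, c2⟩, ⟨c3, c4⟩, c5, c6⟩ := hh
  have hS₁' : (5 : ℤ) ≤ S₁ := by exact_mod_cast hS₁
  have hb₁' : (b₁ : ℤ) ≤ 2 * b₂ := by exact_mod_cast hb₁
  have hb₂' : 2 * ((S₂ : ℤ) + 1) ≤ b₂ := by exact_mod_cast hb₂
  have hb0 : (0 : ℤ) ≤ b₁ := Int.natCast_nonneg _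
  have key : ∀ d1 d2 d3 : ℤ, -(S₁ : ℤ) < d1 → -(S₂ : ℤ) < d2 → 1 ≤ d3 →
      d1 - b₁ * d3 + S₁ * (d2 + b₂ * d3) ≠ 0 := by
    intro d1 d2 d3 e1 e2 e3 h0
    have f1 : b₂ * d3 ≤ 2 * (d2 + b₂ * d3 - 1) := by nlinarith
    have f2 : (S₁ : ℤ) * (b₂ * d3) ≤ S₁ * (2 * (d2 + b₂ * d3 - 1)) :=
      mul_le_mul_of_nonneg_left f1 (by linarith)
    have f3 : (b₁ : ℤ) * d3 ≤ 2 * b₂ * d3 := mul_le_mul_of_nonneg_right hb₁' (by linarith)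
    have f4 : 5 * ((b₂ : ℤ) * d3) ≤ S₁ * (b₂ * d3) :=
      mul_le_mul_of_nonneg_right hS₁' (by nlinarith)
    have f5 : 0 < (b₂ : ℤ) * d3 := by nlinarith
    linarith
  have h33 : g3 = h3 := by
    rcases lt_trichotomy g3 h3 with hlt | heq | hgt
    · exact (key (h1 - g1) (h2 - g2) (h3 - g3) (by linarith) (by linarith) (by linarith)
        (by linarith)).elim
    · exact heq
    · exact (key (g1 - h1) (g2 - h2) (g3 - h3) (by linarith) (by linarith) (by linarith)
        (by linarith)).elim
  subst h33
  have h5 : g1 - h1 = S₁ * (h2 - g2) := by linarith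
  have h22 : h2 - g2 = 0 := by
    by_contra hne
    rcases lt_or_gt_of_ne hne with hlt | hgt
    · nlinarith
    · nlinarith
  rw [h22, mul_zero] at h5
  rw [Prod.mk.injEq, Prod.mk.injEq]
  exact ⟨by linarith, by linarith, rfl⟩

lemma int_linear_independent {x y : ℝ} (hx : 0 < x) (hy : 0 < y)
    (hxy : ∀ a c : ℕ, 1 ≤ a → 1 ≤ c → a * x ≠ c * y) {a c : ℤ} (h : a * x + c * y = 0) :
    a = 0 ∧ c = 0 := by
  rcases lt_trichotomy a 0 with ha | ha | ha
  · have hc : 0 < c := by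
      by_contra hc
      have h1 : (a : ℝ) < 0 := by exact_mod_cast ha
      have h2 : (c : ℝ) ≤ 0 := by exact_mod_cast not_lt.1 hc
      nlinarith
    refine (hxy a.natAbs c.natAbs (by omega) (by omega) ?_).elim
    rw [Nat.cast_natAbs, Nat.cast_natAbs, abs_of_neg ha, abs_of_pos hc]
    push_cast
    linarith
  · subst ha
    refine ⟨rfl, ?_⟩
    rw [Int.cast_zero, zero_mul, zero_add] at h
    exact_mod_cast (mul_eq_zero.1 h).resolve_right hy.ne'
  · have hc : c < 0 := by
      by_contra hc
      have h1 : (0 : ℝ) < a := by exact_mod_cast ha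
      have h2 : (0 : ℝ) ≤ c := by exact_mod_cast not_lt.1 hc
      nlinarith
    refine (hxy a.natAbs c.natAbs (by omega) (by omega) ?_).elim
    rw [Nat.cast_natAbs, Nat.cast_natAbs, abs_of_pos ha, abs_of_neg hc]
    push_cast
    linarith

lemma eq_of_wHom_eq {x y z : ℝ} (hx : 0 < x) (hy : 0 < y)
    (hxy : ∀ a c : ℕ, 1 ≤ a → 1 ≤ c → a * x ≠ c * y) {g h : ℤ × ℤ × ℤ}
    (hw : wHom x y z g = wHom x y z h) (h3 : g.2.2 = h.2.2) : g = h := by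
  rw [wHom_apply, wHom_apply, h3] at hw
  have h4 : ((g.1 - h.1 : ℤ) : ℝ) * x + ((g.2.1 - h.2.1 : ℤ) : ℝ) * y = 0 := by
    push_cast
    linarith
  obtain ⟨h5, h6⟩ := int_linear_independent hx hy hxy h4
  exact Prod.ext (by linarith) (Prod.ext (by linarith) h3)

end Homs

section Parameters

/-- The algebraic number occurring in the linear form in logarithms. -/
noncomputable def formCoeff (k e c : ℕ) (α : ℝ) : ℝ :=
  c * √2 * (α - 1) ^ e / ((k + 1) * α - 2 * k) ^ e

/-- The hypotheses on the data of a linear form in logarithms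
`b₁ log α - b₂ log (1 + √2) + log (formCoeff k e c α)`. -/
structure Admissible (k e c η ℓ b₁ b₂ : ℕ) (α H : ℝ) : Prop where
  three_le : 3 ≤ k
  root : α ^ k = ∑ i ∈ Finset.range k, α ^ i
  lower : 1.8 ≤ α
  upper : α < 2
  den_pos : 0 < (k + 1) * α - 2 * k
  conj : ∀ β : ℂ, β ^ k = ∑ i ∈ Finset.range k, β ^ i → β = α ∨ ‖β‖ ≤ 1
  one_le : 1 ≤ c
  height₁ : c * √2 * 2 ^ e ≤ H
  height₂ : (3 * k + 1 : ℝ) ^ e ≤ H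
  height_le : H ≤ Real.exp η
  two_le : 2 ≤ η
  log_le : |Real.log (formCoeff k e c α)| ≤ η
  le_two_mul : b₁ ≤ 2 * b₂
  large : 2 * (η * (2500000 * k ^ 2 * ℓ) + 1) ≤ b₂
  size : 2e13 * (k : ℝ) ^ 5 * η * ℓ ^ 2 * b₂ ≤ Real.exp ℓ
  pos : 1 ≤ ℓ

namespace Admissible

variable {k e c η ℓ b₁ b₂ : ℕ} {α H : ℝ}

lemma formCoeff_pos (h : Admissible k e c η ℓ b₁ b₂ α H) : 0 < formCoeff k e c α := by
  have h1 : (0 : ℝ) < c := by exact_mod_cast h.one_le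
  have h2 : 0 < α - 1 := by linarith [h.lower]
  have h3 := h.den_pos
  rw [formCoeff]
  positivity

lemma log_pos (h : Admissible k e c η ℓ b₁ b₂ α H) : 0 < Real.log α :=
  Real.log_pos (by linarith [h.lower])

lemma log_lt (h : Admissible k e c η ℓ b₁ b₂ α H) : Real.log α < 0.7 := by
  have h1 : Real.log α < Real.log 2 := Real.log_lt_log (by linarith [h.lower]) h.upper
  linarith [Real.log_two_lt_d9]

lemma log_gt (h : Admissible k e c η ℓ b₁ b₂ α H) : 0.5 < Real.log α := by
  rw [Real.lt_log_iff_exp_lt (by linarith [h.lower])]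
  have h1 := Real.exp_one_lt_d9
  have h2 : Real.exp 0.5 * Real.exp 0.5 = Real.exp 1 := by rw [← Real.exp_add]; norm_num
  have h3 := Real.exp_pos 0.5
  nlinarith [h.lower]

lemma mul_log_ne (h : Admissible k e c η ℓ b₁ b₂ α H) (a d : ℕ) (ha : 1 ≤ a) (hd : 1 ≤ d) :
    a * Real.log α ≠ d * Real.log (1 + √2) := by
  intro heq
  have hb := one_add_sqrt_two_bounds
  rw [← Real.log_pow, ← Real.log_pow] at heq
  have h0 : 0 < α := by linarith [h.lower]
  exact pow_ne_one_add_sqrt_two_pow h.root h.lower h.upper h.conj ha hd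
    (Real.log_injOn_pos (Set.mem_Ioi.2 (pow_pos h0 a))
      (Set.mem_Ioi.2 (pow_pos (show (0 : ℝ) < 1 + √2 by linarith) d)) heq)

lemma log_sqrt_pos : 0 < Real.log (1 + √2) :=
  Real.log_pos (by linarith [one_add_sqrt_two_bounds.1])

/-- The nonvanishing interpolation determinant cannot be as small as predicted. -/
theorem false_of_det (h : Admissible k e c η ℓ b₁ b₂ α H) {J : Type*} [Fintype J] [DecidableEq J]
    [Nonempty J] (t : J → ℕ) (ht : ∀ j, t j ≤ 24 * k * ℓ) (z : J → J → ℤ)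
    (hz : ∀ j i, |(z j i : ℝ)| ≤ Real.exp (2 * (120 * k * η * (2500000 * k ^ 2 * ℓ) : ℕ) * ℓ))
    (pts : J → ℤ × ℤ × ℤ)
    (hpts : ∀ i, pts i ∈ box (101 * k * η * (50000 * k ^ 2 * ℓ)) (101 * η * (50000 * k ^ 2 * ℓ))
      (100 * (50000 * k ^ 2 * ℓ)))
    (A : Matrix J J ℝ) (hA : ∀ j i, A j i = z j i * Real.exp (t j *
      wHom (Real.log α) (Real.log (1 + √2)) (Real.log (formCoeff k e c α)) (pts i)))
    (hdet : A.det ≠ 0) (hcard : (Fintype.card J : ℝ) ≤ Real.exp ℓ) {Z : ℝ} (hZ₀ : 0 ≤ Z)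
    (hZ : Z ≤ 0.7 * (101 * k * η * (50000 * k ^ 2 * ℓ)) + 0.9 * (101 * η * (50000 * k ^ 2 * ℓ)) +
      η * (100 * (50000 * k ^ 2 * ℓ)) + 1) {G S : ℕ}
    (hG : 4 * (Fintype.card J * G) + 2 * Fintype.card J = 4 * S +
      Fintype.card J * ((120 * k * η * (2500000 * k ^ 2 * ℓ)) * (24 * k * ℓ)))
    (hup : |A.det| * Real.exp 2 ^ (Fintype.card J * G) ≤ (Fintype.card J).factorial *
      (3 * (Real.exp (2 * (120 * k * η * (2500000 * k ^ 2 * ℓ) : ℕ) * ℓ) *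
        Real.exp (Real.exp 2 * ((24 * k * ℓ : ℕ) * Z)))) ^ Fintype.card J * Real.exp 2 ^ S) :
    False := by
  have hb := one_add_sqrt_two_bounds
  have hα0 : 0 < α := by linarith [h.lower]
  have hH1 : 1 ≤ H := le_trans (one_le_pow₀ (by have : (0 : ℝ) ≤ k := k.cast_nonneg; linarith))
    h.height₂
  have hlow := one_le_abs_det_mul (by linarith [h.three_le]) h.root (by linarith [h.lower])
    h.upper.le h.den_pos h.conj h.height₁ h.height₂ (T := 24 * k * ℓ)
    (R₁ := 101 * k * η * (50000 * k ^ 2 * ℓ)) (R₂ := 101 * η * (50000 * k ^ 2 * ℓ))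
    (R₃ := 100 * (50000 * k ^ 2 * ℓ)) z t (fun i => (pts i).1.toNat)
    (fun i => (pts i).2.1.toNat) (fun i => (pts i).2.2.toNat) ht
    (fun i => by have := (mem_box.1 (hpts i)).1; omega)
    (fun i => by have := (mem_box.1 (hpts i)).2.1; omega)
    (fun i => by have := (mem_box.1 (hpts i)).2.2; omega)
    (C := Real.exp (2 * (120 * k * η * (2500000 * k ^ 2 * ℓ) : ℕ) * ℓ))
    (Real.one_le_exp (by positivity)) hz A (fun j i => by
      rw [hA, Real.exp_nat_mul, wHom_apply, Real.exp_add, Real.exp_add]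
      have hm := mem_box.1 (hpts i)
      have key : ∀ (m : ℤ) (x : ℝ), 0 < x → 0 ≤ m → Real.exp (m * Real.log x) = x ^ m.toNat := by
        intro m x hx hm
        lift m to ℕ using hm
        rw [Int.toNat_natCast, Int.cast_natCast, Real.exp_nat_mul, Real.exp_log hx]
      rw [key _ _ hα0 hm.1.1, key _ _ (by linarith) hm.2.1.1, key _ _ h.formCoeff_pos hm.2.2.1]
      rfl) hdet
  have h1 := compare_det_bounds (Fintype.card_pos (α := J)) hα0 (by linarith) (by linarith)
    h.height_le hcard (abs_nonneg _) hlow hup hG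
  have hk : (3 : ℝ) ≤ k := by exact_mod_cast h.three_le
  have hη : (2 : ℝ) ≤ η := by exact_mod_cast h.two_le
  have hℓ : (1 : ℝ) ≤ ℓ := by exact_mod_cast h.pos
  have h2 := parameters_violate (k := k) (η := η) (ℓ := ℓ) (q := 2500000 * k ^ 2 * ℓ) (Z := Z)
    (la := Real.log α) (lg := Real.log (1 + √2)) hk (by linarith) hℓ (by nlinarith) h.log_lt.le
    log_one_add_sqrt_two_lt.le exp_two_lt.le hZ₀ (hZ.trans (le_of_eq (by ring)))
  refine absurd h1 (not_le.2 (lt_of_eq_of_lt ?_ (h2.trans_eq ?_)))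
  · push_cast
    ring
  · push_cast
    ring

end Admissible

end Parameters

section DetBounds

lemma add_pow_eq_sum_fin {K b : ℕ} (hb : b < K) (x y : ℝ) :
    ∑ m : Fin K, (b.choose m : ℝ) * x ^ (m : ℕ) * y ^ (b - m) = (x + y) ^ b := by
  rw [Fin.sum_univ_eq_sum_range (fun m => (b.choose m : ℝ) * x ^ m * y ^ (b - m)) K, add_pow,
    ← Finset.sum_subset (Finset.range_subset_range.2 (Nat.succ_le_of_lt hb))]
  · exact Finset.sum_congr rfl fun m _ => by ring
  · intro m _ hm
    rw [Nat.choose_eq_zero_of_lt (by simpa [Nat.lt_succ_iff] using hm)]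
    simp

/-- Upper bound for an interpolation determinant of exponential monomials in three variables. -/
theorem abs_det_monomials_mul_pow_le {K T : ℕ}
    (A : Matrix (Fin K × Fin K × Fin T) (Fin K × Fin K × Fin T) ℝ)
    (v u w : Fin K × Fin K × Fin T → ℝ) {c₁ c₂ V Z E : ℝ} (hu : ∀ i, u i = c₁ * w i + c₂ * v i)
    (err : Fin K × Fin K × Fin T → Fin K × Fin K × Fin T → ℝ)
    (hA : ∀ j i, A j i = v i ^ (j.1 : ℕ) * u i ^ (j.2.1 : ℕ) * Real.exp ((j.2.2 : ℕ) * w i) +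
      err j i)
    (hE : 1 ≤ E) (hV : 1 ≤ V) (hv : ∀ i, |v i| ≤ V) (hw : ∀ i, |w i| ≤ Z) (hZ : 0 ≤ Z)
    (hc : |c₁| * (E * Z) + |c₂| * V ≤ V) (G : ℕ)
    (herr : ∀ j i, |err j i| * E ^ G ≤ V ^ (2 * K) * Real.exp (E * (T * Z))) :
    |A.det| * E ^ (Fintype.card (Fin K × Fin K × Fin T) * G) ≤
      (Fintype.card (Fin K × Fin K × Fin T)).factorial *
      (3 * (V ^ (2 * K) * Real.exp (E * (T * Z)))) ^ Fintype.card (Fin K × Fin K × Fin T) *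
      E ^ (2 * K * ∑ c ∈ Finset.range G, (G - c)) := by
  have hc2 : 0 ≤ |c₂| := abs_nonneg _
  refine abs_det_exp_poly_mul_pow_le (K := K) A w
    (fun j m i => ((j.2.1 : ℕ).choose m : ℝ) * c₁ ^ (m : ℕ) * c₂ ^ ((j.2.1 : ℕ) - m) *
      v i ^ ((j.1 : ℕ) + (j.2.1 - m)))
    (fun j => (j.2.2 : ℕ)) err ?_
    (Submodule.span ℝ (Set.range fun (m : Fin (2 * K)) i => v i ^ (m : ℕ))) (2 * K) ?_ ?_ Z hw
    (fun j m => ((j.2.1 : ℕ).choose m : ℝ) * |c₁| ^ (m : ℕ) * |c₂| ^ ((j.2.1 : ℕ) - m) *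
      V ^ ((j.1 : ℕ) + (j.2.1 - m))) ?_ hE G ?_ herr
  · intro j i
    rw [hA, hu, ← add_pow_eq_sum_fin j.2.1.2 (c₁ * w i) (c₂ * v i), Finset.mul_sum]
    congr 2
    refine Finset.sum_congr rfl fun m _ => ?_
    rw [mul_pow, mul_pow, pow_add]
    ring
  · exact (finrank_range_le_card _).trans (by simp)
  · intro j m
    have h1 : (j.1 : ℕ) + (j.2.1 - m) < 2 * K := by
      have := j.1.2
      have := j.2.1.2
      omega
    have h2 : (fun i => v i ^ ((j.1 : ℕ) + (j.2.1 - m))) ∈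
        Submodule.span ℝ (Set.range fun (m : Fin (2 * K)) i => v i ^ (m : ℕ)) :=
      Submodule.subset_span ⟨⟨_, h1⟩, rfl⟩
    exact Submodule.smul_mem _
      (((j.2.1 : ℕ).choose m : ℝ) * c₁ ^ (m : ℕ) * c₂ ^ ((j.2.1 : ℕ) - m)) h2
  · intro j m i
    rw [abs_mul, abs_mul, abs_mul, Nat.abs_cast, abs_pow, abs_pow, abs_pow]
    gcongr
    exact hv i
  · intro j
    have h1 : ∑ m : Fin K, ((j.2.1 : ℕ).choose m : ℝ) * |c₁| ^ (m : ℕ) *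
        |c₂| ^ ((j.2.1 : ℕ) - m) * V ^ ((j.1 : ℕ) + (j.2.1 - m)) * (E * Z) ^ (m : ℕ) =
        V ^ (j.1 : ℕ) * (|c₁| * (E * Z) + |c₂| * V) ^ (j.2.1 : ℕ) := by
      rw [← add_pow_eq_sum_fin j.2.1.2, Finset.mul_sum]
      refine Finset.sum_congr rfl fun m _ => ?_
      rw [mul_pow |c₁|, mul_pow |c₂|, pow_add]
      ring
    rw [h1, Nat.abs_cast]
    have h2 : V ^ (j.1 : ℕ) * (|c₁| * (E * Z) + |c₂| * V) ^ (j.2.1 : ℕ) ≤ V ^ (2 * K) := by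
      calc _ ≤ V ^ (j.1 : ℕ) * V ^ (j.2.1 : ℕ) := by gcongr
        _ = V ^ ((j.1 : ℕ) + j.2.1) := (pow_add _ _ _).symm
        _ ≤ _ := pow_le_pow_right₀ hV (by have := j.1.2; have := j.2.1.2; omega)
    have h3 : ((j.2.2 : ℕ) : ℝ) ≤ T := by exact_mod_cast j.2.2.2.le
    gcongr

/-- Upper bound for an interpolation determinant of exponential monomials along a line. -/
theorem abs_det_monomials_line_mul_pow_le {K T : ℕ} [Nonempty (Fin K × Fin T)]
    (A : Matrix (Fin K × Fin T) (Fin K × Fin T) ℝ)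
    (v w : Fin K × Fin T → ℝ) {a b V Z E : ℝ} (hab : ∀ i, w i = a + b * v i)
    (err : Fin K × Fin T → Fin K × Fin T → ℝ)
    (hA : ∀ j i, A j i = v i ^ (j.1 : ℕ) * Real.exp ((j.2 : ℕ) * w i) + err j i)
    (hE : 1 ≤ E) (hV : 1 ≤ V) (hv : ∀ i, |v i| ≤ V) (hw : ∀ i, |w i| ≤ Z) {B : ℝ}
    (hB : (E * V + V) ^ K * Real.exp (E * (T * Z)) ≤ B) (G : ℕ)
    (herr : ∀ j i, |err j i| * E ^ G ≤ B) :
    |A.det| * E ^ (Fintype.card (Fin K × Fin T) * G) ≤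
      (Fintype.card (Fin K × Fin T)).factorial *
      (3 * B) ^ Fintype.card (Fin K × Fin T) * E ^ (1 * ∑ c ∈ Finset.range G, (G - c)) := by
  obtain ⟨i₁, h₁⟩ := Finite.exists_max v
  obtain ⟨i₂, h₂⟩ := Finite.exists_min v
  set v₀ : ℝ := (v i₁ + v i₂) / 2 with hv₀
  set r : ℝ := (v i₁ - v i₂) / 2 with hr
  have hr0 : 0 ≤ r := by have := h₁ i₂; rw [hr]; linarith
  have hrV : r ≤ V := by
    have := abs_le.1 (hv i₁)
    have := abs_le.1 (hv i₂)
    rw [hr]; linarith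
  have hv₀V : |v₀| ≤ V := by
    have := abs_le.1 (hv i₁)
    have := abs_le.1 (hv i₂)
    rw [abs_le, hv₀]
    constructor <;> linarith
  have hZr : |a + b * v₀| + |b| * r ≤ Z := by
    have e₁ : w i₁ = (a + b * v₀) + b * r := by rw [hab, hv₀, hr]; ring
    have e₂ : w i₂ = (a + b * v₀) - b * r := by rw [hab, hv₀, hr]; ring
    have f₁ := abs_le.1 (e₁ ▸ hw i₁)
    have f₂ := abs_le.1 (e₂ ▸ hw i₂)
    rw [← abs_of_nonneg hr0, ← abs_mul]
    rcases abs_cases (a + b * v₀) with ⟨h3, _⟩ | ⟨h3, _⟩ <;>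
    rcases abs_cases (b * r) with ⟨h4, _⟩ | ⟨h4, _⟩ <;> rw [h3, h4] <;> linarith
  have hE0 : 0 ≤ E := by linarith
  refine abs_det_exp_poly_mul_pow_le (K := K) A (fun i => v i - v₀)
    (fun j m _ => ((j.1 : ℕ).choose m : ℝ) * v₀ ^ ((j.1 : ℕ) - m) *
      Real.exp ((j.2 : ℕ) * (a + b * v₀)))
    (fun j => (j.2 : ℕ) * b) err ?_
    (Submodule.span ℝ (Set.range fun (_ : Fin 1) (_ : Fin K × Fin T) => (1 : ℝ))) 1 ?_ ?_ r ?_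
    (fun j m => ((j.1 : ℕ).choose m : ℝ) * V ^ ((j.1 : ℕ) - m) *
      Real.exp ((j.2 : ℕ) * |a + b * v₀|)) ?_ hE G ?_ herr
  · intro j i
    have h1 : v i ^ (j.1 : ℕ) = ∑ m : Fin K, ((j.1 : ℕ).choose m : ℝ) * (v i - v₀) ^ (m : ℕ) *
        v₀ ^ ((j.1 : ℕ) - m) := by
      rw [add_pow_eq_sum_fin j.1.2, sub_add_cancel]
    have h2 : Real.exp ((j.2 : ℕ) * w i) = Real.exp ((j.2 : ℕ) * (a + b * v₀)) *
        Real.exp ((j.2 : ℕ) * b * (v i - v₀)) := by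
      rw [← Real.exp_add, hab]
      ring_nf
    rw [hA, h1, h2, ← mul_assoc, Finset.sum_mul]
    congr 2
    exact Finset.sum_congr rfl fun m _ => by ring
  · exact (finrank_range_le_card _).trans (by simp)
  · intro j m
    have h2 : (fun _ : Fin K × Fin T => (1 : ℝ)) ∈
        Submodule.span ℝ (Set.range fun (_ : Fin 1) (_ : Fin K × Fin T) => (1 : ℝ)) :=
      Submodule.subset_span ⟨0, rfl⟩
    convert Submodule.smul_mem _ (((j.1 : ℕ).choose m : ℝ) * v₀ ^ ((j.1 : ℕ) - m) *
      Real.exp ((j.2 : ℕ) * (a + b * v₀))) h2 using 1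
    ext i
    simp
  · intro i
    have := h₁ i
    have := h₂ i
    rw [abs_le, hv₀, hr]
    constructor <;> linarith
  · intro j m i
    rw [abs_mul, abs_mul, Nat.abs_cast, abs_pow, Real.abs_exp]
    have : a + b * v₀ ≤ |a + b * v₀| := le_abs_self _
    gcongr
  · intro j
    have h1 : ∑ m : Fin K, ((j.1 : ℕ).choose m : ℝ) * V ^ ((j.1 : ℕ) - m) *
        Real.exp ((j.2 : ℕ) * |a + b * v₀|) * (E * r) ^ (m : ℕ) =
        (E * r + V) ^ (j.1 : ℕ) * Real.exp ((j.2 : ℕ) * |a + b * v₀|) := by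
      rw [← add_pow_eq_sum_fin j.1.2, Finset.sum_mul]
      exact Finset.sum_congr rfl fun m _ => by ring
    rw [h1, abs_mul, Nat.abs_cast, mul_assoc, ← Real.exp_add]
    refine le_trans ?_ hB
    have h3 : ((j.2 : ℕ) : ℝ) ≤ T := by exact_mod_cast j.2.2.le
    have h4 : (E * r + V) ^ (j.1 : ℕ) ≤ (E * V + V) ^ K := by
      calc _ ≤ (E * V + V) ^ (j.1 : ℕ) := by gcongr
        _ ≤ _ := pow_le_pow_right₀ (by nlinarith) j.1.2.le
    have hZ : 0 ≤ Z := le_trans (by positivity) hZr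
    have h5 : ((j.2 : ℕ) : ℝ) * |a + b * v₀| + E * ((j.2 : ℕ) * |b| * r) ≤ E * (T * Z) := by
      have g1 : ((j.2 : ℕ) : ℝ) * (|a + b * v₀| + |b| * r) ≤ T * Z :=
        mul_le_mul h3 hZr (by positivity) (by positivity)
      have g2 : ((j.2 : ℕ) : ℝ) * |a + b * v₀| ≤ E * ((j.2 : ℕ) * |a + b * v₀|) :=
        le_mul_of_one_le_left (by positivity) hE
      have g3 := mul_le_mul_of_nonneg_left g1 hE0
      linarith
    gcongr

end DetBounds

section Polynomials

open MvPolynomial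

/-- Linear combinations of exponential monomials come from polynomials. -/
lemma exists_polynomial_of_coeffs {ι : Type*} [Fintype ι] (a b t : ι → ℕ)
    (hinj : ∀ i j, a i = a j → b i = b j → t i = t j → i = j) (c : ι → ℝ) :
    ∃ P : MvPolynomial (Fin 3) ℝ, (P = 0 → c = 0) ∧
      (∀ D, 0 < D → (∀ i, a i < D) → degreeOf 0 P < D) ∧
      (∀ D, 0 < D → (∀ i, b i < D) → degreeOf 1 P < D) ∧
      (∀ D, 0 < D → (∀ i, t i < D) → degreeOf 2 P < D) ∧
      ∀ x y w : ℝ, eval ![x, y, Real.exp w] P =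
        ∑ i, c i * (x ^ a i * y ^ b i * Real.exp (t i * w)) := by
  classical
  let σ : ι → Fin 3 →₀ ℕ := fun i => Finsupp.equivFunOnFinite.symm ![a i, b i, t i]
  have hσ0 : ∀ i, σ i 0 = a i := fun i => rfl
  have hσ1 : ∀ i, σ i 1 = b i := fun i => rfl
  have hσ2 : ∀ i, σ i 2 = t i := fun i => rfl
  have hσ : Function.Injective σ := fun i j hij =>
    hinj i j (by rw [← hσ0, hij, hσ0]) (by rw [← hσ1, hij, hσ1]) (by rw [← hσ2, hij, hσ2])
  have hdeg : ∀ (n : Fin 3) (D : ℕ), 0 < D → (∀ i, σ i n < D) →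
      degreeOf n (∑ i, monomial (σ i) (c i)) < D := by
    intro n D hD h
    rw [degreeOf_lt_iff hD]
    intro m hm
    obtain ⟨i, _, hi⟩ := Finset.mem_biUnion.1 (support_sum hm)
    rw [Finset.mem_singleton.1 (support_monomial_subset hi)]
    exact h i
  refine ⟨∑ i, monomial (σ i) (c i), fun h => ?_, fun D hD h => hdeg 0 D hD h,
    fun D hD h => hdeg 1 D hD h, fun D hD h => hdeg 2 D hD h, fun x y w => ?_⟩
  · ext i
    have h1 := congrArg (coeff (σ i)) h
    rw [coeff_sum, Finset.sum_eq_single i, coeff_monomial, if_pos rfl, coeff_zero] at h1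
    · exact h1
    · intro j _ hj
      rw [coeff_monomial, if_neg (fun h2 => hj (hσ h2))]
    · simp
  · rw [map_sum]
    refine Finset.sum_congr rfl fun i _ => ?_
    rw [eval_monomial, Finsupp.prod_fintype _ _ (fun _ => pow_zero _), Fin.prod_univ_three,
      hσ0, hσ1, hσ2, Real.exp_nat_mul]
    simp

end Polynomials

namespace Admissible

variable {k e c η ℓ b₁ b₂ : ℕ} {α H : ℝ}

lemma real_bounds (h : Admissible k e c η ℓ b₁ b₂ α H) :
    (3 : ℝ) ≤ k ∧ (2 : ℝ) ≤ η ∧ (1 : ℝ) ≤ ℓ ∧ (b₁ : ℝ) ≤ 2 * b₂ ∧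
      2 * (η * (2500000 * (k : ℝ) ^ 2 * ℓ) + 1) ≤ b₂ :=
  ⟨by exact_mod_cast h.three_le, by exact_mod_cast h.two_le, by exact_mod_cast h.pos,
    by exact_mod_cast h.le_two_mul, by exact_mod_cast h.large⟩

lemma le_exp (h : Admissible k e c η ℓ b₁ b₂ α H) :
    1e20 * (k : ℝ) ^ 7 * η ^ 2 * ℓ ^ 3 ≤ Real.exp ℓ := by
  obtain ⟨hk, hη, hℓ, -, hb⟩ := h.real_bounds
  refine le_trans ?_ h.size
  have h1 : (2 : ℝ) * (η * (2500000 * (k : ℝ) ^ 2 * ℓ)) ≤ b₂ := by linarith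
  calc 1e20 * (k : ℝ) ^ 7 * η ^ 2 * ℓ ^ 3 =
      2e13 * (k : ℝ) ^ 5 * η * ℓ ^ 2 * (2 * (η * (2500000 * (k : ℝ) ^ 2 * ℓ))) := by ring
    _ ≤ _ := by gcongr

lemma abs_hom_le (h : Admissible k e c η ℓ b₁ b₂ α H) {g : ℤ × ℤ × ℤ}
    (hg : g ∈ box (101 * k * η * (50000 * k ^ 2 * ℓ)) (101 * η * (50000 * k ^ 2 * ℓ))
      (100 * (50000 * k ^ 2 * ℓ))) :
    |vHom (k * η * (2500000 * k ^ 2 * ℓ) : ℕ) b₁ b₂ g| ≤ Real.exp ℓ ∧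
      |uHom b₂ g| ≤ Real.exp ℓ := by
  obtain ⟨hk, hη, hℓ, hb₁, hb⟩ := h.real_bounds
  have hsize := h.size
  rw [mem_box] at hg
  obtain ⟨⟨x1, x2⟩, ⟨y1, y2⟩, z1, z2⟩ := hg
  rw [vHom_apply, uHom_apply]
  push_cast
  generalize hX : g.1 = X at *
  generalize hY : g.2.1 = Y at *
  generalize hZ : g.2.2 = W at *
  have x1' : (0 : ℝ) ≤ X := by exact_mod_cast x1
  have y1' : (0 : ℝ) ≤ Y := by exact_mod_cast y1
  have z1' : (0 : ℝ) ≤ W := by exact_mod_cast z1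
  obtain ⟨p, hp⟩ : ∃ p : ℝ, p = 50000 * (k : ℝ) ^ 2 * ℓ := ⟨_, rfl⟩
  have x2' : (X : ℝ) ≤ 101 * k * η * p := by rw [hp]; exact_mod_cast x2.le
  have y2' : (Y : ℝ) ≤ 101 * η * p := by rw [hp]; exact_mod_cast y2.le
  have z2' : (W : ℝ) ≤ 100 * p := by rw [hp]; exact_mod_cast z2.le
  have hS : (k : ℝ) * η * (2500000 * k ^ 2 * ℓ) = 50 * (k * η * p) := by rw [hp]; ring
  have hp0 : 450000 ≤ p := by
    have : (9 : ℝ) ≤ (k : ℝ) ^ 2 := by nlinarith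
    rw [hp]; nlinarith
  have hb' : 100 * (η * p) ≤ b₂ := by
    have : η * (2500000 * (k : ℝ) ^ 2 * ℓ) = 50 * (η * p) := by rw [hp]; ring
    rw [this] at hb
    linarith
  have hb0 : (0 : ℝ) ≤ b₂ := by positivity
  have hb10 : (0 : ℝ) ≤ b₁ := by positivity
  have hsize' : 8000 * (k * η * p * (p * b₂)) ≤ Real.exp ℓ := by
    refine le_trans (le_of_eq ?_) hsize
    rw [hp]; ring
  have hkη : (6 : ℝ) ≤ k * η := by nlinarith
  have hpb : 0 ≤ p * b₂ := by positivity
  have hu : (Y : ℝ) + b₂ * W ≤ 102 * (p * b₂) := by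
    have f1 : (b₂ : ℝ) * W ≤ b₂ * (100 * p) := mul_le_mul_of_nonneg_left z2' hb0
    have f2 : b₂ * 450000 ≤ b₂ * p := mul_le_mul_of_nonneg_left hp0 hb0
    linarith
  have hu0 : 0 ≤ (Y : ℝ) + b₂ * W := by positivity
  have hkp : 6 * 450000 ≤ k * η * p := by nlinarith
  have hkp' : 6 * 450000 * (p * b₂) ≤ k * η * p * (p * b₂) :=
    mul_le_mul_of_nonneg_right hkp hpb
  have hX2 : (X : ℝ) ≤ k * η * p * (p * b₂) := by
    have f1 : (450000 : ℝ) ≤ b₂ := by nlinarith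
    have f2 : 450000 * 450000 ≤ p * b₂ := mul_le_mul hp0 f1 (by norm_num) (by linarith)
    have f3 : k * η * p * 101 ≤ k * η * p * (p * b₂) :=
      mul_le_mul_of_nonneg_left (by linarith) (by linarith)
    linarith
  have hbW : (b₁ : ℝ) * W ≤ 200 * (p * b₂) := by
    have := mul_le_mul hb₁ z2' z1' (by linarith)
    linarith
  have hbW0 : 0 ≤ (b₁ : ℝ) * W := by positivity
  have hSu : (k : ℝ) * η * (2500000 * k ^ 2 * ℓ) * (Y + b₂ * W) ≤
      5100 * (k * η * p * (p * b₂)) := by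
    rw [hS]
    have := mul_le_mul_of_nonneg_left hu (show 0 ≤ 50 * (k * η * p) by linarith)
    linarith
  have hSu0 : 0 ≤ (k : ℝ) * η * (2500000 * k ^ 2 * ℓ) * (Y + b₂ * W) := by positivity
  constructor
  · rw [abs_le]
    constructor <;> linarith
  · rw [abs_of_nonneg hu0]
    linarith

/-- The approximate logarithm of an exponential point. -/
lemma abs_approx_le (h : Admissible k e c η ℓ b₁ b₂ α H) {Λ : ℝ}
    (hΛ : |Λ| ≤ Real.exp (-(8e9 * (k : ℝ) ^ 4 * η * ℓ ^ 2))) {g : ℤ × ℤ × ℤ}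
    (hg : g ∈ box (101 * k * η * (50000 * k ^ 2 * ℓ)) (101 * η * (50000 * k ^ 2 * ℓ))
      (100 * (50000 * k ^ 2 * ℓ))) {w₀ : ℝ}
    (hw₀ : wHom (Real.log α) (Real.log (1 + √2)) (Real.log (formCoeff k e c α)) g -
      g.2.2 * Λ = w₀) :
    |w₀| ≤ 0.7 * (101 * k * η * (50000 * k ^ 2 * ℓ)) + 0.9 * (101 * η * (50000 * k ^ 2 * ℓ)) +
      η * (100 * (50000 * k ^ 2 * ℓ)) + 1 ∧
    ∀ (t : ℕ), t ≤ 24 * k * ℓ → ∀ Z, |w₀| ≤ Z → ∀ G : ℕ,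
      2 * G ≤ (120 * k * η * (2500000 * k ^ 2 * ℓ)) * (24 * k * ℓ) →
      |Real.exp (t * wHom (Real.log α) (Real.log (1 + √2)) (Real.log (formCoeff k e c α)) g) -
        Real.exp (t * w₀)| * Real.exp 2 ^ G ≤ Real.exp (Real.exp 2 * ((24 * k * ℓ : ℕ) * Z)) := by
  obtain ⟨hk, hη, hℓ, hb₁, hb⟩ := h.real_bounds
  rw [mem_box] at hg
  obtain ⟨⟨x1, x2⟩, ⟨y1, y2⟩, z1, z2⟩ := hg
  have hx0 := h.log_pos
  have hx1 := h.log_lt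
  have hy0 := log_sqrt_pos
  have hy1 := log_one_add_sqrt_two_lt
  have hz := h.log_le
  generalize hw : wHom (Real.log α) (Real.log (1 + √2)) (Real.log (formCoeff k e c α)) g = w at *
  rw [wHom_apply] at hw
  generalize hX : g.1 = X at *
  generalize hY : g.2.1 = Y at *
  generalize hZ : g.2.2 = W at *
  generalize Real.log α = x at *
  generalize Real.log (1 + √2) = y at *
  generalize Real.log (formCoeff k e c α) = z at *
  have x1' : (0 : ℝ) ≤ X := by exact_mod_cast x1
  have y1' : (0 : ℝ) ≤ Y := by exact_mod_cast y1
  have z1' : (0 : ℝ) ≤ W := by exact_mod_cast z1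
  have x2' : (X : ℝ) ≤ 101 * k * η * (50000 * k ^ 2 * ℓ) := by exact_mod_cast x2.le
  have y2' : (Y : ℝ) ≤ 101 * η * (50000 * k ^ 2 * ℓ) := by exact_mod_cast y2.le
  have z2' : (W : ℝ) ≤ 100 * (50000 * k ^ 2 * ℓ) := by exact_mod_cast z2.le
  set M : ℝ := (k : ℝ) ^ 4 * η * ℓ ^ 2 with hM
  have hΛ' : |Λ| ≤ Real.exp (-(8e9 * M)) := by rw [hM]; convert hΛ using 3; ring
  have hTR : (24 * k * ℓ : ℝ) * (100 * (50000 * k ^ 2 * ℓ)) ≤ 4e7 * M := by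
    have e1 : (24 * k * ℓ : ℝ) * (100 * (50000 * k ^ 2 * ℓ)) = 1.2e8 * ((k : ℝ) ^ 3 * ℓ ^ 2) := by
      ring
    have e2 : M = (k * η) * ((k : ℝ) ^ 3 * ℓ ^ 2) := by rw [hM]; ring
    have e3 : (6 : ℝ) ≤ k * η := by nlinarith
    have e4 : 6 * ((k : ℝ) ^ 3 * ℓ ^ 2) ≤ M := by
      rw [e2]; exact mul_le_mul_of_nonneg_right e3 (by positivity)
    rw [e1]; nlinarith
  have hM0 : 0 < M := by positivity
  have hexp : 8e7 * M * Real.exp (-(8e9 * M)) * Real.exp (7.2e9 * M) ≤ 1 := by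
    rw [mul_assoc, ← Real.exp_add]
    have := Real.add_one_le_exp (8e8 * M)
    have e1 : Real.exp (-(8e9 * M) + 7.2e9 * M) * Real.exp (8e8 * M) = 1 := by
      rw [← Real.exp_add, ← Real.exp_zero]; ring_nf
    rw [← e1, mul_comm]
    exact mul_le_mul_of_nonneg_left (by linarith) (Real.exp_pos _).le
  have hone : 1 ≤ Real.exp (7.2e9 * M) := Real.one_le_exp (by positivity)
  have hexp' : 8e7 * M * Real.exp (-(8e9 * M)) ≤ 1 :=
    le_trans (le_mul_of_one_le_right (by positivity) hone) hexp
  have hTWΛ : ∀ t : ℕ, t ≤ 24 * k * ℓ →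
      |t * (W * Λ)| ≤ 4e7 * M * Real.exp (-(8e9 * M)) := by
    intro t ht
    have ht' : (t : ℝ) ≤ 24 * k * ℓ := by exact_mod_cast ht
    rw [← mul_assoc, abs_mul, abs_of_nonneg (by positivity)]
    refine mul_le_mul ((mul_le_mul ht' z2' z1' (by positivity)).trans hTR) hΛ' (abs_nonneg _)
      (by positivity)
  refine ⟨?_, ?_⟩
  · have h1 := hTWΛ 1 (by nlinarith [h.three_le, h.pos])
    rw [Nat.cast_one, one_mul] at h1
    have h2 : |W * Λ| ≤ 1 := by linarith
    have h3 : |w| ≤ 0.7 * (101 * k * η * (50000 * k ^ 2 * ℓ)) +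
        0.9 * (101 * η * (50000 * k ^ 2 * ℓ)) + η * (100 * (50000 * k ^ 2 * ℓ)) := by
      rw [← hw]
      refine (abs_add_three _ _ _).trans ?_
      rw [abs_mul, abs_mul, abs_mul, abs_of_nonneg x1', abs_of_nonneg y1', abs_of_nonneg z1',
        abs_of_pos hx0, abs_of_pos hy0]
      have g1 := mul_le_mul x2' hx1.le hx0.le (by positivity)
      have g2 := mul_le_mul y2' hy1.le hy0.le (by positivity)
      have g3 := mul_le_mul z2' hz (abs_nonneg _) (by positivity)
      linarith
    rw [← hw₀]
    exact (abs_sub _ _).trans (add_le_add h3 h2)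
  · intro t ht Z hZ G hG
    have h1 := hTWΛ t ht
    have h2 : |(t : ℝ) * (W * Λ)| ≤ 1 := by linarith
    have h3 : Real.exp (t * w) - Real.exp (t * w₀) =
        Real.exp (t * w₀) * (Real.exp (t * (W * Λ)) - 1) := by
      rw [mul_sub, ← Real.exp_add, mul_one, ← hw₀]
      ring_nf
    have h4 := Real.abs_exp_sub_one_le h2
    have ht' : (t : ℝ) ≤ (24 * k * ℓ : ℕ) := by exact_mod_cast ht
    have h5 : Real.exp 2 ^ G ≤ Real.exp (7.2e9 * M) := by
      rw [← Real.exp_nat_mul]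
      refine Real.exp_le_exp.2 ?_
      have : (2 : ℝ) * G ≤ (120 * k * η * (2500000 * k ^ 2 * ℓ)) * (24 * k * ℓ) := by
        exact_mod_cast hG
      rw [hM]
      linarith
    rw [h3, abs_mul, Real.abs_exp]
    have hZ0 : 0 ≤ Z := (abs_nonneg _).trans hZ
    have h6 : Real.exp (t * w₀) ≤ Real.exp (Real.exp 2 * ((24 * k * ℓ : ℕ) * Z)) := by
      refine Real.exp_le_exp.2 ?_
      have g1 : (t : ℝ) * w₀ ≤ (24 * k * ℓ : ℕ) * Z :=
        (mul_le_mul_of_nonneg_left ((le_abs_self _).trans hZ) (by positivity)).trans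
          (mul_le_mul_of_nonneg_right ht' hZ0)
      have g2 : 1 ≤ Real.exp 2 := Real.one_le_exp (by norm_num)
      exact g1.trans (le_mul_of_one_le_left (by positivity) g2)
    have h7 : |Real.exp (t * (W * Λ)) - 1| * Real.exp 2 ^ G ≤ 1 := by
      refine le_trans (mul_le_mul h4 h5 (by positivity) (by positivity)) (le_trans ?_ hexp)
      refine mul_le_mul_of_nonneg_right ?_ (Real.exp_pos _).le
      linarith
    rw [mul_assoc]
    calc _ ≤ Real.exp (t * w₀) * 1 := mul_le_mul_of_nonneg_left h7 (Real.exp_pos _).le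
      _ ≤ _ := by rw [mul_one]; exact h6

end Admissible

section

open scoped Pointwise

namespace Admissible

variable {k e c η ℓ b₁ b₂ : ℕ} {α H : ℝ}

lemma sum_range_sub_mul_two (G : ℕ) : 2 * ∑ c ∈ Finset.range G, (G - c) = G * (G + 1) := by
  rw [Finset.sum_congr rfl fun c hc => show G - c = (G - 1 - c) + 1 by
    have := Finset.mem_range.1 hc; omega, Finset.sum_add_distrib, Finset.sum_range_reflect
    (fun i => i) G, mul_add, mul_comm 2, Finset.sum_range_id_mul_two]
  cases G with
  | zero => simp
  | succ n => simp; ring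

lemma card_le_exp (h : Admissible k e c η ℓ b₁ b₂ α H) {N : ℕ}
    (hN : N ≤ (120 * k * η * (2500000 * k ^ 2 * ℓ)) ^ 2 * (24 * k * ℓ)) :
    (N : ℝ) ≤ Real.exp ℓ := by
  refine le_trans ?_ h.le_exp
  have h1 : (N : ℝ) ≤ (120 * k * η * (2500000 * k ^ 2 * ℓ)) ^ 2 * (24 * k * ℓ) := by
    exact_mod_cast hN
  refine h1.trans ?_
  have h2 : (0 : ℝ) ≤ (k : ℝ) ^ 7 * η ^ 2 * ℓ ^ 3 := by positivity
  nlinarith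

/-- The interpolation determinant does not vanish identically if the points are generic. -/
theorem exists_det_ne_zero_of_generic (h : Admissible k e c η ℓ b₁ b₂ α H)
    {p K T S : ℕ} (hp : p = 50000 * k ^ 2 * ℓ)
    (hK : K = 120 * k * η * (2500000 * k ^ 2 * ℓ)) (hT : T = 24 * k * ℓ)
    (hS : S = k * η * (2500000 * k ^ 2 * ℓ))
    (hC : ∀ f : ℝ × ℝ →ₗ[ℝ] ℝ, f ≠ 0 → 2 * (120 * k * η * (2500000 * k ^ 2 * ℓ)) ≤
      ((box (k * η * (2500000 * k ^ 2 * ℓ)) (η * (2500000 * k ^ 2 * ℓ))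
        (2500000 * k ^ 2 * ℓ)).image fun g =>
          f (vHom (k * η * (2500000 * k ^ 2 * ℓ) : ℕ) b₁ b₂ g, uHom b₂ g)).card) :
    ∃ P : Fin K × Fin K × Fin T → box (101 * k * η * (50000 * k ^ 2 * ℓ)) (101 * η * (50000 * k ^ 2 * ℓ))
    (100 * (50000 * k ^ 2 * ℓ)),
      (Matrix.of fun j i => vHom S b₁ b₂ (P i) ^ (j.1 : ℕ) * uHom b₂ (P i) ^ (j.2.1 : ℕ) *
        Real.exp ((j.2.2 : ℕ) * wHom (Real.log α) (Real.log (1 + √2))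
          (Real.log (formCoeff k e c α)) (P i))).det ≠ 0 := by
  obtain ⟨hk, hη, hℓ, hb₁, hb⟩ := h.real_bounds
  have hk3 := h.three_le
  have hη2 := h.two_le
  have hℓ1 := h.pos
  set x := Real.log α with hx
  set y := Real.log (1 + √2) with hy
  set z := Real.log (formCoeff k e c α) with hz
  set R := box (101 * k * η * (50000 * k ^ 2 * ℓ)) (101 * η * (50000 * k ^ 2 * ℓ))
    (100 * (50000 * k ^ 2 * ℓ)) with hR
  set E₁ := box (k * η * (2500000 * k ^ 2 * ℓ)) (η * (2500000 * k ^ 2 * ℓ))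
    (2500000 * k ^ 2 * ℓ) with hE₁
  set E₂ := box (k * η * p) (η * p) 1 with hE₂
  have hq : 2500000 * k ^ 2 * ℓ = 50 * p := by rw [hp]; ring
  have hp1 : 450000 ≤ p := by
    rw [hp]
    have : 9 ≤ k ^ 2 := by nlinarith
    nlinarith
  have hηp : 0 < η * p := by positivity
  have hkηp : 0 < k * η * p := by positivity
  have hsum : ∀ g₁ ∈ E₁, ∀ g₂ ∈ E₂, ∀ g₃ ∈ E₁, g₁ + g₂ + g₃ ∈ R := by
    intro g₁ h₁ g₂ h₂ g₃ h₃
    rw [hE₁, mem_box, hq] at h₁ h₃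
    rw [hE₂, mem_box] at h₂
    rw [hR, mem_box, ← hp]
    simp only [Prod.fst_add, Prod.snd_add]
    push_cast at *
    obtain ⟨⟨a1, a2⟩, ⟨a3, a4⟩, a5, a6⟩ := h₁
    obtain ⟨⟨c1, c2⟩, ⟨c3, c4⟩, c5, c6⟩ := h₂
    obtain ⟨⟨d1, d2⟩, ⟨d3, d4⟩, d5, d6⟩ := h₃
    refine ⟨⟨by linarith, by linarith⟩, ⟨by linarith, by linarith⟩, by linarith, by linarith⟩
  refine exists_det_eval_ne_zero
    (fun (j : Fin K × Fin K × Fin T) (g : R) => vHom S b₁ b₂ g ^ (j.1 : ℕ) *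
      uHom b₂ g ^ (j.2.1 : ℕ) * Real.exp ((j.2.2 : ℕ) * wHom x y z g)) (by
    intro c' hc'
    obtain ⟨Q, hQ0, hQ1, hQ2, hQ3, hQ⟩ := exists_polynomial_of_coeffs
      (fun j : Fin K × Fin K × Fin T => (j.1 : ℕ)) (fun j => (j.2.1 : ℕ)) (fun j => (j.2.2 : ℕ))
      (fun i j e₁ e₂ e₃ => Prod.ext (Fin.ext e₁) (Prod.ext (Fin.ext e₂) (Fin.ext e₃))) c'
    refine hQ0 ?_
    by_contra hQne
    have hK0 : 0 < K := by rw [hK]; positivity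
    have hT0 : 0 < T := by rw [hT]; positivity
    have hvinj : Set.InjOn (vHom S b₁ b₂) E₁ := by
      rw [hS, hE₁]
      refine vHom_injOn_box ?_ h.le_two_mul h.large
      rw [hq]; nlinarith
    refine zero_estimate (vHom S b₁ b₂) (uHom b₂) (wHom x y z) hQne (hQ1 K hK0 fun j => j.1.2)
      (hQ2 K hK0 fun j => j.2.1.2) (hQ3 T hT0 fun j => j.2.2.2) E₁ E₂ E₁ ?_ ?_ hvinj ?_ ?_ ?_ ?_ ?_
      ?_
    · rw [hE₁, mem_box, hq]
      exact ⟨⟨le_rfl, Int.natCast_pos.2 (by positivity)⟩, ⟨le_rfl, Int.natCast_pos.2 (by positivity)⟩,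
        le_rfl, Int.natCast_pos.2 (by positivity)⟩
    · rw [hE₂, mem_box]
      exact ⟨⟨le_rfl, Int.natCast_pos.2 hkηp⟩, ⟨le_rfl, Int.natCast_pos.2 hηp⟩, le_rfl,
        Int.natCast_pos.2 one_pos⟩
    · rw [hS, hK]; exact hC
    · have hsub : (Finset.Ico (0 : ℤ) S).image (fun s => wHom x y z (s, 0, 0)) ⊆
          E₁.image (wHom x y z) := by
        intro r hr
        obtain ⟨s, hs, rfl⟩ := Finset.mem_image.1 hr
        refine Finset.mem_image_of_mem _ ?_
        rw [Finset.mem_Ico] at hs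
        rw [hE₁, mem_box, ← hS, hq]
        refine ⟨hs, ?_, ?_⟩ <;> simp <;> positivity
      refine le_trans ?_ (Finset.card_le_card hsub)
      rw [Finset.card_image_of_injective]
      · simp only [Int.card_Ico, sub_zero, Int.toNat_natCast]
        rw [hT, hS]
        have : 24 * k * ℓ ≤ k * η * (2500000 * k ^ 2 * ℓ) := by
          have e1 : 24 ≤ η * (2500000 * k ^ 2) := by nlinarith
          calc 24 * k * ℓ ≤ (η * (2500000 * k ^ 2)) * k * ℓ := by gcongr
            _ = _ := by ring
        exact this
      · intro s s' hss
        have := eq_of_wHom_eq h.log_pos log_sqrt_pos h.mul_log_ne hss rfl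
        exact (Prod.mk.inj this).1
    · intro g hg g' hg' hgg
      rw [Finset.mem_coe, hE₂, mem_box] at hg hg'
      exact eq_of_wHom_eq h.log_pos log_sqrt_pos h.mul_log_ne hgg (by omega)
    · rw [hE₂, card_box, hK, hT, hq, mul_one]
      have e1 : 6 ≤ k * η := by nlinarith
      have e2 : 2 * (120 * k * η * (50 * p)) * (24 * k * ℓ) = 288000 * (k ^ 2 * ℓ) * (η * p) * 1 := by
        ring
      have e3 : k * η * p * (η * p) = (k * η) * 50000 * (k ^ 2 * ℓ) * (η * p) := by
        nth_rewrite 1 [hp]; ring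
      rw [e2, e3]
      have e4 : 0 < (k ^ 2 * ℓ) * (η * p) := by positivity
      nlinarith
    · rw [hE₁, card_box, hK, hT]
      have e0 : 0 < k ^ 4 * η ^ 2 * (2500000 * k ^ 2 * ℓ) := by positivity
      set q := 2500000 * k ^ 2 * ℓ with hqdef
      have e1 : k * η * q * (η * q * q) = k * η ^ 2 * q ^ 2 * (2500000 * k ^ 2 * ℓ) := by
        rw [← hqdef]; ring
      rw [e1]
      have e2 : 6 * (120 * k * η * q) ^ 2 * (24 * k * ℓ) = 2073600 * (k ^ 3 * η ^ 2 * q ^ 2 * ℓ) := by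
        ring
      have e3 : 2 * (120 * k * η * q) * (24 * k * ℓ) ≤ 5760 * (k ^ 3 * η ^ 2 * q ^ 2 * ℓ) := by
        calc _ = 5760 * (k ^ 2 * η * q * ℓ) := by ring
          _ ≤ 5760 * (k ^ 2 * η * q * ℓ * (k * η * q)) :=
            Nat.mul_le_mul_left _ (Nat.le_mul_of_pos_right _ (by positivity))
          _ = _ := by ring
      have e4 : 2 * (120 * k * η * q) ^ 2 ≤ 28800 * (k ^ 3 * η ^ 2 * q ^ 2 * ℓ) := by
        calc _ = 28800 * (k ^ 2 * η ^ 2 * q ^ 2) := by ring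
          _ ≤ 28800 * (k ^ 2 * η ^ 2 * q ^ 2 * (k * ℓ)) :=
            Nat.mul_le_mul_left _ (Nat.le_mul_of_pos_right _ (by positivity))
          _ = _ := by ring
      have e5 : k * η ^ 2 * q ^ 2 * (2500000 * k ^ 2 * ℓ) = 2500000 * (k ^ 3 * η ^ 2 * q ^ 2 * ℓ) := by
        ring
      have e6 : 0 < k ^ 3 * η ^ 2 * q ^ 2 * ℓ := by positivity
      rw [e2, e5]
      omega
    · intro g₁ h₁ g₂ h₂ g₃ h₃
      rw [pt, hQ, ← hc' ⟨_, hsum g₁ h₁ g₂ h₂ g₃ h₃⟩])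

set_option maxHeartbeats 1000000 in
/-- No small value of the linear form if the points are generic. -/
theorem false_of_generic (h : Admissible k e c η ℓ b₁ b₂ α H)
    (hΛ : |b₁ * Real.log α - b₂ * Real.log (1 + √2) + Real.log (formCoeff k e c α)| ≤
      Real.exp (-(8e9 * (k : ℝ) ^ 4 * η * ℓ ^ 2))) {p : ℕ} (hp : p = 50000 * k ^ 2 * ℓ)
    (hC : ∀ f : ℝ × ℝ →ₗ[ℝ] ℝ, f ≠ 0 → 2 * (120 * k * η * (2500000 * k ^ 2 * ℓ)) ≤
      ((box (k * η * (2500000 * k ^ 2 * ℓ)) (η * (2500000 * k ^ 2 * ℓ))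
        (2500000 * k ^ 2 * ℓ)).image fun g =>
          f (vHom (k * η * (2500000 * k ^ 2 * ℓ) : ℕ) b₁ b₂ g, uHom b₂ g)).card) : False := by
  obtain ⟨hk, hη, hℓ, hb₁, hb⟩ := h.real_bounds
  have hk3 := h.three_le
  have hη2 := h.two_le
  have hℓ1 := h.pos
  obtain ⟨K, hK⟩ : ∃ K, K = 120 * k * η * (2500000 * k ^ 2 * ℓ) := ⟨_, rfl⟩
  obtain ⟨T, hT⟩ : ∃ T, T = 24 * k * ℓ := ⟨_, rfl⟩
  obtain ⟨S, hS⟩ : ∃ S, S = k * η * (2500000 * k ^ 2 * ℓ) := ⟨_, rfl⟩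
  set x := Real.log α with hx
  set y := Real.log (1 + √2) with hy
  set z := Real.log (formCoeff k e c α) with hz
  set Λ := b₁ * x - b₂ * y + z with hΛdef
  have hq : 2500000 * k ^ 2 * ℓ = 50 * p := by rw [hp]; ring
  have hp1 : 450000 ≤ p := by
    rw [hp]
    have : 9 ≤ k ^ 2 := by nlinarith
    nlinarith
  have hkηp : 0 < k * η * p := by positivity
  obtain ⟨P, hdet⟩ := h.exists_det_ne_zero_of_generic hp hK hT hS hC
  obtain ⟨Z, hZ⟩ : ∃ Z : ℝ, Z = 0.7 * (101 * k * η * (50000 * k ^ 2 * ℓ)) +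
    0.9 * (101 * η * (50000 * k ^ 2 * ℓ)) + η * (100 * (50000 * k ^ 2 * ℓ)) + 1 := ⟨_, rfl⟩
  have hZ0 : 0 ≤ Z := by rw [hZ]; positivity
  set w₀ : Fin K × Fin K × Fin T → ℝ := fun i => wHom x y z (P i) - (P i : ℤ × ℤ × ℤ).2.2 * Λ
    with hw₀
  have hZw : ∀ i, |w₀ i| ≤ Z := fun i => by
    rw [hZ]; exact (h.abs_approx_le hΛ (P i).2 rfl).1
  obtain ⟨G, hG⟩ : ∃ G, 2 * G = K * T := ⟨60 * k * η * (2500000 * k ^ 2 * ℓ) * T, by rw [hK]; ring⟩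
  have hκ : 24 * (k * η * p) ≤ S * x - y := by
    have e1 := h.log_gt
    have e2 := log_one_add_sqrt_two_lt
    have e3 : (S : ℝ) = 50 * (k * η * p) := by rw [hS, hq]; push_cast; ring
    have e4 : (1 : ℝ) ≤ k * η * p := by exact_mod_cast hkηp
    rw [e3]
    nlinarith
  have hkηp' : (1 : ℝ) ≤ k * η * p := by exact_mod_cast hkηp
  have hκ0 : 0 < S * x - y := by linarith
  have hVbig : (1000 : ℝ) ≤ Real.exp ℓ := by
    refine le_trans ?_ h.le_exp
    have e1 : (1 : ℝ) ≤ (k : ℝ) ^ 7 := one_le_pow₀ (by linarith)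
    have e2 : (1 : ℝ) ≤ (η : ℝ) ^ 2 := one_le_pow₀ (by linarith)
    have e3 : (1 : ℝ) ≤ (ℓ : ℝ) ^ 3 := one_le_pow₀ (by linarith)
    have e4 : (1 : ℝ) ≤ (k : ℝ) ^ 7 * η ^ 2 * ℓ ^ 3 :=
      one_le_mul_of_one_le_of_one_le (one_le_mul_of_one_le_of_one_le e1 e2) e3
    linarith
  have hup := abs_det_monomials_mul_pow_le (Matrix.of fun j i => vHom S b₁ b₂ (P i) ^ (j.1 : ℕ) *
      uHom b₂ (P i) ^ (j.2.1 : ℕ) * Real.exp ((j.2.2 : ℕ) * wHom x y z (P i)))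
    (fun i => vHom S b₁ b₂ (P i)) (fun i => uHom b₂ (P i)) w₀ (c₁ := -1 / (S * x - y))
    (c₂ := x / (S * x - y)) (V := Real.exp ℓ) (Z := Z) (E := Real.exp 2) (by
      intro i
      have := wHom_sub S b₁ b₂ x y z (P i)
      have e1 : w₀ i = (vHom S b₁ b₂ (P i) - S * uHom b₂ (P i)) * x + uHom b₂ (P i) * y := by
        rw [hw₀, ← Int.cast_natCast (R := ℝ) S, ← this, hΛdef]
        push_cast
        rfl
      rw [e1]
      field_simp
      ring)
    (fun j i => vHom S b₁ b₂ (P i) ^ (j.1 : ℕ) * uHom b₂ (P i) ^ (j.2.1 : ℕ) *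
      (Real.exp ((j.2.2 : ℕ) * wHom x y z (P i)) - Real.exp ((j.2.2 : ℕ) * w₀ i)))
    (by intro j i; rw [Matrix.of_apply]; ring)
    (Real.one_le_exp (by norm_num)) (Real.one_le_exp (by positivity))
    (fun i => by have := (h.abs_hom_le (P i).2).1; rwa [← hS] at this) hZw hZ0 (by
      have e0 : x < 0.7 := h.log_lt
      have e0' : 0 < x := h.log_pos
      rw [abs_div, abs_div, abs_neg, abs_one, abs_of_pos hκ0, abs_of_pos e0']
      have e1 : Z ≤ 262 * (k * η * p) := by
        have e2 : (1 : ℝ) * (η * p) ≤ k * (η * p) := by gcongr; linarith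
        have e3 : Z = 70.7 * (k * η * p) + 190.9 * (η * p) + 1 := by
          rw [hZ, hp]; push_cast; ring
        have e5 : (2 : ℝ) * p ≤ η * p := by gcongr
        have e6 : (3 : ℝ) * (η * p) ≤ k * (η * p) := by gcongr
        rw [e3]
        linarith
      have e2 := exp_two_lt
      have e3 : 1 / (S * x - y) * (Real.exp 2 * Z) ≤ 100 := by
        rw [one_div, inv_mul_le_iff₀ hκ0]
        have := mul_le_mul e2.le e1 hZ0 (by norm_num)
        linarith
      have e4 : x / (S * x - y) ≤ 1 / 2 := by
        rw [div_le_iff₀ hκ0]; linarith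
      have e5 := mul_le_mul_of_nonneg_right e4 (Real.exp_pos ℓ).le
      linarith) G (by
      intro j i
      have e1 : |vHom S b₁ b₂ (P i)| ≤ Real.exp ℓ := by
        have := (h.abs_hom_le (P i).2).1; rwa [← hS] at this
      have e2 := (h.abs_hom_le (P i).2).2
      have e3 := (h.abs_approx_le hΛ (P i).2 rfl).2 (j.2.2 : ℕ) (by rw [← hT]; exact j.2.2.2.le)
        Z (hZw i) G (by rw [← hT, ← hK]; exact hG.le)
      rw [← hT] at e3
      rw [abs_mul, abs_mul, abs_pow, abs_pow, mul_assoc]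
      refine mul_le_mul ?_ e3 (by positivity) (by positivity)
      calc _ ≤ Real.exp ℓ ^ (j.1 : ℕ) * Real.exp ℓ ^ (j.2.1 : ℕ) := by gcongr
        _ = Real.exp ℓ ^ ((j.1 : ℕ) + j.2.1) := (pow_add _ _ _).symm
        _ ≤ _ := pow_le_pow_right₀ (by linarith) (by have := j.1.2; have := j.2.1.2; omega))
  have hK0 : 0 < K := by rw [hK]; positivity
  have hT0 : 0 < T := by rw [hT]; positivity
  have : NeZero K := ⟨hK0.ne'⟩
  have : NeZero T := ⟨hT0.ne'⟩
  have hcard : Fintype.card (Fin K × Fin K × Fin T) = K ^ 2 * T := by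
    simp; ring
  have hV2K : Real.exp ℓ ^ (2 * K) = Real.exp (2 * (K : ℕ) * ℓ) := by
    rw [← Real.exp_nat_mul]; push_cast; rfl
  refine h.false_of_det (J := Fin K × Fin K × Fin T) (fun j => j.2.2)
    (fun j => by rw [← hT]; exact j.2.2.2.le)
    (fun j i => ((P i : ℤ × ℤ × ℤ).1 - b₁ * (P i : ℤ × ℤ × ℤ).2.2 +
      S * ((P i : ℤ × ℤ × ℤ).2.1 + b₂ * (P i : ℤ × ℤ × ℤ).2.2)) ^ (j.1 : ℕ) *
      ((P i : ℤ × ℤ × ℤ).2.1 + b₂ * (P i : ℤ × ℤ × ℤ).2.2) ^ (j.2.1 : ℕ)) ?_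
    (fun i => P i) (fun i => (P i).2) _ ?_ hdet (h.card_le_exp ?_) hZ0 hZ.le
    (G := G) (S := 2 * K * ∑ c ∈ Finset.range G, (G - c)) ?_ ?_
  · intro j i
    rw [← hK, ← hV2K]
    push_cast
    have e1 : |vHom S b₁ b₂ (P i)| ≤ Real.exp ℓ := by
      have := (h.abs_hom_le (P i).2).1; rwa [← hS] at this
    have e2 := (h.abs_hom_le (P i).2).2
    rw [vHom_apply] at e1
    rw [uHom_apply] at e2
    push_cast at e1 e2
    rw [abs_mul, abs_pow, abs_pow]
    calc _ ≤ Real.exp ℓ ^ (j.1 : ℕ) * Real.exp ℓ ^ (j.2.1 : ℕ) := by gcongr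
      _ = Real.exp ℓ ^ ((j.1 : ℕ) + j.2.1) := (pow_add _ _ _).symm
      _ ≤ _ := pow_le_pow_right₀ (by linarith) (by have := j.1.2; have := j.2.1.2; omega)
  · intro j i
    rw [Matrix.of_apply, vHom_apply, uHom_apply]
    push_cast
    rfl
  · rw [hcard, hK, hT]
  · rw [← hK, ← hT, hcard]
    have e1 := sum_range_sub_mul_two G
    have e2 : 4 * (2 * K * ∑ c ∈ Finset.range G, (G - c)) = 4 * K * (G * (G + 1)) := by
      rw [← e1]; ring
    rw [e2]
    have e3 : 4 * K * (G * (G + 1)) = K * ((2 * G) * (2 * G + 2)) := by ring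
    have e4 : 4 * (K ^ 2 * T * G) = 2 * (K ^ 2 * T * (2 * G)) := by ring
    rw [e3, e4, hG]
    ring
  · rw [← hK, ← hT, ← hV2K]
    exact hup

end Admissible

end

section

open scoped Pointwise

namespace Admissible

variable {k e c η ℓ b₁ b₂ : ℕ} {α H : ℝ}

/-- If the points are not generic, then there is a nonvanishing interpolation determinant of
points on a line. -/
theorem exists_det_ne_zero_of_degenerate (h : Admissible k e c η ℓ b₁ b₂ α H)
    {K T S : ℕ} (hK : 2 * K = 120 * k * η * (2500000 * k ^ 2 * ℓ)) (hT : T = 24 * k * ℓ)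
    (hS : S = k * η * (2500000 * k ^ 2 * ℓ)) {f : ℝ × ℝ →ₗ[ℝ] ℝ} (hf : f ≠ 0)
    (hC : ((box (k * η * (2500000 * k ^ 2 * ℓ)) (η * (2500000 * k ^ 2 * ℓ))
        (2500000 * k ^ 2 * ℓ)).image fun g => f (vHom S b₁ b₂ g, uHom b₂ g)).card <
          2 * (120 * k * η * (2500000 * k ^ 2 * ℓ))) :
    ∃ P : Fin K × Fin T → box (101 * k * η * (50000 * k ^ 2 * ℓ)) (101 * η * (50000 * k ^ 2 * ℓ))
      (100 * (50000 * k ^ 2 * ℓ)), ∃ r s : ℝ, (∀ i, uHom b₂ (P i) = r + s * vHom S b₁ b₂ (P i)) ∧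
      (Matrix.of fun j i => vHom S b₁ b₂ (P i) ^ (j.1 : ℕ) *
        Real.exp ((j.2 : ℕ) * wHom (Real.log α) (Real.log (1 + √2))
          (Real.log (formCoeff k e c α)) (P i))).det ≠ 0 := by
  have hk3 := h.three_le
  have hη2 := h.two_le
  have hℓ1 := h.pos
  set x := Real.log α with hx
  set y := Real.log (1 + √2) with hy
  set z := Real.log (formCoeff k e c α) with hz
  obtain ⟨q, hq⟩ : ∃ q, q = 2500000 * k ^ 2 * ℓ := ⟨_, rfl⟩
  rw [← hq] at hC hS hK
  set E := box (k * η * q) (η * q) q with hE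
  have hq0 : 2500000 ≤ q := by
    rw [hq]
    have : 1 ≤ k ^ 2 := Nat.one_le_pow _ _ (by omega)
    nlinarith
  have hK60 : K = 60 * (k * η * q) := by linarith
  have hK0 : 0 < K := by rw [hK60]; positivity
  have hT0 : 0 < T := by rw [hT]; positivity
  have hvinj : Set.InjOn (vHom S b₁ b₂) E := by
    rw [hS, hE]
    refine vHom_injOn_box ?_ h.le_two_mul ?_
    · have : 0 < k * η := by positivity
      nlinarith
    · have := h.large
      rwa [← hq] at this
  -- a popular fibre
  have hcount : (E.image fun g => f (vHom S b₁ b₂ g, uHom b₂ g)).card * (2 * K * T + 1) ≤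
      E.card := by
    refine (Nat.mul_le_mul_right _ hC.le).trans ?_
    rw [hE, card_box]
    have e1 : 2 * (120 * k * η * q) * (2 * K * T + 1) =
        691200 * (k ^ 3 * η ^ 2 * q ^ 2 * ℓ) + 240 * (k * η * q) := by
      rw [hK60, hT]; ring
    have e2 : k * η * q * (η * q * q) = 2500000 * (k ^ 3 * η ^ 2 * q ^ 2 * ℓ) := by
      nth_rewrite 3 [hq]; ring
    have e3 : k * η * q ≤ k ^ 3 * η ^ 2 * q ^ 2 * ℓ := by
      calc k * η * q ≤ k * η * q * (k ^ 2 * η * q * ℓ) :=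
            Nat.le_mul_of_pos_right _ (by positivity)
        _ = _ := by ring
    rw [e1, e2]
    omega
  have hEne : E.Nonempty := by
    rw [← Finset.card_pos, hE, card_box]; positivity
  obtain ⟨d, -, hd⟩ := Finset.exists_le_card_fiber_of_mul_le_card_of_maps_to
    (fun g hg => Finset.mem_image_of_mem (fun g => f (vHom S b₁ b₂ g, uHom b₂ g)) hg)
    (hEne.image _) hcount
  set Φ := E.filter fun g => f (vHom S b₁ b₂ g, uHom b₂ g) = d with hΦ
  have hΦE : Φ ⊆ E := Finset.filter_subset _ _
  have hvΦ : Set.InjOn (vHom S b₁ b₂) Φ := hvinj.mono (Finset.coe_subset.2 hΦE)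
  have hf2 : ∀ v u : ℝ, f (v, u) = v * f (1, 0) + u * f (0, 1) := by
    intro v u
    have : ((v, u) : ℝ × ℝ) = v • (1, 0) + u • (0, 1) := by simp
    rw [this, map_add, map_smul, map_smul, smul_eq_mul, smul_eq_mul]
  have hline : ∀ g ∈ Φ, vHom S b₁ b₂ g * f (1, 0) + uHom b₂ g * f (0, 1) = d := fun g hg => by
    rw [← hf2]; exact (Finset.mem_filter.1 hg).2
  have hf01 : f (0, 1) ≠ 0 := by
    intro h0
    have h1 : f (1, 0) ≠ 0 := by
      intro h1
      refine hf (LinearMap.ext fun v => ?_)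
      rw [show v = (v.1, v.2) from rfl, hf2, h0, h1]
      simp
    obtain ⟨g, hg, g', hg', hne⟩ := Finset.one_lt_card.1 (show 1 < Φ.card by
      have : 0 < 2 * K * T := by positivity
      omega)
    refine hne (hvΦ hg hg' ?_)
    have e1 := hline g hg
    have e2 := hline g' hg'
    rw [h0, mul_zero, add_zero] at e1 e2
    exact mul_right_cancel₀ h1 (e1.trans e2.symm)
  have hsum : ∀ g ∈ Φ + Φ, g ∈ box (101 * k * η * (50000 * k ^ 2 * ℓ))
      (101 * η * (50000 * k ^ 2 * ℓ)) (100 * (50000 * k ^ 2 * ℓ)) := by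
    intro g hg
    obtain ⟨g₁, h₁, g₃, h₃, rfl⟩ := Finset.mem_add.1 hg
    have h₁' := hΦE h₁
    have h₃' := hΦE h₃
    rw [hE, mem_box] at h₁' h₃'
    rw [mem_box]
    have hp : q = 50 * (50000 * k ^ 2 * ℓ) := by rw [hq]; ring
    generalize 50000 * k ^ 2 * ℓ = p at *
    subst hp
    simp only [Prod.fst_add, Prod.snd_add]
    have hp0 : 0 ≤ ((k : ℤ) * η * p) := by positivity
    have hp1 : 0 ≤ ((η : ℤ) * p) := by positivity
    push_cast at *
    obtain ⟨⟨a1, a2⟩, ⟨a3, a4⟩, a5, a6⟩ := h₁'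
    obtain ⟨⟨d1, d2⟩, ⟨d3, d4⟩, d5, d6⟩ := h₃'
    refine ⟨⟨by linarith, by linarith⟩, ⟨by linarith, by linarith⟩, by linarith, by linarith⟩
  have hline2 : ∀ g ∈ Φ + Φ, uHom b₂ g =
      2 * d / f (0, 1) + (-f (1, 0) / f (0, 1)) * vHom S b₁ b₂ g := by
    intro g hg
    obtain ⟨g₁, h₁, g₃, h₃, rfl⟩ := Finset.mem_add.1 hg
    have e1 := hline g₁ h₁
    have e2 := hline g₃ h₃
    rw [map_add, map_add]
    field_simp
    linarith
  obtain ⟨P, hP⟩ := exists_det_eval_ne_zero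
    (fun (j : Fin K × Fin T) (g : (Φ + Φ : Finset (ℤ × ℤ × ℤ))) =>
      vHom S b₁ b₂ g ^ (j.1 : ℕ) * Real.exp ((j.2 : ℕ) * wHom x y z g)) (by
    intro c' hc'
    obtain ⟨Q, hQ0, hQ1, hQ2, hQ3, hQ⟩ := exists_polynomial_of_coeffs
      (fun j : Fin K × Fin T => (j.1 : ℕ)) (fun _ => 0) (fun j => (j.2 : ℕ))
      (fun i j e₁ _ e₃ => Prod.ext (Fin.ext e₁) (Fin.ext e₃)) c'
    refine hQ0 ?_
    by_contra hQne
    refine two_variable_zero_estimate (vHom S b₁ b₂) (uHom b₂) (wHom x y z) hQne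
      (hQ1 K hK0 fun j => j.1.2) (Nat.lt_one_iff.1 (hQ2 1 one_pos fun _ => one_pos))
      (hQ3 T hT0 fun j => j.2.2) Φ hvΦ ?_ ?_ ?_ ?_
    · refine le_trans ?_ hd
      nlinarith
    · have e1 := Finset.card_le_mul_card_image (f := wHom x y z) Φ q (by
        intro r _
        have : ({g ∈ Φ | wHom x y z g = r} : Finset _).card ≤ (Finset.Ico (0 : ℤ) q).card := by
          refine Finset.card_le_card_of_injOn (fun g => g.2.2) ?_ ?_
          · intro g hg
            have := hΦE (Finset.mem_filter.1 hg).1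
            rw [hE, mem_box] at this
            simpa using this.2.2
          · intro g hg g' hg' hgg
            exact eq_of_wHom_eq h.log_pos log_sqrt_pos h.mul_log_ne
              ((Finset.mem_filter.1 hg).2.trans (Finset.mem_filter.1 hg').2.symm) hgg
        simpa using this)
      by_contra hlt
      have e2 : q * (Φ.image (wHom x y z)).card ≤ q * T := Nat.mul_le_mul_left _ (not_le.1 hlt).le
      have e3 : q * T ≤ 2 * K * T := by
        refine Nat.mul_le_mul_right _ ?_
        rw [hK60]
        have : 1 ≤ k * η := Nat.mul_pos (by omega) (by omega)
        nlinarith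
      omega
    · omega
    · intro g hg g' hg'
      rw [pt, hQ, ← hc' ⟨g + g', Finset.add_mem_add hg hg'⟩]
      simp)
  exact ⟨fun i => ⟨P i, hsum _ (P i).2⟩, _, _, fun i => hline2 _ (P i).2, hP⟩

set_option maxHeartbeats 1000000 in
/-- No small value of the linear form if the points are not generic. -/
theorem false_of_degenerate (h : Admissible k e c η ℓ b₁ b₂ α H)
    (hΛ : |b₁ * Real.log α - b₂ * Real.log (1 + √2) + Real.log (formCoeff k e c α)| ≤
      Real.exp (-(8e9 * (k : ℝ) ^ 4 * η * ℓ ^ 2))) {f : ℝ × ℝ →ₗ[ℝ] ℝ} (hf : f ≠ 0)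
    (hC : ((box (k * η * (2500000 * k ^ 2 * ℓ)) (η * (2500000 * k ^ 2 * ℓ))
        (2500000 * k ^ 2 * ℓ)).image fun g =>
          f (vHom (k * η * (2500000 * k ^ 2 * ℓ) : ℕ) b₁ b₂ g, uHom b₂ g)).card <
          2 * (120 * k * η * (2500000 * k ^ 2 * ℓ))) : False := by
  obtain ⟨hk, hη, hℓ, hb₁, hb⟩ := h.real_bounds
  have hk3 := h.three_le
  have hη2 := h.two_le
  have hℓ1 := h.pos
  obtain ⟨K, hK⟩ : ∃ K, 2 * K = 120 * k * η * (2500000 * k ^ 2 * ℓ) :=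
    ⟨60 * k * η * (2500000 * k ^ 2 * ℓ), by ring⟩
  obtain ⟨T, hT⟩ : ∃ T, T = 24 * k * ℓ := ⟨_, rfl⟩
  obtain ⟨S, hS⟩ : ∃ S, S = k * η * (2500000 * k ^ 2 * ℓ) := ⟨_, rfl⟩
  obtain ⟨P, r, s, hrs, hdet⟩ := h.exists_det_ne_zero_of_degenerate hK hT hS hf
    (by rw [hS]; exact hC)
  have hK0 : 0 < K := by
    have : 0 < 120 * k * η * (2500000 * k ^ 2 * ℓ) := by positivity
    omega
  have hT0 : 0 < T := by rw [hT]; positivity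
  have : NeZero K := ⟨hK0.ne'⟩
  have : NeZero T := ⟨hT0.ne'⟩
  set x := Real.log α with hx
  set y := Real.log (1 + √2) with hy
  set z := Real.log (formCoeff k e c α) with hz
  set Λ := b₁ * x - b₂ * y + z with hΛdef
  obtain ⟨Z, hZ⟩ : ∃ Z : ℝ, Z = 0.7 * (101 * k * η * (50000 * k ^ 2 * ℓ)) +
    0.9 * (101 * η * (50000 * k ^ 2 * ℓ)) + η * (100 * (50000 * k ^ 2 * ℓ)) + 1 := ⟨_, rfl⟩
  have hZ0 : 0 ≤ Z := by rw [hZ]; positivity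
  set w₀ : Fin K × Fin T → ℝ := fun i => wHom x y z (P i) - (P i : ℤ × ℤ × ℤ).2.2 * Λ
    with hw₀
  have hZw : ∀ i, |w₀ i| ≤ Z := fun i => by
    rw [hZ]; exact (h.abs_approx_le hΛ (P i).2 rfl).1
  have hVbig : (1000 : ℝ) ≤ Real.exp ℓ := by
    refine le_trans ?_ h.le_exp
    have e1 : (1 : ℝ) ≤ (k : ℝ) ^ 7 := one_le_pow₀ (by linarith)
    have e2 : (1 : ℝ) ≤ (η : ℝ) ^ 2 := one_le_pow₀ (by linarith)
    have e3 : (1 : ℝ) ≤ (ℓ : ℝ) ^ 3 := one_le_pow₀ (by linarith)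
    have e4 : (1 : ℝ) ≤ (k : ℝ) ^ 7 * η ^ 2 * ℓ ^ 3 :=
      one_le_mul_of_one_le_of_one_le (one_le_mul_of_one_le_of_one_le e1 e2) e3
    linarith
  have hV2K : Real.exp ℓ ^ (2 * (2 * K)) = Real.exp (2 * (2 * K : ℕ) * ℓ) := by
    rw [← Real.exp_nat_mul]; push_cast; ring_nf
  have hvP : ∀ i, |vHom S b₁ b₂ (P i)| ≤ Real.exp ℓ := fun i => by
    have := (h.abs_hom_le (P i).2).1; rwa [← hS] at this
  have hB : (Real.exp 2 * Real.exp ℓ + Real.exp ℓ) ^ K * Real.exp (Real.exp 2 * (T * Z)) ≤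
      Real.exp (2 * (2 * K : ℕ) * ℓ) * Real.exp (Real.exp 2 * (T * Z)) := by
    refine mul_le_mul_of_nonneg_right ?_ (Real.exp_pos _).le
    have e2 := exp_two_lt
    rw [← hV2K, show 2 * (2 * K) = 2 * K + 2 * K by ring, pow_add]
    refine le_trans ?_ (le_mul_of_one_le_right (by positivity) (one_le_pow₀ (show 1 ≤ Real.exp ℓ by linarith)))
    rw [pow_mul]
    refine pow_le_pow_left₀ (by positivity) ?_ K
    have e3 := mul_le_mul_of_nonneg_right e2.le (Real.exp_pos ℓ).le
    have e4 := mul_le_mul_of_nonneg_right hVbig (Real.exp_pos ℓ).le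
    linarith [pow_two (Real.exp ℓ)]
  have hup := abs_det_monomials_line_mul_pow_le (Matrix.of fun j i =>
      vHom S b₁ b₂ (P i) ^ (j.1 : ℕ) * Real.exp ((j.2 : ℕ) * wHom x y z (P i)))
    (fun i => vHom S b₁ b₂ (P i)) w₀ (a := r * (y - S * x)) (b := x + s * (y - S * x))
    (V := Real.exp ℓ) (Z := Z) (E := Real.exp 2) (by
      intro i
      have := wHom_sub S b₁ b₂ x y z (P i)
      have e1 : w₀ i = (vHom S b₁ b₂ (P i) - S * uHom b₂ (P i)) * x + uHom b₂ (P i) * y := by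
        rw [hw₀, ← Int.cast_natCast (R := ℝ) S, ← this, hΛdef]
        push_cast
        rfl
      rw [e1, hrs]
      ring)
    (fun j i => vHom S b₁ b₂ (P i) ^ (j.1 : ℕ) *
      (Real.exp ((j.2 : ℕ) * wHom x y z (P i)) - Real.exp ((j.2 : ℕ) * w₀ i)))
    (by intro j i; rw [Matrix.of_apply]; ring)
    (Real.one_le_exp (by norm_num)) (Real.one_le_exp (by positivity)) hvP hZw hB (K * T) (by
      intro j i
      have e3 := (h.abs_approx_le hΛ (P i).2 rfl).2 (j.2 : ℕ) (by rw [← hT]; exact j.2.2.le)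
        Z (hZw i) (K * T) (by rw [← hT, ← hK, mul_assoc])
      rw [← hT] at e3
      rw [abs_mul, abs_pow, mul_assoc, ← hV2K]
      refine mul_le_mul ?_ e3 (by positivity) (by positivity)
      calc _ ≤ Real.exp ℓ ^ (j.1 : ℕ) := pow_le_pow_left₀ (abs_nonneg _) (hvP i) _
        _ ≤ _ := pow_le_pow_right₀ (by linarith) (by have := j.1.2; omega))
  have hcard : Fintype.card (Fin K × Fin T) = K * T := by simp
  refine h.false_of_det (J := Fin K × Fin T) (fun j => j.2)
    (fun j => by rw [← hT]; exact j.2.2.le)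
    (fun j i => ((P i : ℤ × ℤ × ℤ).1 - b₁ * (P i : ℤ × ℤ × ℤ).2.2 +
      S * ((P i : ℤ × ℤ × ℤ).2.1 + b₂ * (P i : ℤ × ℤ × ℤ).2.2)) ^ (j.1 : ℕ)) ?_
    (fun i => P i) (fun i => (P i).2) _ ?_ hdet (h.card_le_exp ?_) hZ0 hZ.le
    (G := K * T) (S := 1 * ∑ c ∈ Finset.range (K * T), (K * T - c)) ?_ ?_
  · intro j i
    rw [← hK, ← hV2K]
    push_cast
    have e1 := hvP i
    rw [vHom_apply] at e1
    push_cast at e1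
    rw [abs_pow]
    calc _ ≤ Real.exp ℓ ^ (j.1 : ℕ) := pow_le_pow_left₀ (abs_nonneg _) e1 _
      _ ≤ _ := pow_le_pow_right₀ (by linarith) (by have := j.1.2; omega)
  · intro j i
    rw [Matrix.of_apply, vHom_apply]
    push_cast
    rfl
  · rw [hcard, ← hK, ← hT]
    refine Nat.mul_le_mul_right _ ?_
    nlinarith
  · rw [← hK, ← hT, hcard]
    have e1 := sum_range_sub_mul_two (K * T)
    have e2 : 4 * (1 * ∑ c ∈ Finset.range (K * T), (K * T - c)) =
        2 * (K * T * (K * T + 1)) := by rw [← e1]; ring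
    rw [e2]
    ring
  · rw [← hK, ← hT]
    exact hup

/-- A lower bound for the linear form in three logarithms. -/
theorem exp_lt_abs_linear_form (h : Admissible k e c η ℓ b₁ b₂ α H) :
    Real.exp (-(8e9 * (k : ℝ) ^ 4 * η * ℓ ^ 2)) <
      |b₁ * Real.log α - b₂ * Real.log (1 + √2) + Real.log (formCoeff k e c α)| := by
  by_contra! hΛ
  by_cases hC : ∀ f : ℝ × ℝ →ₗ[ℝ] ℝ, f ≠ 0 → 2 * (120 * k * η * (2500000 * k ^ 2 * ℓ)) ≤
      ((box (k * η * (2500000 * k ^ 2 * ℓ)) (η * (2500000 * k ^ 2 * ℓ))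
        (2500000 * k ^ 2 * ℓ)).image fun g =>
          f (vHom (k * η * (2500000 * k ^ 2 * ℓ) : ℕ) b₁ b₂ g, uHom b₂ g)).card
  · exact h.false_of_generic hΛ rfl hC
  · push Not at hC
    obtain ⟨f, hf, hC⟩ := hC
    exact h.false_of_degenerate hΛ hf hC

end Admissible

end

section DominantRoot

lemma pow_mul_two_sub_eq {R : Type*} [CommRing R] {k : ℕ} {β : R}
    (h : β ^ k = ∑ i ∈ Finset.range k, β ^ i) : β ^ k * (2 - β) = 1 := by
  have h1 := mul_geom_sum β k
  rw [← h] at h1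
  linear_combination -h1

/-- Two positive reals, one sub- and one super-root, are ordered. -/
lemma le_of_pow_le_sum {k : ℕ} (hk : 1 ≤ k) {r s : ℝ} (hr : 0 < r) (hs : 0 < s)
    (h1 : r ^ k ≤ ∑ i ∈ Finset.range k, r ^ i) (h2 : ∑ i ∈ Finset.range k, s ^ i ≤ s ^ k) :
    r ≤ s := by
  by_contra! hlt
  have hq : 1 < r / s := (one_lt_div hs).2 hlt
  have h3 : ∑ i ∈ Finset.range k, r ^ i ≤ (r / s) ^ (k - 1) * ∑ i ∈ Finset.range k, s ^ i := by
    rw [Finset.mul_sum]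
    refine Finset.sum_le_sum fun i hi => ?_
    have hi' := Finset.mem_range.1 hi
    calc r ^ i = (r / s) ^ i * s ^ i := by rw [← mul_pow, div_mul_cancel₀ _ hs.ne']
      _ ≤ (r / s) ^ (k - 1) * s ^ i := by
        gcongr
        · exact hq.le
        · omega
  have h4 : r ^ k = (r / s) ^ (k - 1) * s ^ k * (r / s) := by
    rw [mul_right_comm, ← pow_succ, Nat.sub_add_cancel hk, ← mul_pow, div_mul_cancel₀ _ hs.ne']
  have h5 : (r / s) ^ (k - 1) * s ^ k < (r / s) ^ (k - 1) * s ^ k * (r / s) :=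
    lt_mul_of_one_lt_right (by positivity) hq
  have h6 := mul_le_mul_of_nonneg_left h2 (show 0 ≤ (r / s) ^ (k - 1) by positivity)
  linarith

lemma cast_lt_pow {k : ℕ} (hk : 3 ≤ k) : (k : ℝ) < 1.8 ^ k := by
  induction k, hk using Nat.le_induction with
  | base => norm_num
  | succ k hk ih =>
    have : (3 : ℝ) ≤ k := by exact_mod_cast hk
    push_cast
    rw [pow_succ]
    linarith

/-- The dominant root of the characteristic polynomial of the `k`-Fibonacci sequence. -/
lemma exists_dominant_root {k : ℕ} (hk : 3 ≤ k) :
    ∃ α : ℝ, 1.8 ≤ α ∧ α < 2 ∧ α ^ k = ∑ i ∈ Finset.range k, α ^ i ∧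
      (∀ β : ℂ, β ^ k = ∑ i ∈ Finset.range k, β ^ i → β = α ∨ ‖β‖ ≤ 1) ∧ k * (2 - α) < 1 := by
  have hpow : (5 : ℝ) ≤ 1.8 ^ k := by
    calc (5 : ℝ) ≤ 1.8 ^ 3 := by norm_num
      _ ≤ _ := pow_le_pow_right₀ (by norm_num) hk
  obtain ⟨α, ⟨hα1, hα2⟩, hα⟩ : (1 : ℝ) ∈ (fun x : ℝ => x ^ k * (2 - x)) '' Set.Icc 1.8 2 := by
    refine intermediate_value_Icc' (by norm_num) (by fun_prop) ⟨by norm_num, ?_⟩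
    norm_num at hpow ⊢
    linarith
  simp only at hα
  have hlt : α < 2 := lt_of_le_of_ne hα2 fun h => by rw [h] at hα; norm_num at hα
  have hα0 : 0 < α := by linarith
  have hroot : α ^ k = ∑ i ∈ Finset.range k, α ^ i := by
    have h1 := mul_geom_sum α k
    have h2 : (α - 1) * (α ^ k - ∑ i ∈ Finset.range k, α ^ i) = 0 := by
      rw [mul_sub, h1]; linear_combination -hα
    have h3 := (mul_eq_zero.1 h2).resolve_left (by linarith)
    linarith
  refine ⟨α, hα1, hlt, hroot, fun β hβ => ?_, ?_⟩
  · by_cases hr : ‖β‖ ≤ 1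
    · exact Or.inr hr
    left
    push Not at hr
    have hβ' := pow_mul_two_sub_eq hβ
    have hn : ‖β‖ ^ k * ‖2 - β‖ = 1 := by rw [← norm_pow, ← norm_mul, hβ', norm_one]
    have h1 : ‖β‖ ^ k ≤ ∑ i ∈ Finset.range k, ‖β‖ ^ i := by
      rw [← norm_pow, hβ]
      refine (norm_sum_le _ _).trans (Finset.sum_le_sum fun i _ => (norm_pow _ _).le)
    have h2 : ∑ i ∈ Finset.range k, ‖β‖ ^ i ≤ ‖β‖ ^ k := by
      have e1 := mul_geom_sum ‖β‖ k
      have e2 : 2 - ‖β‖ ≤ ‖2 - β‖ := by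
        have := norm_sub_norm_le (2 : ℂ) β
        simpa using this
      have e3 := mul_le_mul_of_nonneg_left e2 (show 0 ≤ ‖β‖ ^ k by positivity)
      rw [hn] at e3
      have e4 : (‖β‖ - 1) * ∑ i ∈ Finset.range k, ‖β‖ ^ i ≤ (‖β‖ - 1) * ‖β‖ ^ k := by
        rw [e1]; linarith
      exact le_of_mul_le_mul_left e4 (by linarith)
    have hβα : ‖β‖ = α := le_antisymm
      (le_of_pow_le_sum (by omega) (by linarith) hα0 h1 hroot.ge)
      (le_of_pow_le_sum (by omega) hα0 (by linarith) hroot.le h2)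
    have h3 : ‖2 - β‖ = 2 - α := by
      rw [hβα] at hn
      exact mul_left_cancel₀ (by positivity : α ^ k ≠ 0) (hn.trans hα.symm)
    have h4 := Complex.sq_norm (2 - β)
    have h5 := Complex.sq_norm β
    rw [h3, Complex.normSq_apply] at h4
    rw [hβα, Complex.normSq_apply] at h5
    simp only [Complex.sub_re, Complex.sub_im, Complex.re_ofNat, Complex.im_ofNat] at h4
    have hre : β.re = α := by linarith
    have him : β.im = 0 := by
      rw [hre] at h5
      have : β.im * β.im = 0 := by linarith
      simpa using this
    exact Complex.ext (by simpa using hre) (by simpa using him)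
  · have h1 : (k : ℝ) < α ^ k :=
      (cast_lt_pow hk).trans_le (pow_le_pow_left₀ (by norm_num) hα1 k)
    rw [← hα]
    exact mul_lt_mul_of_pos_right h1 (by linarith)

end DominantRoot

/-- Solutions of the recurrence without dominant part are bounded by their initial values. -/
lemma abs_le_of_recurrence {k : ℕ} {α B : ℝ} (hα : 1.8 ≤ α)
    (hroot : α ^ k = ∑ i ∈ Finset.range k, α ^ i) (u : ℕ → ℝ)
    (hrec : ∀ j, u (j + k) = ∑ i ∈ Finset.range k, u (j + i))
    (h0 : ∑ i ∈ Finset.range k, α⁻¹ ^ (i + 1) * u i = ∑ i ∈ Finset.range k, u i)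
    (hB : ∀ i < k, |u i| ≤ B) (n : ℕ) : |u n| ≤ B := by
  have hα0 : 0 < α := by linarith
  have hinv : α * α⁻¹ = 1 := mul_inv_cancel₀ hα0.ne'
  have hak : α⁻¹ ^ k = 2 - α := by
    have := pow_mul_two_sub_eq hroot
    rw [inv_pow]
    exact (eq_inv_of_mul_eq_one_right this).symm
  have hshift : ∀ (g : ℕ → ℝ), ∑ i ∈ Finset.range k, g (i + 1) =
      ∑ i ∈ Finset.range k, g i - g 0 + g k := fun g => by
    have := Finset.sum_range_succ' g k
    rw [Finset.sum_range_succ] at this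
    linarith
  have hnext : ∀ j, ∑ i ∈ Finset.range k, u (j + 1 + i) = 2 * u (j + k) - u j := by
    intro j
    have := hshift fun i => u (j + i)
    simp only [add_zero] at this
    rw [Finset.sum_congr rfl fun i _ => by rw [show j + 1 + i = j + (i + 1) by ring], this, ← hrec]
    ring
  have hM : ∀ j, ∑ i ∈ Finset.range k, α⁻¹ ^ (i + 1) * u (j + i) = u (j + k) := by
    intro j
    induction j with
    | zero => rw [hrec]; simpa using h0
    | succ j ih =>
      have e1 := hshift fun i => α⁻¹ ^ (i + 1) * u (j + i)
      simp only [add_zero, zero_add, pow_one] at e1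
      have e2 : ∑ i ∈ Finset.range k, α⁻¹ ^ (i + 1) * u (j + 1 + i) =
          α * ∑ i ∈ Finset.range k, α⁻¹ ^ (i + 1 + 1) * u (j + (i + 1)) := by
        rw [Finset.mul_sum]
        refine Finset.sum_congr rfl fun i _ => ?_
        rw [show j + 1 + i = j + (i + 1) by ring, pow_succ _ (i + 1)]
        linear_combination (-(α⁻¹ ^ (i + 1) * u (j + (i + 1)))) * hinv
      rw [e2, e1, ih, show j + 1 + k = (j + 1) + k by ring, hrec (j + 1), hnext, pow_succ, hak]
      linear_combination ((2 - α) * u (j + k) - u j) * hinv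
  have hconv : ∀ j, (1 - α⁻¹ ^ k) * u (j + k) =
      ∑ i ∈ Finset.range k, (α⁻¹ ^ i - α⁻¹ ^ (i + 1)) * u (j + i) := by
    intro j
    have e1 := hshift fun i => α⁻¹ ^ i * u (j + i)
    simp only [add_zero, pow_zero, one_mul] at e1
    have e2 := hM (j + 1)
    rw [Finset.sum_congr rfl fun i _ => by rw [show j + 1 + i = j + (i + 1) by ring], e1,
      hrec (j + 1), hnext] at e2
    rw [Finset.sum_congr rfl fun i _ => sub_mul _ _ _, Finset.sum_sub_distrib, hM]
    linarith
  have hak1 : 0 < 1 - α⁻¹ ^ k := by rw [hak]; linarith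
  induction n using Nat.strong_induction_on with
  | _ n ih =>
    rcases lt_or_ge n k with hn | hn
    · exact hB n hn
    obtain ⟨j, rfl⟩ : ∃ j, n = j + k := ⟨n - k, by omega⟩
    have h1 : (1 - α⁻¹ ^ k) * |u (j + k)| ≤ (1 - α⁻¹ ^ k) * B := by
      rw [← abs_of_pos hak1, ← abs_mul, abs_of_pos hak1, hconv]
      refine (Finset.abs_sum_le_sum_abs _ _).trans ?_
      have e1 : (1 - α⁻¹ ^ k) * B =
          ∑ i ∈ Finset.range k, (α⁻¹ ^ i - α⁻¹ ^ (i + 1)) * B := by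
        rw [← Finset.sum_mul, Finset.sum_range_sub' (fun i => α⁻¹ ^ i), pow_zero]
      rw [e1]
      refine Finset.sum_le_sum fun i hi => ?_
      have e2 : 0 ≤ α⁻¹ ^ i - α⁻¹ ^ (i + 1) := by
        rw [sub_nonneg]
        exact pow_le_pow_of_le_one (by positivity) (inv_le_one_of_one_le₀ (by linarith))
          (Nat.le_succ i)
      rw [abs_mul, abs_of_nonneg e2]
      exact mul_le_mul_of_nonneg_left (ih _ (by have := Finset.mem_range.1 hi; omega)) e2
    exact le_of_mul_le_mul_left h1 hak1

section Sequences

lemma kfib_of_lt {k j : ℕ} (hj : j < k - 1) : kfib k j = 0 := by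
  rw [kfib]
  split_ifs <;> rfl

lemma kfib_sub_one {k : ℕ} (hk : 2 ≤ k) : kfib k (k - 1) = 1 := by
  rw [kfib, if_neg (by omega), if_neg (by omega), if_pos rfl]

lemma kfib_add {k : ℕ} (hk : 2 ≤ k) (j : ℕ) :
    kfib k (j + k) = ∑ i ∈ Finset.range k, kfib k (j + i) := by
  rw [kfib, if_neg (by omega), if_neg (by omega), if_neg (by omega),
    ← Finset.sum_range_reflect (fun i => kfib k (j + i))]
  refine Finset.sum_congr rfl fun i hi => ?_
  rw [show j + k - 1 - i = j + (k - 1 - i) by have := Finset.mem_range.1 hi; omega]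

lemma kfib_nonneg {k : ℕ} (hk : 2 ≤ k) (j : ℕ) : 0 ≤ kfib k j := by
  induction j using Nat.strong_induction_on with
  | _ j ih =>
    rcases lt_trichotomy j (k - 1) with h | h | h
    · rw [kfib_of_lt h]
    · rw [h, kfib_sub_one hk]; exact zero_le_one
    · obtain ⟨i, rfl⟩ : ∃ i, j = i + k := ⟨j - k, by omega⟩
      rw [kfib_add hk]
      exact Finset.sum_nonneg fun r hr => ih _ (by have := Finset.mem_range.1 hr; omega)

lemma one_le_kfib {k : ℕ} (hk : 2 ≤ k) (j : ℕ) : 1 ≤ kfib k (j + (k - 1)) := by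
  induction j with
  | zero => rw [zero_add, kfib_sub_one hk]
  | succ j ih =>
    rw [show j + 1 + (k - 1) = j + k by omega, kfib_add hk]
    exact ih.trans (Finset.single_le_sum (f := fun i => kfib k (j + i))
      (fun i _ => kfib_nonneg hk _) (Finset.mem_range.2 (by omega)))

lemma abs_kfib_sub_le {k : ℕ} (hk : 3 ≤ k) {α : ℝ} (hα : 1.8 ≤ α) (hα2 : α < 2)
    (hroot : α ^ k = ∑ i ∈ Finset.range k, α ^ i) (hlt : k * (2 - α) < 1) (n : ℕ) :
    |(kfib k (n + (k - 1)) : ℝ) - (α - 1) / ((k + 1) * α - 2 * k) * α ^ n| ≤ 1 := by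
  have hα0 : 0 < α := by linarith
  have hD : 0 < (k + 1) * α - 2 * k := by linarith
  have hinv : α * α⁻¹ = 1 := mul_inv_cancel₀ hα0.ne'
  have hp := pow_mul_two_sub_eq hroot
  have hak : α⁻¹ ^ k = 2 - α := by
    rw [inv_pow]
    exact (eq_inv_of_mul_eq_one_right hp).symm
  set f := (α - 1) / ((k + 1) * α - 2 * k) with hf
  have hfD : f * ((k + 1) * α - 2 * k) = α - 1 := div_mul_cancel₀ _ hD.ne'
  have hf0 : 0 < f := div_pos (by linarith) hD
  have hf1 : f ≤ 1 := by rw [hf, div_le_one hD]; linarith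
  set g := f * (α * (2 - α)) with hg
  have hg0 : 0 < g := mul_pos hf0 (mul_pos hα0 (by linarith))
  have hgk : g * α ^ (k - 1) = f := by
    have : α ^ k = α ^ (k - 1) * α := by rw [← pow_succ, Nat.sub_add_cancel (by omega)]
    rw [this] at hp
    linear_combination f * hp
  have key := abs_le_of_recurrence (B := 1) hα hroot (fun j => (kfib k j : ℝ) - g * α ^ j)
    ?_ ?_ ?_ (n + (k - 1))
  · simp only [pow_add] at key
    rwa [show g * (α ^ n * α ^ (k - 1)) = f * α ^ n by rw [← hgk]; ring] at key
  · intro j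
    rw [kfib_add (by omega), pow_add, hroot, Finset.sum_sub_distrib, Finset.mul_sum, Finset.mul_sum]
    push_cast
    congr 1
    exact Finset.sum_congr rfl fun i _ => by rw [pow_add]
  · obtain ⟨r, rfl⟩ : ∃ r, k = r + 1 := ⟨k - 1, by omega⟩
    have hz : ∀ i ∈ Finset.range r, kfib (r + 1) i = 0 := fun i hi =>
      kfib_of_lt (by simpa using hi)
    have h1 : kfib (r + 1) r = 1 := by simpa using kfib_sub_one (k := r + 1) (by omega)
    have e1 : ∑ i ∈ Finset.range (r + 1), (kfib (r + 1) i : ℝ) = 1 := by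
      rw [Finset.sum_range_succ, Finset.sum_eq_zero fun i hi => by simp [hz i hi], h1]
      simp
    have e2 : ∑ i ∈ Finset.range (r + 1), α⁻¹ ^ (i + 1) * (kfib (r + 1) i : ℝ) = 2 - α := by
      rw [Finset.sum_range_succ, Finset.sum_eq_zero fun i hi => by simp [hz i hi], h1, hak]
      simp
    have e3 : ∀ i, α⁻¹ ^ (i + 1) * (g * α ^ i) = g * α⁻¹ := fun i => by
      have : α⁻¹ ^ i * α ^ i = 1 := by rw [← mul_pow, inv_mul_cancel₀ hα0.ne', one_pow]
      rw [pow_succ]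
      linear_combination g * α⁻¹ * this
    simp only [mul_sub, Finset.sum_sub_distrib, e3, e1, e2]
    rw [Finset.sum_const, Finset.card_range, nsmul_eq_mul, ← Finset.mul_sum, ← hroot]
    push_cast at hfD ⊢
    rw [hg]
    linear_combination hfD + f * α * hp - ((r + 1) * f * (2 - α)) * hinv
  · intro i hi
    rcases Nat.lt_or_ge i (k - 1) with h | h
    · have e1 : g * α ^ i ≤ g * α ^ (k - 1) := by
        gcongr
        · linarith
      have e2 : 0 < g * α ^ i := by positivity
      rw [kfib_of_lt h, Int.cast_zero, zero_sub, abs_neg, abs_of_pos e2]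
      linarith
    · obtain rfl : i = k - 1 := by omega
      rw [hgk, kfib_sub_one (by omega), Int.cast_one, abs_le]
      constructor <;> linarith

lemma pell_eq (ℓ : ℕ) : 2 * √2 * (pell ℓ : ℝ) = (1 + √2) ^ ℓ - (1 - √2) ^ ℓ := by
  have h2 : √2 * √2 = 2 := Real.mul_self_sqrt (by norm_num)
  induction ℓ using Nat.twoStepInduction with
  | zero => simp [pell]
  | one => simp only [pell]; push_cast; ring
  | more n h0 h1 =>
    rw [pell]
    push_cast
    rw [pow_add (1 + √2), pow_add (1 - √2)]
    rw [pow_succ, pow_succ] at h1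
    linear_combination 2 * h1 + h0 + ((1 - √2) ^ n - (1 + √2) ^ n) * h2

lemma abs_pell_sub_le (ℓ : ℕ) : |2 * √2 * (pell ℓ : ℝ) - (1 + √2) ^ ℓ| ≤ 1 := by
  rw [pell_eq, sub_right_comm, sub_self, zero_sub, abs_neg, abs_pow]
  refine pow_le_one₀ (abs_nonneg _) ?_
  have h2 : √2 * √2 = 2 := Real.mul_self_sqrt (by norm_num)
  have := Real.sqrt_nonneg 2
  rw [abs_le]
  constructor <;> nlinarith

end Sequences

section Numerics

lemma one_lt_log_of_three_le {k : ℕ} (hk : 3 ≤ k) : 1.09 < Real.log k := by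
  have h3 : (3 : ℝ) ≤ k := by exact_mod_cast hk
  rw [Real.lt_log_iff_exp_lt (by linarith)]
  refine lt_of_lt_of_le ?_ h3
  have h1 : Real.exp 1.09 = Real.exp 1 * Real.exp 0.09 := by rw [← Real.exp_add]; norm_num
  have h2 := Real.exp_bound' (show (0 : ℝ) ≤ 0.09 by norm_num) (by norm_num) (n := 3) (by norm_num)
  norm_num [Finset.sum_range_succ, Nat.factorial] at h2
  have h4 := Real.exp_one_lt_d9
  have h5 := Real.exp_pos 1
  rw [h1]
  nlinarith

/-- Parameters for the linear forms attached to a large index `n`. -/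
lemma exists_parameters {k n : ℕ} (hk : 3 ≤ k)
    (hn : 8.3e30 * (k : ℝ) ^ 8 * Real.log k ^ 5 ≤ n) :
    ∃ η L : ℕ, 2 ≤ η ∧ 2 * Real.log (3 * k + 1) ≤ η ∧ 1 ≤ L ∧ 2.5 * Real.log n ≤ L ∧
      1e21 * (k : ℝ) ^ 8 * η * L ^ 4 ≤ n := by
  have hx := one_lt_log_of_three_le hk
  set x := Real.log k with hxdef
  have hk3 : (3 : ℝ) ≤ k := by exact_mod_cast hk
  have hx0 : 0 < x := by linarith
  set N : ℝ := 8.3e30 * (k : ℝ) ^ 8 * x ^ 5 with hN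
  have hk8 : (1 : ℝ) ≤ (k : ℝ) ^ 8 := one_le_pow₀ (by linarith)
  have hx5 : (1 : ℝ) ≤ x ^ 5 := one_le_pow₀ (by linarith)
  have hN1 : 8.3e30 ≤ N := by
    rw [hN]
    calc (8.3e30 : ℝ) = 8.3e30 * 1 * 1 := by norm_num
      _ ≤ _ := by gcongr
  have hN0 : 0 < N := by linarith
  have hn0 : (0 : ℝ) < n := by linarith
  have hlogN : Real.log N ≤ 74 * x := by
    rw [hN, Real.log_mul (by positivity) (by positivity), Real.log_mul (by positivity)
      (by positivity), Real.log_pow, Real.log_pow]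
    have h1 : Real.log 8.3e30 ≤ 103 * Real.log 2 := by
      have : (103 : ℝ) * Real.log 2 = Real.log (2 ^ 103) := by rw [Real.log_pow]; norm_num
      rw [this]
      exact Real.log_le_log (by norm_num) (by norm_num)
    have h2 := Real.log_two_lt_d9
    have h3 := Real.log_le_sub_one_of_pos hx0
    push_cast
    rw [← hxdef]
    linarith
  set s : ℝ := (n / N) ^ (1 / 4 : ℝ) with hs
  have hr1 : 1 ≤ n / N := (one_le_div hN0).2 hn
  have hs1 : 1 ≤ s := Real.one_le_rpow hr1 (by norm_num)
  have hs4 : s ^ 4 = n / N := by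
    rw [hs, ← Real.rpow_natCast, ← Real.rpow_mul (by linarith)]
    norm_num
  have hlogn : Real.log n ≤ 74 * x * s := by
    have h1 : (n : ℝ) = N * s ^ 4 := by rw [hs4, mul_div_cancel₀ _ hN0.ne']
    rw [h1, Real.log_mul hN0.ne' (by positivity), Real.log_pow]
    have h2 := Real.log_le_sub_one_of_pos (show 0 < s by linarith)
    push_cast
    nlinarith
  have hlogn50 : 50 ≤ Real.log n := by
    rw [Real.le_log_iff_exp_le hn0]
    have h1 : Real.exp 50 = Real.exp 1 ^ 50 := by rw [← Real.exp_nat_mul]; norm_num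
    have h2 : Real.exp 1 ^ 50 ≤ 2.7182818286 ^ 50 :=
      pow_le_pow_left₀ (Real.exp_pos 1).le Real.exp_one_lt_d9.le 50
    rw [h1]
    refine h2.trans (le_trans ?_ (hN1.trans hn))
    norm_num
  have hlog : 2 * Real.log (3 * k + 1) ≤ 4.5 * x := by
    have h1 : Real.log ((3 * k + 1) ^ 4) ≤ Real.log ((k : ℝ) ^ 9) := by
      refine Real.log_le_log (by positivity) ?_
      calc (3 * k + 1 : ℝ) ^ 4 ≤ (10 / 3 * k) ^ 4 := by gcongr; linarith
        _ = (10 / 3) ^ 4 * (k : ℝ) ^ 4 := by ring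
        _ ≤ 3 ^ 5 * (k : ℝ) ^ 4 := by gcongr; norm_num
        _ ≤ (k : ℝ) ^ 5 * (k : ℝ) ^ 4 := by gcongr
        _ = (k : ℝ) ^ 9 := by ring
    rw [Real.log_pow, Real.log_pow] at h1
    push_cast at h1
    rw [← hxdef] at h1
    linarith
  have hη := Nat.ceil_lt_add_one (a := 2 * Real.log (3 * k + 1))
    (by have := Real.log_nonneg (show (1 : ℝ) ≤ 3 * k + 1 by linarith); linarith)
  have hL := Nat.ceil_lt_add_one (a := 2.5 * Real.log n) (by linarith)
  have hη' := Nat.le_ceil (2 * Real.log (3 * k + 1))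
  have hL' := Nat.le_ceil (2.5 * Real.log n)
  set η := ⌈2 * Real.log (3 * k + 1)⌉₊
  set L := ⌈2.5 * Real.log n⌉₊
  have hLs : (L : ℝ) ≤ 186.48 * x * s := by linarith
  refine ⟨η, L, ?_, hη', ?_, hL', ?_⟩
  · have h1 : x ≤ Real.log (3 * k + 1) := Real.log_le_log (by linarith) (by linarith)
    have h2 : (2 : ℝ) ≤ η := by linarith
    exact_mod_cast h2
  · have h2 : (1 : ℝ) ≤ L := by linarith
    exact_mod_cast h2
  · calc 1e21 * (k : ℝ) ^ 8 * η * L ^ 4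
        ≤ 1e21 * (k : ℝ) ^ 8 * (5.42 * x) * (186.48 * x * s) ^ 4 := by gcongr; linarith
      _ = (1e21 * 5.42 * 186.48 ^ 4) * ((k : ℝ) ^ 8 * x ^ 5) * (n / N) := by rw [← hs4]; ring
      _ ≤ 8.3e30 * ((k : ℝ) ^ 8 * x ^ 5) * (n / N) := by gcongr; norm_num
      _ = N * (n / N) := by rw [hN]; ring
      _ = n := mul_div_cancel₀ _ hN0.ne'

end Numerics

lemma abs_log_lt_of_abs_sub_one {y δ ε : ℝ} (hy : 0 < y) (h : |y - 1| ≤ δ) (hε : ε ≤ 1)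
    (hlog : ε < |Real.log y|) : ε < 2 * δ := by
  rcases lt_or_ge (1 / 2) δ with hδ | hδ
  · linarith
  rw [abs_le] at h
  refine hlog.trans_le (abs_le.2 ⟨?_, ?_⟩)
  · have h1 := Real.one_sub_inv_le_log_of_pos hy
    have h2 : y⁻¹ ≤ 1 + 2 * δ := by
      rw [inv_le_iff_one_le_mul₀ hy]
      nlinarith
    linarith
  · have h1 := Real.log_le_sub_one_of_pos hy
    linarith

lemma exp_seven_halves_gt : (20 : ℝ) < Real.exp 3.5 := by
  have := Real.sum_le_exp_of_nonneg (show (0 : ℝ) ≤ 3.5 by norm_num) 6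
  norm_num [Finset.sum_range_succ, Nat.factorial] at this
  linarith

lemma Admissible.exponent_lt {k e c η L b₁ b₂ : ℕ} {α H : ℝ}
    (h : Admissible k e c η L b₁ b₂ α H) (m : ℕ)
    (hm : |(1 + √2) ^ b₂ - formCoeff k e c α * α ^ b₁| * α ^ m ≤
      10 * (formCoeff k e c α * α ^ b₁)) :
    (m : ℝ) < 2 * (8e9 * (k : ℝ) ^ 4 * η * L ^ 2) + 7 := by
  have hα : 0 < α := by linarith [h.lower]
  have hf := h.formCoeff_pos
  have hγ : 0 < 1 + √2 := by linarith [one_add_sqrt_two_bounds.1]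
  have hmain := h.exp_lt_abs_linear_form
  set B := 8e9 * (k : ℝ) ^ 4 * η * L ^ 2 with hB
  have hB0 : 0 ≤ B := by positivity
  have hden : 0 < formCoeff k e c α * α ^ b₁ := by positivity
  have hαm : 0 < α ^ m := by positivity
  have hlog : Real.log ((1 + √2) ^ b₂ / (formCoeff k e c α * α ^ b₁)) =
      -(b₁ * Real.log α - b₂ * Real.log (1 + √2) + Real.log (formCoeff k e c α)) := by
    rw [Real.log_div (by positivity) hden.ne', Real.log_mul hf.ne' (by positivity), Real.log_pow,
      Real.log_pow]
    ring
  have h1 : Real.exp (-B) < 2 * (10 / α ^ m) := by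
    refine abs_log_lt_of_abs_sub_one (y := (1 + √2) ^ b₂ / (formCoeff k e c α * α ^ b₁))
      (by positivity) ?_ (Real.exp_le_one_iff.2 (by linarith)) ?_
    · rw [div_sub_one hden.ne', abs_div, abs_of_pos hden, div_le_div_iff₀ hden hαm]
      exact hm
    · rw [hlog, abs_neg]
      exact hmain
  have h2 : Real.exp (m / 2) ≤ α ^ m := by
    rw [← Real.exp_log hαm, Real.exp_le_exp, Real.log_pow]
    have := h.log_gt
    have hm0 : (0 : ℝ) ≤ m := by positivity
    nlinarith
  have h3 : Real.exp (-B) * α ^ m < 20 := by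
    have := (lt_div_iff₀ hαm).1 (show Real.exp (-B) < 20 / α ^ m by
      convert h1 using 1; ring)
    exact this
  have h4 : Real.exp (-B + m / 2) < Real.exp 3.5 := by
    rw [Real.exp_add]
    exact ((mul_le_mul_of_nonneg_left h2 (Real.exp_pos _).le).trans_lt h3).trans
      exp_seven_halves_gt
  have := Real.exp_lt_exp.1 h4
  linarith

lemma formCoeff_eq (k e c : ℕ) (α : ℝ) :
    formCoeff k e c α = c * √2 * ((α - 1) / ((k + 1) * α - 2 * k)) ^ e := by
  rw [formCoeff, div_pow, mul_div_assoc]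

/-- The size conditions on the parameters of a linear form hold for large `n`. -/
lemma admissible_of_le {k e c η η₁ L b₁ ℓ n : ℕ} {α H : ℝ} (hk : 3 ≤ k) (hα : 1.8 ≤ α)
    (hα2 : α < 2) (hroot : α ^ k = ∑ i ∈ Finset.range k, α ^ i)
    (hconj : ∀ β : ℂ, β ^ k = ∑ i ∈ Finset.range k, β ^ i → β = α ∨ ‖β‖ ≤ 1)
    (hlt : k * (2 - α) < 1) (hc : 1 ≤ c) (hH₁ : c * √2 * 2 ^ e ≤ H)
    (hH₂ : (3 * k + 1 : ℝ) ^ e ≤ H) (hHη : H ≤ Real.exp η) (hη : 2 ≤ η)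
    (hlog : |Real.log (formCoeff k e c α)| ≤ η)
    (hη₁ : 1 ≤ η₁) (hL : 1 ≤ L) (hηle : (η : ℝ) ≤ 1.7e10 * (k : ℝ) ^ 4 * η₁ * L ^ 2)
    (hn : 1e21 * (k : ℝ) ^ 8 * η₁ * L ^ 4 ≤ n) (hnL : 2.5 * Real.log n ≤ L)
    (hb₁ : b₁ ≤ 2 * ℓ) (hnℓ : n ≤ 2 * ℓ) (hℓ : ℓ ≤ 2 * n + 1) :
    Admissible k e c η L b₁ ℓ α H := by
  have hk' : (3 : ℝ) ≤ k := by exact_mod_cast hk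
  have hη₁' : (1 : ℝ) ≤ η₁ := by exact_mod_cast hη₁
  have hL' : (1 : ℝ) ≤ L := by exact_mod_cast hL
  have hkp : ∀ i, (1 : ℝ) ≤ (k : ℝ) ^ i := fun i => one_le_pow₀ (by linarith)
  have hnℓ' : (n : ℝ) ≤ 2 * ℓ := by exact_mod_cast hnℓ
  have hℓ' : (ℓ : ℝ) ≤ 2 * n + 1 := by exact_mod_cast hℓ
  set Z := (k : ℝ) ^ 8 * η₁ * L ^ 4 with hZ
  have hn' : 1e21 * Z ≤ n := by rw [hZ]; linarith
  have hkZ : (k : ℝ) ^ 8 ≤ Z := by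
    rw [hZ, mul_assoc]
    exact le_mul_of_one_le_right (by positivity)
      (one_le_mul_of_one_le_of_one_le hη₁' (one_le_pow₀ hL'))
  have hZ1 : 1 ≤ Z := (hkp 8).trans hkZ
  have hn1 : 1 ≤ (n : ℝ) := by linarith
  refine ⟨hk, hroot, hα, hα2, by linarith, hconj, hc, hH₁, hH₂, hHη, hη, hlog, hb₁, ?_, ?_, hL⟩
  · have h1 : (2 : ℝ) * (η * (2500000 * k ^ 2 * L) + 1) ≤ ℓ := by
      have h2 : (η : ℝ) * (2500000 * k ^ 2 * L) ≤ 4.25e16 * Z := by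
        calc (η : ℝ) * (2500000 * k ^ 2 * L)
            ≤ 1.7e10 * (k : ℝ) ^ 4 * η₁ * L ^ 2 * (2500000 * k ^ 2 * L) := by gcongr
          _ = 4.25e16 * ((k : ℝ) ^ 6 * η₁ * L ^ 3) := by ring
          _ ≤ 4.25e16 * Z := by
            rw [hZ]
            gcongr <;> linarith
      linarith
    exact_mod_cast h1
  · have h1 : 2e13 * (k : ℝ) ^ 5 * η * L ^ 2 * ℓ ≤ 1020 * k * n ^ 2 := by
      calc 2e13 * (k : ℝ) ^ 5 * η * L ^ 2 * ℓ
          ≤ 2e13 * (k : ℝ) ^ 5 * (1.7e10 * (k : ℝ) ^ 4 * η₁ * L ^ 2) * L ^ 2 * (3 * n) := by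
            gcongr
            linarith
        _ = 1.02e24 * k * n * Z := by rw [hZ]; ring
        _ ≤ 1.02e24 * k * n * (n / 1e21) := by
            gcongr
            rw [le_div_iff₀ (by norm_num)]
            linarith
        _ = 1020 * k * n ^ 2 := by ring
    refine h1.trans (abs_le_of_sq_le_sq' ?_ (Real.exp_pos _).le).2
    have h2 : (n : ℝ) ^ 5 ≤ Real.exp L ^ 2 := by
      rw [← Real.exp_nat_mul, ← Real.log_le_iff_le_exp (by positivity), Real.log_pow]
      push_cast
      linarith
    refine le_trans ?_ h2
    have h3 : 1020 ^ 2 * (k : ℝ) ^ 2 ≤ n := by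
      have : (k : ℝ) ^ 2 ≤ (k : ℝ) ^ 8 := pow_le_pow_right₀ (by linarith) (by norm_num)
      linarith
    calc (1020 * k * (n : ℝ) ^ 2) ^ 2 = 1020 ^ 2 * (k : ℝ) ^ 2 * (n : ℝ) ^ 4 := by ring
      _ ≤ n * (n : ℝ) ^ 4 := by gcongr
      _ = (n : ℝ) ^ 5 := by ring

section Solutions

lemma div_sub_bounds {k : ℕ} (hk : 3 ≤ k) {α : ℝ} (hα : 1.8 ≤ α) (hα2 : α < 2)
    (hlt : k * (2 - α) < 1) :
    1 / 2 ≤ (α - 1) / ((k + 1) * α - 2 * k) ∧ (α - 1) / ((k + 1) * α - 2 * k) ≤ 1 := by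
  have hD : 0 < (k + 1) * α - 2 * k := by linarith
  have hk' : (3 : ℝ) ≤ k := by exact_mod_cast hk
  constructor
  · rw [le_div_iff₀ hD]
    nlinarith
  · rw [div_le_one hD]
    linarith

lemma le_of_kfib_mul_kfib_eq_pell {n m k ℓ : ℕ} (hk : 3 ≤ k) (hm : 3 ≤ m) (hmn : m < n)
    (heq : kfib k (n + k - 2) * kfib k (m + k - 2) = pell ℓ) : ℓ ≤ 2 * n + 1 := by
  obtain ⟨α, hα, hα2, hroot, -, hlt⟩ := exists_dominant_root hk
  obtain ⟨hf1, hf2⟩ := div_sub_bounds hk hα hα2 hlt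
  have hup : ∀ r, (kfib k (r + (k - 1)) : ℝ) ≤ 2 ^ (r + 1) := by
    intro r
    have h1 := (abs_le.1 (abs_kfib_sub_le hk hα hα2 hroot hlt r)).2
    have h2 : α ^ r ≤ 2 ^ r := pow_le_pow_left₀ (by linarith) hα2.le r
    have h3 : (α - 1) / ((k + 1) * α - 2 * k) * α ^ r ≤ α ^ r :=
      mul_le_of_le_one_left (by positivity) hf2
    have h4 : (1 : ℝ) ≤ 2 ^ r := one_le_pow₀ (by norm_num)
    rw [pow_succ]
    linarith
  have hn' := hup (n - 1)
  have hm' := hup (m - 1)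
  rw [show n - 1 + (k - 1) = n + k - 2 by omega, Nat.sub_add_cancel (by omega)] at hn'
  rw [show m - 1 + (k - 1) = m + k - 2 by omega, Nat.sub_add_cancel (by omega)] at hm'
  have hP : (pell ℓ : ℝ) ≤ 2 ^ n * 2 ^ n := by
    rw [← heq]
    push_cast
    have h0 : (0 : ℝ) ≤ kfib k (m + k - 2) := by exact_mod_cast kfib_nonneg (by omega) _
    refine mul_le_mul hn' (hm'.trans ?_) h0 (by positivity)
    exact pow_le_pow_right₀ (by norm_num) hmn.le
  have hγ := one_add_sqrt_two_bounds
  have h1 := (abs_le.1 (abs_pell_sub_le ℓ)).1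
  by_contra! hℓ
  have h2 : (1 + √2) ^ (2 * (n + 1)) ≤ (1 + √2) ^ ℓ :=
    pow_le_pow_right₀ (by linarith) (by omega)
  have h3 : (4 : ℝ) ^ (n + 1) ≤ (1 + √2) ^ (2 * (n + 1)) := by
    rw [pow_mul]
    exact pow_le_pow_left₀ (by norm_num) (by nlinarith) _
  have h4 : (2 : ℝ) ^ n * 2 ^ n = 4 ^ n := by rw [← mul_pow]; norm_num
  have h5 : (4 : ℝ) ≤ 4 ^ n := le_self_pow₀ (by norm_num) (by omega)
  rw [h4] at hP
  rw [pow_succ] at h3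
  nlinarith

lemma div_six_le_of_abs_sub_le {A f X : ℝ} (hA : 1 ≤ A) (hf : 1 / 2 ≤ f) (hX : 0 < X)
    (h : |A - f * X| ≤ 1) : X / 6 ≤ A := by
  have h1 := (abs_le.1 h).1
  have h2 : 1 / 2 * X ≤ f * X := by gcongr
  by_contra! h3
  linarith

lemma le_two_mul_of_pow_le {α : ℝ} (hα : 1.8 ≤ α) {b ℓ : ℕ} (hb : 100 ≤ b)
    (h : α ^ b / 36 ≤ (1 + √2) ^ ℓ) : b ≤ 2 * ℓ := by
  have hα0 : 0 < α := by linarith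
  have h1 : (36 : ℝ) < Real.exp 4 := by
    have := Real.sum_le_exp_of_nonneg (show (0 : ℝ) ≤ 4 by norm_num) 6
    norm_num [Finset.sum_range_succ, Nat.factorial] at this
    linarith
  have h2 : 0.5 < Real.log α := by
    rw [Real.lt_log_iff_exp_lt hα0]
    have h1 := Real.exp_one_lt_d9
    have h2 : Real.exp 0.5 * Real.exp 0.5 = Real.exp 1 := by rw [← Real.exp_add]; norm_num
    have h3 := Real.exp_pos 0.5
    nlinarith
  have h3 := Real.log_le_log (by positivity) h
  rw [Real.log_div (by positivity) (by norm_num), Real.log_pow, Real.log_pow] at h3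
  have h4 : Real.log 36 < 4 := (Real.log_lt_iff_lt_exp (by norm_num)).2 h1
  have h5 := log_one_add_sqrt_two_lt
  have hb' : (100 : ℝ) ≤ b := by exact_mod_cast hb
  by_contra! hlt
  have hlt' : 2 * (ℓ : ℝ) + 1 ≤ b := by exact_mod_cast hlt
  have hℓ0 : (0 : ℝ) ≤ ℓ := by positivity
  nlinarith

/-- The analytic content of a solution: closeness of `(1 + √2) ^ ℓ` to its main terms. -/
lemma abs_sub_mul_le {α f A C P G X Y : ℝ} (hα0 : 0 < α) (hα2 : α < 2) (hf1 : 1 / 2 ≤ f)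
    (hX : 1 ≤ X) (hXY : 1.8 * X ≤ Y) (hY : 5.8 ≤ Y) (hC : 1 ≤ C)
    (hA : |A - f * Y| ≤ 1) (hCX : |C - f * X| ≤ 1) (hG : |2 * √2 * P - G| ≤ 1)
    (hP : A * C = P) :
    |G - 2 * √2 * f ^ 2 * (Y * X)| * (X * α) ≤ 10 * (2 * √2 * f ^ 2 * (Y * X)) ∧
      |G - 2 * C * √2 * f * Y| * (Y * α) ≤ 10 * (2 * C * √2 * f * Y) := by
  have hs : 1.414 < √2 := by linarith [one_add_sqrt_two_bounds.1]
  have hY0 : 0 < Y := by linarith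
  have hf0 : 0 < f := by linarith
  rw [abs_sub_comm] at hG
  constructor
  · have e1 : G - 2 * √2 * f ^ 2 * (Y * X) = (G - 2 * √2 * P) +
        2 * √2 * ((A - f * Y) * (C - f * X) + (A - f * Y) * (f * X) + f * Y * (C - f * X)) := by
      rw [← hP]; ring
    have e2 : |G - 2 * √2 * f ^ 2 * (Y * X)| ≤ 1 + 2 * √2 * (1 + f * X + f * Y) := by
      rw [e1]
      refine (abs_add_le _ _).trans (add_le_add hG ?_)
      rw [abs_mul (2 * √2), abs_of_pos (by positivity : 0 < 2 * √2)]
      gcongr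
      refine (abs_add_three _ _ _).trans ?_
      rw [abs_mul, abs_mul _ (f * X), abs_mul (f * Y), abs_of_pos (by positivity : 0 < f * X),
        abs_of_pos (by positivity : 0 < f * Y)]
      have a1 : |A - f * Y| * |C - f * X| ≤ 1 * 1 := by gcongr
      have a2 : |A - f * Y| * (f * X) ≤ 1 * (f * X) := by gcongr
      have a3 : f * Y * |C - f * X| ≤ f * Y * 1 := by gcongr
      linarith
    have e3 : (1 + 2 * √2 * (1 + f * X + f * Y)) ≤ 10 * √2 * f ^ 2 * Y := by
      have a1 : 1 / 2 * (f * Y) ≤ f ^ 2 * Y := by rw [sq, mul_assoc]; gcongr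
      have a2 : f * (1.8 * X) ≤ f * Y := by gcongr
      have a3 : 1 / 2 * 5.8 ≤ f * Y := by gcongr
      have a4 : 1 / 1.414 * 2 + 2 * (1 + f * X + f * Y) ≤ 10 * (f ^ 2 * Y) + 0.7075 := by
        linarith
      have a5 : 1 ≤ √2 * 0.7075 := by linarith
      have a6 : √2 * (0.7075 + 2 * (1 + f * X + f * Y)) ≤ √2 * (10 * (f ^ 2 * Y)) := by
        gcongr
        linarith
      linarith
    calc |G - 2 * √2 * f ^ 2 * (Y * X)| * (X * α)
        ≤ 10 * √2 * f ^ 2 * Y * (X * 2) := by gcongr; exact e2.trans e3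
      _ = 10 * (2 * √2 * f ^ 2 * (Y * X)) := by ring
  · have e1 : G - 2 * C * √2 * f * Y = (G - 2 * √2 * P) + 2 * √2 * (C * (A - f * Y)) := by
      rw [← hP]; ring
    have e2 : |G - 2 * C * √2 * f * Y| ≤ 1 + 2 * √2 * (C * 1) := by
      rw [e1]
      refine (abs_add_le _ _).trans (add_le_add hG ?_)
      rw [abs_mul, abs_mul C, abs_of_pos (by positivity : 0 < 2 * √2),
        abs_of_pos (by linarith : 0 < C)]
      gcongr
    have e3 : 1 + 2 * √2 * (C * 1) ≤ 10 * C * √2 * f := by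
      have a1 : 1 ≤ C * √2 := by nlinarith
      have a2 : C * √2 * (1 / 2) ≤ C * √2 * f := by gcongr
      linarith
    calc |G - 2 * C * √2 * f * Y| * (Y * α)
        ≤ 10 * C * √2 * f * (Y * 2) := by gcongr; exact e2.trans e3
      _ = 10 * (2 * C * √2 * f * Y) := by ring

set_option maxHeartbeats 1000000 in
lemma lt_of_kfib_mul_kfib_eq_pell {n m k ℓ : ℕ} (hk : 3 ≤ k) (hm : 3 ≤ m) (hmn : m < n)
    (heq : kfib k (n + k - 2) * kfib k (m + k - 2) = pell ℓ) :
    (n : ℝ) < 8.3e30 * (k : ℝ) ^ 8 * Real.log k ^ 5 := by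
  by_contra! hN
  obtain ⟨η, L, hη, hηlog, hL, hnL, hZ⟩ := exists_parameters hk hN
  obtain ⟨α, hα, hα2, hroot, hconj, hlt⟩ := exists_dominant_root hk
  obtain ⟨hf1, hf2⟩ := div_sub_bounds hk hα hα2 hlt
  have hℓ := le_of_kfib_mul_kfib_eq_pell hk hm hmn heq
  have hα0 : 0 < α := by linarith
  have hs := one_add_sqrt_two_bounds
  have hA := abs_kfib_sub_le hk hα hα2 hroot hlt (n - 1)
  have hC := abs_kfib_sub_le hk hα hα2 hroot hlt (m - 1)
  have hA1 := one_le_kfib (k := k) (by omega) (n - 1)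
  have hC1 := one_le_kfib (k := k) (by omega) (m - 1)
  rw [show n - 1 + (k - 1) = n + k - 2 by omega] at hA hA1
  rw [show m - 1 + (k - 1) = m + k - 2 by omega] at hC hC1
  have hG := abs_pell_sub_le ℓ
  have hk' : (3 : ℝ) ≤ k := by exact_mod_cast hk
  have hη' : (2 : ℝ) ≤ η := by exact_mod_cast hη
  have hL' : (1 : ℝ) ≤ L := by exact_mod_cast hL
  have hkp : ∀ i, (1 : ℝ) ≤ (k : ℝ) ^ i := fun i => one_le_pow₀ (by linarith)
  have hL2 : (1 : ℝ) ≤ (L : ℝ) ^ 2 := one_le_pow₀ hL'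
  set Q := (k : ℝ) ^ 4 * η * L ^ 2 with hQ
  have hηQ : (η : ℝ) ≤ Q := by
    have a1 : 1 * (η : ℝ) * 1 ≤ (k : ℝ) ^ 4 * η * L ^ 2 := by gcongr; exact hkp 4
    linarith
  have hZQ : 1e21 * (k ^ 4 * Q * L ^ 2) ≤ n := by
    rw [hQ]
    linarith
  have hZQ' : Q ≤ k ^ 4 * Q * L ^ 2 := by
    have hQ0 : 0 ≤ Q := by positivity
    have a1 : 1 * Q * 1 ≤ (k : ℝ) ^ 4 * Q * L ^ 2 := by gcongr; exact hkp 4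
    linarith
  have hn100 : 100 ≤ n := by
    have : (100 : ℝ) ≤ n := by linarith
    exact_mod_cast this
  obtain ⟨c, hc⟩ := Int.eq_ofNat_of_zero_le (kfib_nonneg (by omega : 2 ≤ k) (m + k - 2))
  rw [hc] at hC hC1 heq
  set A := kfib k (n + k - 2)
  rw [← heq] at hG
  push_cast at hC hG
  have hc1 : 1 ≤ c := by exact_mod_cast hC1
  have hc1' : (1 : ℝ) ≤ c := by exact_mod_cast hc1
  have hA1' : (1 : ℝ) ≤ A := by exact_mod_cast hA1
  have hcoef₁ := formCoeff_eq k 2 2 α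
  have hcoef₂ := formCoeff_eq k 1 (2 * c) α
  set f := (α - 1) / ((k + 1) * α - 2 * k) with hf
  have hX2 : (1.8 : ℝ) ^ 2 ≤ α ^ (m - 1) :=
    (pow_le_pow_right₀ (by norm_num) (by omega)).trans (pow_le_pow_left₀ (by norm_num) hα _)
  have hX : 1 ≤ α ^ (m - 1) := by linarith
  have hXY : 1.8 * α ^ (m - 1) ≤ α ^ (n - 1) := by
    calc 1.8 * α ^ (m - 1) ≤ α * α ^ (m - 1) := by gcongr
      _ = α ^ m := by rw [← pow_succ', Nat.sub_add_cancel (by omega)]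
      _ ≤ _ := pow_le_pow_right₀ (by linarith) (by omega)
  obtain ⟨hclose₁, hclose₂⟩ := abs_sub_mul_le (P := A * c) hα0 hα2 hf1 hX hXY
    (by linarith) hc1' hA hC hG rfl
  rw [← pow_succ, Nat.sub_add_cancel (by omega), ← pow_add,
    show n - 1 + (m - 1) = n + m - 2 by omega] at hclose₁
  rw [← pow_succ, Nat.sub_add_cancel (by omega)] at hclose₂
  have hb : n + m - 2 ≤ 2 * ℓ := by
    refine le_two_mul_of_pow_le hα (by omega) ?_
    have a1 := div_six_le_of_abs_sub_le hA1' hf1 (by positivity) hA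
    have a2 := div_six_le_of_abs_sub_le hc1' hf1 (by positivity) hC
    have a3 : α ^ (n - 1) / 6 * (α ^ (m - 1) / 6) ≤ A * c := by gcongr
    have a4 : α ^ (n + m - 2) / 36 = α ^ (n - 1) / 6 * (α ^ (m - 1) / 6) := by
      rw [show n + m - 2 = n - 1 + (m - 1) by omega, pow_add]; ring
    have a5 := (abs_le.1 hG).2
    have a6 : 1 ≤ (A : ℝ) * c := one_le_mul_of_one_le_of_one_le hA1' hc1'
    nlinarith
  have hexpη : (3 * k + 1 : ℝ) ^ 2 ≤ Real.exp η := by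
    rw [← Real.log_le_iff_le_exp (by positivity), Real.log_pow]
    exact_mod_cast hηlog
  have hexp1 := Real.exp_one_gt_d9
  have hexp2 : 7 < Real.exp 2 := by
    have : Real.exp 2 = Real.exp 1 * Real.exp 1 := by rw [← Real.exp_add]; norm_num
    nlinarith
  have hadm₁ : Admissible k 2 2 η L (n + m - 2) ℓ α ((3 * k + 1) ^ 2) := by
    refine admissible_of_le hk hα hα2 hroot hconj hlt (by norm_num) ?_ le_rfl hexpη hη ?_
      (by omega) hL (by linarith) hZ hnL hb (by omega) hℓ
    · push_cast
      nlinarith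
    · rw [hcoef₁]
      have b1 : (1 / 2 : ℝ) ^ 2 ≤ f ^ 2 := by gcongr
      have b2 : f ^ 2 ≤ 1 := pow_le_one₀ (by linarith) hf2
      push_cast
      have b3 : 2 * √2 * (1 / 2 : ℝ) ^ 2 ≤ 2 * √2 * f ^ 2 := by gcongr
      have b4 : 2 * √2 * f ^ 2 ≤ 2 * √2 * 1 := by gcongr
      refine (abs_le.2 ⟨?_, ?_⟩).trans hη'
      · rw [Real.le_log_iff_exp_le (by linarith), Real.exp_neg]
        have : (Real.exp 2)⁻¹ ≤ 7⁻¹ := inv_anti₀ (by norm_num) hexp2.le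
        linarith
      · rw [Real.log_le_iff_le_exp (by linarith)]
        linarith
  have hm₁ := hadm₁.exponent_lt m (by rw [hcoef₁]; exact_mod_cast hclose₁)
  have hmQ : (m : ℝ) < 1.6e10 * Q + 7 := by rw [hQ]; linarith
  have hη₂ : ((m + 2 + η : ℕ) : ℝ) ≤ 1.7e10 * Q := by
    push_cast
    linarith
  have hexpm : 2 ^ m * 7 ≤ Real.exp (m + 2 : ℕ) := by
    push_cast
    rw [Real.exp_add]
    have : (2 : ℝ) ^ m ≤ Real.exp m := by
      rw [← Real.exp_one_pow]
      exact pow_le_pow_left₀ (by norm_num) (by linarith) m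
    gcongr
  have hcm : (c : ℝ) ≤ 2 ^ m := by
    have b1 := (abs_le.1 hC).2
    have b2 : α ^ (m - 1) ≤ 2 ^ (m - 1) := pow_le_pow_left₀ hα0.le hα2.le _
    have b3 : f * α ^ (m - 1) ≤ α ^ (m - 1) := mul_le_of_le_one_left (by positivity) hf2
    have b4 : (1 : ℝ) ≤ 2 ^ (m - 1) := one_le_pow₀ (by norm_num)
    have b5 : (2 : ℝ) ^ m = 2 ^ (m - 1) * 2 := by rw [← pow_succ, Nat.sub_add_cancel (by omega)]
    linarith
  have hcs : (c : ℝ) * √2 ≤ 2 ^ m * 1.5 := by gcongr; linarith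
  have hcs1 : 1 ≤ (c : ℝ) * √2 := one_le_mul_of_one_le_of_one_le hc1' (by linarith)
  have hadm₂ : Admissible k 1 (2 * c) (m + 2 + η) L (n - 1) ℓ α (Real.exp (m + 2 + η : ℕ)) := by
    refine admissible_of_le hk hα hα2 hroot hconj hlt (by omega) ?_ ?_ le_rfl (by omega) ?_
      (by omega) hL (by linarith) hZ hnL (by omega) (by omega) hℓ
    · rw [Nat.cast_add, Real.exp_add]
      have b1 : 1 ≤ Real.exp η := Real.one_le_exp (by linarith)
      have b2 : Real.exp (m + 2 : ℕ) * 1 ≤ Real.exp (m + 2 : ℕ) * Real.exp η := by gcongr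
      push_cast at b2 hexpm ⊢
      linarith
    · have b1 : Real.exp η ≤ Real.exp (m + 2 + η : ℕ) := by
        rw [Real.exp_le_exp]
        exact_mod_cast (by omega : η ≤ m + 2 + η)
      have b2 : (3 * k + 1 : ℝ) ^ 1 ≤ (3 * k + 1) ^ 2 :=
        pow_le_pow_right₀ (by linarith) (by norm_num)
      exact b2.trans (hexpη.trans b1)
    · rw [hcoef₂]
      push_cast
      have b1 : c * √2 * (1 / 2) ≤ c * √2 * f := by gcongr
      have b2 : c * √2 * f ≤ c * √2 * 1 := by gcongr
      rw [abs_of_nonneg (Real.log_nonneg (by linarith))]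
      refine le_trans ?_ (show ((m + 2 : ℕ) : ℝ) ≤ m + 2 + η by push_cast; linarith)
      rw [Real.log_le_iff_le_exp (by linarith)]
      linarith
  have hn₂ := hadm₂.exponent_lt n (by
    rw [hcoef₂]
    push_cast
    rw [pow_one]
    exact hclose₂)
  have hfin : 8e9 * (k : ℝ) ^ 4 * (m + 2 + η : ℕ) * L ^ 2 ≤
      8e9 * (k : ℝ) ^ 4 * (1.7e10 * Q) * L ^ 2 := by gcongr
  linarith

end Solutions

/-- If positive integers `(n, m, k, ℓ)` satisfy `F⁽ᵏ⁾_n · F⁽ᵏ⁾_m = P_ℓ` with `k ≥ 3`,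
`n > m ≥ 3` and `n ≥ k + 2`, then `n < 8.3 × 10³⁰ k⁸ (log k)⁵` and
`ℓ < 1.7 × 10³¹ k⁸ (log k)⁵`. -/
theorem n_ell_bounded (n m k ℓ : ℕ) (hk : 3 ≤ k) (hm : 3 ≤ m) (hmn : m < n)
    (hn : k + 2 ≤ n) (hℓ : 0 < ℓ)
    (heq : kfib k (n + k - 2) * kfib k (m + k - 2) = pell ℓ) :
    (n : ℝ) < 8.3e30 * (k : ℝ) ^ 8 * Real.log k ^ 5 ∧
      (ℓ : ℝ) < 1.7e31 * (k : ℝ) ^ 8 * Real.log k ^ 5 := by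
  have h1 := lt_of_kfib_mul_kfib_eq_pell hk hm hmn heq
  refine ⟨h1, ?_⟩
  have h2 : (ℓ : ℝ) ≤ 2 * n + 1 := by
    exact_mod_cast le_of_kfib_mul_kfib_eq_pell hk hm hmn heq
  have h3 : (1 : ℝ) ≤ (k : ℝ) ^ 8 * Real.log k ^ 5 :=
    one_le_mul_of_one_le_of_one_le (one_le_pow₀ (by exact_mod_cast (by omega : 1 ≤ k)))
      (one_le_pow₀ (by linarith [one_lt_log_of_three_le hk]))
  linarith
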